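/- arXiv:2301.06131 — 3 statements merged into one kernel-verified Lean document; each statement's English description precedes it below -/
import Mathlib

section
/- Let (K_t)_{t∈(a,b)} be a shadow system of convex bodies in ℝⁿ. Then the function t ↦ vol((K_t)^{s(K_t)})^{−1} = (min_{z ∈ int K_t} vol((K_t − z)*))^{−1} is convex on (a,b). -/
open MeasureTheory Filter
open scoped InnerProductSpace Pointwise NNReal ENNReal Topology

noncomputable section

/-- The polar of a set `K` in Euclidean space: `{y | ⟨x,y⟩ ≤ 1 for all x ∈ K}`. -/
def polarSet {n : ℕ} (K : Set (EuclideanSpace ℝ (Fin n))) : Set (EuclideanSpace ℝ (Fin n)) :=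
  {y | ∀ x ∈ K, ⟪x, y⟫_ℝ ≤ 1}

/-- A convex body: a compact convex set with nonempty interior. -/
structure IsConvexBody {n : ℕ} (K : Set (EuclideanSpace ℝ (Fin n))) : Prop where
  convex : Convex ℝ K
  isCompact : IsCompact K
  nonempty_interior : (interior K).Nonempty

/-- `vol(K^{s(K)}) = min_{z ∈ int K} vol((K - z)*)`, the minimal volume of the polar of `K`
with respect to interior points. -/
def minPolarVolume {n : ℕ} (K : Set (EuclideanSpace ℝ (Fin n))) : ℝ≥0∞ :=
  ⨅ z : interior K, volume (polarSet ((fun x => x - (z : EuclideanSpace ℝ (Fin n))) '' K))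

/-- A convex function on a normed space with at least linear growth, bounded below by a positive
constant. -/
def ConvexCoercive {E : Type*} [NormedAddCommGroup E] [NormedSpace ℝ E] (f : E → ℝ) : Prop :=
  ConvexOn ℝ Set.univ f ∧ ∃ ε > 0, ∀ x, ε * (1 + ‖x‖) ≤ f x

namespace ConvexCoercive

variable {E : Type*} [NormedAddCommGroup E] [NormedSpace ℝ E] {f : E → ℝ}

lemma pos (hf : ConvexCoercive f) (x : E) : 0 < f x := by
  obtain ⟨-, ε, hε, h⟩ := hf
  have := norm_nonneg x
  exact lt_of_lt_of_le (by positivity) (h x)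

lemma continuous [FiniteDimensional ℝ E] (hf : ConvexCoercive f) : Continuous f :=
  continuousOn_univ.1 (hf.1.continuousOn isOpen_univ)

lemma exists_isMin [FiniteDimensional ℝ E] (hf : ConvexCoercive f) : ∃ x, ∀ y, f x ≤ f y := by
  have hc := hf.continuous
  have : ProperSpace E := FiniteDimensional.proper ℝ E
  obtain ⟨-, ε, hε, h⟩ := hf
  refine hc.exists_forall_le ?_
  refine tendsto_atTop_mono h ?_
  refine Tendsto.const_mul_atTop hε ?_
  exact tendsto_atTop_add_const_left _ _ (tendsto_norm_cocompact_atTop)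

lemma isCompact_sublevel [FiniteDimensional ℝ E] (hf : ConvexCoercive f) (c : ℝ) :
    IsCompact {x | f x ≤ c} := by
  have : ProperSpace E := FiniteDimensional.proper ℝ E
  refine Metric.isCompact_of_isClosed_isBounded (isClosed_le hf.continuous continuous_const) ?_
  obtain ⟨-, ε, hε, h⟩ := hf
  refine (Metric.isBounded_closedBall (x := (0 : E)) (r := c / ε)).subset fun x hx => ?_
  rw [mem_closedBall_zero_iff, le_div_iff₀ hε]
  have := h x
  have hx' : f x ≤ c := hx
  nlinarith

end ConvexCoercive

lemma volume_convex_combination_le {A B C : Set ℝ} {a b : ℝ} (ha : 0 ≤ a) (hb : 0 ≤ b)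
    (hA : IsCompact A) (hB : IsCompact B) (hA' : A.Nonempty) (hB' : B.Nonempty)
    (hC : Convex ℝ C) (h : ∀ x ∈ A, ∀ y ∈ B, a * x + b * y ∈ C) :
    ENNReal.ofReal a * volume A + ENNReal.ofReal b * volume B ≤ volume C := by
  have key : ∀ {A : Set ℝ}, IsCompact A → volume A ≤ ENNReal.ofReal (sSup A - sInf A) := by
    intro A hA
    rw [← Real.volume_Icc]
    exact measure_mono (subset_Icc_csInf_csSup hA.bddBelow hA.bddAbove)
  have hle : ∀ {A : Set ℝ}, IsCompact A → A.Nonempty → 0 ≤ sSup A - sInf A := fun hA hA' =>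
    sub_nonneg.2 (csInf_le_csSup hA' hA.bddBelow hA.bddAbove)
  have hsub : Set.Icc (a * sInf A + b * sInf B) (a * sSup A + b * sSup B) ⊆ C :=
    hC.ordConnected.out (h _ (hA.sInf_mem hA') _ (hB.sInf_mem hB'))
      (h _ (hA.sSup_mem hA') _ (hB.sSup_mem hB'))
  calc _ ≤ ENNReal.ofReal a * ENNReal.ofReal (sSup A - sInf A)
        + ENNReal.ofReal b * ENNReal.ofReal (sSup B - sInf B) := by
        gcongr <;> exact key (by assumption)
    _ = ENNReal.ofReal ((a * sSup A + b * sSup B) - (a * sInf A + b * sInf B)) := by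
        have h1 := hle hA hA'
        have h2 := hle hB hB'
        rw [← ENNReal.ofReal_mul ha, ← ENNReal.ofReal_mul hb, ← ENNReal.ofReal_add (by positivity)
          (by positivity)]
        congr 1; ring
    _ ≤ _ := by
        rw [← Real.volume_Icc]
        exact measure_mono hsub

/-- The integral of `f⁻ᵏ`. -/
def invPowIntegral {E : Type*} [MeasureSpace E] (k : ℕ) (f : E → ℝ) : ℝ≥0∞ :=
  ∫⁻ x, ENNReal.ofReal ((f x ^ k)⁻¹)

lemma invPowIntegral_eq_levels {f : ℝ → ℝ} (hf : ConvexCoercive f) {k : ℕ} (hk : k ≠ 0) {m : ℝ}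
    (hm : 0 < m) : ENNReal.ofReal (m ^ k) * invPowIntegral k f =
      ∫⁻ s in Set.Ioi (0 : ℝ), volume {x | f x ≤ m * (s ^ (k : ℝ)⁻¹)⁻¹} := by
  have hc := hf.continuous
  have hp := hf.pos
  rw [invPowIntegral, ← lintegral_const_mul' _ _ ENNReal.ofReal_ne_top]
  simp_rw [← ENNReal.ofReal_mul (pow_pos hm k).le]
  rw [lintegral_eq_lintegral_meas_le]
  · refine setLIntegral_congr_fun measurableSet_Ioi fun s hs => ?_
    have hs' : 0 < s := hs
    congr 1
    ext x
    have hx := hp x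
    have hr : 0 < s ^ (k : ℝ)⁻¹ := by positivity
    simp only [Set.mem_ofPred_eq]
    nth_rewrite 1 [← Real.rpow_inv_natCast_pow hs'.le hk]
    rw [← inv_pow, ← mul_pow, pow_le_pow_iff_left₀ hr.le (by positivity) hk,
      ← div_eq_mul_inv, ← div_eq_mul_inv, le_div_iff₀ hx, le_div_iff₀ hr, mul_comm]
  · exact Eventually.of_forall fun x => by have := hp x; positivity
  · have : Measurable f := hc.measurable
    fun_prop

lemma exists_invPowIntegral_combination {f₀ f₁ f : ℝ → ℝ} (h₀ : ConvexCoercive f₀)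
    (h₁ : ConvexCoercive f₁) (hf : ConvexCoercive f) {a b : ℝ} (ha : 0 ≤ a) (hb : 0 ≤ b)
    (hab : a + b = 1) (h : ∀ x y, f (a * x + b * y) ≤ a * f₀ x + b * f₁ y) {k : ℕ} (hk : k ≠ 0) :
    ∃ m₀ > 0, ∃ m₁ > 0, ENNReal.ofReal (a * m₀ ^ k) * invPowIntegral k f₀
      + ENNReal.ofReal (b * m₁ ^ k) * invPowIntegral k f₁
      ≤ ENNReal.ofReal ((a * m₀ + b * m₁) ^ k) * invPowIntegral k f := by
  obtain ⟨x₀, hx₀⟩ := h₀.exists_isMin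
  obtain ⟨x₁, hx₁⟩ := h₁.exists_isMin
  have p₀ := h₀.pos x₀
  have p₁ := h₁.pos x₁
  refine ⟨f₀ x₀, p₀, f₁ x₁, p₁, ?_⟩
  have hm : 0 < a * f₀ x₀ + b * f₁ x₁ := by
    rcases ha.eq_or_lt with rfl | ha
    · obtain rfl : b = 1 := by linarith
      simpa using p₁
    · positivity
  rw [invPowIntegral_eq_levels hf hk hm, ENNReal.ofReal_mul ha, ENNReal.ofReal_mul hb, mul_assoc,
    mul_assoc, invPowIntegral_eq_levels h₀ hk p₀, invPowIntegral_eq_levels h₁ hk p₁]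
  rw [← lintegral_const_mul' _ _ ENNReal.ofReal_ne_top,
    ← lintegral_const_mul' _ _ ENNReal.ofReal_ne_top]
  refine (le_lintegral_add _ _).trans ?_
  refine setLIntegral_mono' measurableSet_Ioi fun s hs => ?_
  have hs' : (0 : ℝ) < s := hs
  set r := (s ^ (k : ℝ)⁻¹)⁻¹ with hr
  rcases le_or_gt s 1 with h1 | h1
  · have hr1 : 1 ≤ r := by
      rw [hr, one_le_inv₀ (by positivity)]
      exact Real.rpow_le_one hs'.le h1 (by positivity)
    refine volume_convex_combination_le ha hb (h₀.isCompact_sublevel _) (h₁.isCompact_sublevel _)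
      ⟨x₀, le_mul_of_one_le_right p₀.le hr1⟩ ⟨x₁, le_mul_of_one_le_right p₁.le hr1⟩ ?_ ?_
    · simpa using hf.1.convex_le ((a * f₀ x₀ + b * f₁ x₁) * r)
    · intro x hx y hy
      simp only [Set.mem_ofPred_eq] at hx hy ⊢
      refine (h x y).trans ?_
      nlinarith [mul_le_mul_of_nonneg_left hx ha, mul_le_mul_of_nonneg_left hy hb]
  · have hr1 : r < 1 := by
      rw [hr]
      exact inv_lt_one_of_one_lt₀ (Real.one_lt_rpow h1 (by positivity))
    have hz : ∀ {g : ℝ → ℝ} {x₀}, 0 < g x₀ → (∀ y, g x₀ ≤ g y) →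
        {x | g x ≤ g x₀ * r} = ∅ := by
      intro g x₀ hg hmin
      ext x
      simp only [Set.mem_ofPred_eq, Set.mem_empty_iff_false, iff_false, not_le]
      exact (mul_lt_of_lt_one_right hg hr1).trans_le (hmin x)
    simp [hz p₀ hx₀, hz p₁ hx₁]

lemma lintegral_inv_pow_linear_lt_top {k : ℕ} (hk : 2 ≤ k) :
    ∫⁻ x : ℝ, ENNReal.ofReal (((1 + |x|) ^ k)⁻¹) < ∞ := by
  have := finite_integral_one_add_norm (μ := (volume : Measure ℝ)) (r := k) (by simp; omega)
  simpa [Real.rpow_neg, Real.rpow_natCast, add_nonneg] using this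

lemma exists_invPowIntegral_le {k : ℕ} (hk : 2 ≤ k) : ∃ C > 0, ∀ (f : ℝ → ℝ) (ε c : ℝ), 0 < ε →
    0 < c → (∀ x, ε * (c + |x|) ≤ f x) →
    invPowIntegral k f ≤ ENNReal.ofReal (C * (ε ^ k * c ^ (k - 1))⁻¹) := by
  have hfin := lintegral_inv_pow_linear_lt_top hk
  set I := ∫⁻ x : ℝ, ENNReal.ofReal (((1 + |x|) ^ k)⁻¹) with hI
  refine ⟨I.toReal + 1, by positivity, fun f ε c hε hc h => ?_⟩
  have h1 : ∀ x, ENNReal.ofReal ((f x ^ k)⁻¹) ≤ ENNReal.ofReal ((ε ^ k * c ^ k)⁻¹) *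
      ENNReal.ofReal (((1 + |c⁻¹ * x|) ^ k)⁻¹) := by
    intro x
    rw [← ENNReal.ofReal_mul (by positivity), ← mul_inv, ← mul_pow, ← mul_pow]
    refine ENNReal.ofReal_le_ofReal ?_
    have : 0 < ε * c * (1 + |c⁻¹ * x|) := by positivity
    gcongr
    refine le_trans (le_of_eq ?_) (h x)
    rw [abs_mul, abs_of_pos (inv_pos.2 hc)]
    field_simp
  calc invPowIntegral k f ≤ ∫⁻ x, ENNReal.ofReal ((ε ^ k * c ^ k)⁻¹) *
      ENNReal.ofReal (((1 + |c⁻¹ * x|) ^ k)⁻¹) := lintegral_mono h1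
    _ = ENNReal.ofReal ((ε ^ k * c ^ k)⁻¹) * (ENNReal.ofReal c * I) := by
      rw [lintegral_const_mul' _ _ ENNReal.ofReal_ne_top]
      congr 1
      have hm := Real.map_volume_mul_left (a := c⁻¹) (by positivity)
      rw [inv_inv, abs_of_pos hc] at hm
      rw [← lintegral_map (f := fun x : ℝ => ENNReal.ofReal (((1 + |x|) ^ k)⁻¹))
        (g := fun x => c⁻¹ * x) (by fun_prop) (by fun_prop), hm, lintegral_smul_measure,
        smul_eq_mul]
    _ ≤ ENNReal.ofReal ((ε ^ k * c ^ k)⁻¹) *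
        (ENNReal.ofReal c * ENNReal.ofReal (I.toReal + 1)) := by
      gcongr
      refine (ENNReal.ofReal_toReal hfin.ne).symm.le.trans (ENNReal.ofReal_le_ofReal ?_)
      linarith
    _ = _ := by
      rw [← ENNReal.ofReal_mul hc.le, ← ENNReal.ofReal_mul (by positivity)]
      congr 1
      obtain ⟨k, rfl⟩ := Nat.exists_eq_add_of_le' (show 1 ≤ k by omega)
      simp only [Nat.add_sub_cancel]
      field_simp
      ring

lemma invPowIntegral_pos {E : Type*} [NormedAddCommGroup E] [NormedSpace ℝ E]
    [FiniteDimensional ℝ E] [MeasureSpace E] [BorelSpace E] [NeZero (volume : Measure E)]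
    {f : E → ℝ} (hf : ConvexCoercive f) (k : ℕ) :
    0 < invPowIntegral k f := by
  have hc := hf.continuous.measurable
  rw [invPowIntegral, lintegral_pos_iff_support (by fun_prop)]
  have : Function.support (fun x => ENNReal.ofReal ((f x ^ k)⁻¹)) = Set.univ := by
    ext x
    have := hf.pos x
    simp only [Function.mem_support, Set.mem_univ, iff_true]
    exact (ENNReal.ofReal_pos.2 (by positivity)).ne'
  simp [this, NeZero.ne]

lemma invPowIntegral_lt_top {f : ℝ → ℝ} (hf : ConvexCoercive f) {k : ℕ} (hk : 2 ≤ k) :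
    invPowIntegral k f < ∞ := by
  obtain ⟨-, ε, hε, h⟩ := hf
  obtain ⟨C, -, hC⟩ := exists_invPowIntegral_le hk
  exact (hC f ε 1 hε one_pos h).trans_lt ENNReal.ofReal_lt_top

/-- The power mean `(∫ f^{-(j+1)})^{-1/j}`. -/
def powMean (j : ℕ) (f : ℝ → ℝ) : ℝ := ((invPowIntegral (j + 1) f).toReal⁻¹) ^ (j : ℝ)⁻¹

section powMean

variable {j : ℕ} {f : ℝ → ℝ}

lemma powMean_pos (hf : ConvexCoercive f) (hj : 1 ≤ j) : 0 < powMean j f := by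
  have := ENNReal.toReal_pos (invPowIntegral_pos hf (j + 1)).ne'
    (invPowIntegral_lt_top hf (by omega)).ne
  rw [powMean]; positivity

lemma invPowIntegral_eq_powMean (hf : ConvexCoercive f) (hj : 1 ≤ j) :
    invPowIntegral (j + 1) f = ENNReal.ofReal ((powMean j f ^ j)⁻¹) := by
  rw [powMean, Real.rpow_inv_natCast_pow (by positivity) (by omega), inv_inv,
    ENNReal.ofReal_toReal (invPowIntegral_lt_top hf (by omega)).ne]

lemma powMean_combination {f₀ f₁ f : ℝ → ℝ} (h₀ : ConvexCoercive f₀)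
    (h₁ : ConvexCoercive f₁) (hf : ConvexCoercive f) {a b : ℝ} (ha : 0 ≤ a) (hb : 0 ≤ b)
    (hab : a + b = 1) (h : ∀ x y, f (a * x + b * y) ≤ a * f₀ x + b * f₁ y) (hj : 1 ≤ j) :
    powMean j f ≤ a * powMean j f₀ + b * powMean j f₁ := by
  obtain ⟨m₀, p₀, m₁, p₁, hm⟩ :=
    exists_invPowIntegral_combination h₀ h₁ hf ha hb hab h (k := j + 1) (by omega)
  rw [invPowIntegral_eq_powMean h₀ hj, invPowIntegral_eq_powMean h₁ hj,
    invPowIntegral_eq_powMean hf hj] at hm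
  have q₀ := powMean_pos h₀ hj
  have q₁ := powMean_pos h₁ hj
  have q := powMean_pos hf hj
  set I₀ := powMean j f₀
  set I₁ := powMean j f₁
  set I := powMean j f
  have hpos : ∀ {u v : ℝ}, 0 < u → 0 < v → 0 < a * u + b * v := by
    intro u v hu hv
    rcases ha.eq_or_lt with rfl | ha
    · obtain rfl : b = 1 := by linarith
      simpa using hv
    · positivity
  set m := a * m₀ + b * m₁ with hmdef
  have hmpos : 0 < m := hpos p₀ p₁
  have hIpos : 0 < a * I₀ + b * I₁ := hpos q₀ q₁
  rw [← ENNReal.ofReal_mul (by positivity), ← ENNReal.ofReal_mul (by positivity),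
    ← ENNReal.ofReal_mul (by positivity), ← ENNReal.ofReal_add (by positivity) (by positivity),
    ENNReal.ofReal_le_ofReal_iff (by positivity)] at hm
  have w₀ : 0 ≤ a * m₀ / m := by positivity
  have w₁ : 0 ≤ b * m₁ / m := by positivity
  have hJ := (convexOn_zpow (𝕜 := ℝ) (-(j : ℤ))).2 (div_pos q₀ p₀) (div_pos q₁ p₁) w₀ w₁
    (by field_simp; exact hmdef.symm)
  have e1 : (a * m₀ / m) • (I₀ / m₀) + (b * m₁ / m) • (I₁ / m₁) = (a * I₀ + b * I₁) / m := by
    simp only [smul_eq_mul]; field_simp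
  rw [e1] at hJ
  simp only [zpow_neg, zpow_natCast, smul_eq_mul, div_pow, inv_div] at hJ
  have key : m ^ j * (I ^ j)⁻¹ ≥ m ^ j * ((a * I₀ + b * I₁) ^ j)⁻¹ := by
    calc _ = (m ^ (j + 1) * (I ^ j)⁻¹) / m := by field_simp; ring
      _ ≥ (a * m₀ ^ (j + 1) * (I₀ ^ j)⁻¹ + b * m₁ ^ (j + 1) * (I₁ ^ j)⁻¹) / m := by gcongr
      _ = a * m₀ / m * (m₀ ^ j / I₀ ^ j) + b * m₁ / m * (m₁ ^ j / I₁ ^ j) := by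
        field_simp
        ring
      _ ≥ _ := by simpa [div_eq_mul_inv] using hJ
  have k2 := le_of_mul_le_mul_left key (by positivity)
  rw [inv_le_inv₀ (by positivity) (by positivity)] at k2
  exact (pow_le_pow_iff_left₀ q.le hIpos.le (by omega)).1 k2

lemma exists_le_powMean (hj : 1 ≤ j) : ∃ C > 0, ∀ (f : ℝ → ℝ) (ε c : ℝ), ConvexCoercive f →
    0 < ε → 0 < c → (∀ x, ε * (c + |x|) ≤ f x) →
      C * (ε ^ (j + 1)) ^ (j : ℝ)⁻¹ * c ≤ powMean j f := by
  obtain ⟨C, hC, h⟩ := exists_invPowIntegral_le (show 2 ≤ j + 1 by omega)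
  refine ⟨C⁻¹ ^ (j : ℝ)⁻¹, by positivity, fun f ε c hf hε hc hle => ?_⟩
  have h1 := h f ε c hε hc hle
  have q := powMean_pos hf hj
  have hj' : j ≠ 0 := by omega
  rw [invPowIntegral_eq_powMean hf hj, ENNReal.ofReal_le_ofReal_iff (by positivity)] at h1
  refine (pow_le_pow_iff_left₀ (by positivity) q.le hj').1 ?_
  rw [mul_pow, mul_pow, Real.rpow_inv_natCast_pow (by positivity) hj',
    Real.rpow_inv_natCast_pow (by positivity) hj']
  rw [inv_le_comm₀ (by positivity) (by positivity)] at h1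
  refine le_trans (le_of_eq ?_) h1
  simp only [mul_inv, inv_inv, Nat.add_sub_cancel, mul_assoc]

end powMean

section slice

variable {m : ℕ} {f : (Fin (m + 1) → ℝ) → ℝ}

lemma cons_combination (a b u v : ℝ) (x y : Fin m → ℝ) :
    (Fin.cons (a * u + b * v) (a • x + b • y) : Fin (m + 1) → ℝ)
      = a • (Fin.cons u x : Fin (m + 1) → ℝ) + b • (Fin.cons v y : Fin (m + 1) → ℝ) := by
  ext i
  refine Fin.cases ?_ (fun i => ?_) i <;> simp

lemma norm_add_norm_le_norm_cons (u : ℝ) (x : Fin m → ℝ) :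
    |u| + ‖x‖ ≤ 2 * ‖(Fin.cons u x : Fin (m + 1) → ℝ)‖ := by
  have h1 : |u| ≤ ‖(Fin.cons u x : Fin (m + 1) → ℝ)‖ := by
    simpa using norm_le_pi_norm (Fin.cons u x : Fin (m + 1) → ℝ) 0
  have h2 : ‖x‖ ≤ ‖(Fin.cons u x : Fin (m + 1) → ℝ)‖ :=
    (pi_norm_le_iff_of_nonneg (norm_nonneg _)).2 fun i => by
      simpa using norm_le_pi_norm (Fin.cons u x : Fin (m + 1) → ℝ) i.succ
  linarith

lemma ConvexCoercive.exists_slice_bound (hf : ConvexCoercive f) :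
    ∃ ε > 0, ∀ x u, ε * ((1 + ‖x‖) + |u|) ≤ f (Fin.cons u x) := by
  obtain ⟨-, ε, hε, h⟩ := hf
  refine ⟨ε / 2, by positivity, fun x u => le_trans ?_ (h _)⟩
  have := norm_add_norm_le_norm_cons u x
  nlinarith

lemma ConvexCoercive.slice (hf : ConvexCoercive f) (x : Fin m → ℝ) :
    ConvexCoercive fun u => f (Fin.cons u x) := by
  refine ⟨⟨convex_univ, fun u _ v _ a b ha hb hab => ?_⟩, ?_⟩
  · have := cons_combination a b u v x x
    rw [← add_smul, hab, one_smul] at this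
    simp only [smul_eq_mul]
    rw [this]
    exact hf.1.2 trivial trivial ha hb hab
  · obtain ⟨ε, hε, h⟩ := hf.exists_slice_bound
    refine ⟨ε, hε, fun u => le_trans ?_ (h x u)⟩
    have := norm_nonneg x
    rw [Real.norm_eq_abs]
    gcongr
    linarith

/-- Integrate out the first coordinate. -/
def marginal (f : (Fin (m + 1) → ℝ) → ℝ) (x : Fin m → ℝ) : ℝ :=
  powMean (m + 1) fun u => f (Fin.cons u x)

lemma marginal_combination {f₀ f₁ f : (Fin (m + 1) → ℝ) → ℝ} (h₀ : ConvexCoercive f₀)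
    (h₁ : ConvexCoercive f₁) (hf : ConvexCoercive f) {a b : ℝ} (ha : 0 ≤ a) (hb : 0 ≤ b)
    (hab : a + b = 1) (h : ∀ x y, f (a • x + b • y) ≤ a * f₀ x + b * f₁ y) (x y : Fin m → ℝ) :
    marginal f (a • x + b • y) ≤ a * marginal f₀ x + b * marginal f₁ y := by
  refine powMean_combination (h₀.slice x) (h₁.slice y) (hf.slice _) ha hb hab (fun u v => ?_)
    (by omega)
  rw [cons_combination]
  exact h _ _

lemma ConvexCoercive.marginal (hf : ConvexCoercive f) : ConvexCoercive (marginal f) := by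
  refine ⟨⟨convex_univ, fun x _ y _ a b ha hb hab => marginal_combination hf hf hf ha hb hab
    (fun x y => hf.1.2 trivial trivial ha hb hab) x y⟩, ?_⟩
  obtain ⟨ε, hε, h⟩ := hf.exists_slice_bound
  obtain ⟨C, hC, hle⟩ := exists_le_powMean (show 1 ≤ m + 1 by omega)
  exact ⟨C * (ε ^ (m + 1 + 1)) ^ ((m + 1 : ℕ) : ℝ)⁻¹, by positivity, fun x =>
    hle _ ε (1 + ‖x‖) (hf.slice x) hε (by positivity) (h x)⟩

lemma invPowIntegral_marginal (hf : ConvexCoercive f) :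
    invPowIntegral (m + 2) f = invPowIntegral (m + 1) (marginal f) := by
  have hc := hf.continuous.measurable
  have hmp := (volume_preserving_piFinSuccAbove (fun _ : Fin (m + 1) => ℝ) 0).symm
  rw [invPowIntegral, ← hmp.lintegral_comp_emb (MeasurableEquiv.measurableEmbedding _),
    Measure.volume_eq_prod, lintegral_prod_symm _ (by fun_prop)]
  refine lintegral_congr fun x => ?_
  rw [marginal, ← invPowIntegral_eq_powMean (hf.slice x) (by omega), invPowIntegral]
  refine lintegral_congr fun u => ?_
  simp [MeasurableEquiv.piFinSuccAbove, Fin.insertNthEquiv]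

end slice

/-- A Borell–Brascamp–Lieb inequality for convex functions with linear growth. -/
lemma inv_invPowIntegral_combination : ∀ {m : ℕ} {f₀ f₁ f : (Fin m → ℝ) → ℝ}, ConvexCoercive f₀ →
    ConvexCoercive f₁ → ConvexCoercive f → ∀ {a b : ℝ}, 0 ≤ a → 0 ≤ b → a + b = 1 →
    (∀ x y, f (a • x + b • y) ≤ a * f₀ x + b * f₁ y) →
    (invPowIntegral (m + 1) f).toReal⁻¹ ≤
      a * (invPowIntegral (m + 1) f₀).toReal⁻¹ + b * (invPowIntegral (m + 1) f₁).toReal⁻¹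
  | 0, f₀, f₁, f, h₀, h₁, hf, a, b, ha, hb, hab, h => by
    have key : ∀ {g : (Fin 0 → ℝ) → ℝ}, ConvexCoercive g →
        (invPowIntegral (0 + 1) g).toReal⁻¹ = g 0 := by
      intro g hg
      have := hg.pos 0
      have hd : ∀ d, g d = g 0 := fun d => congrArg g (Subsingleton.elim d 0)
      rw [invPowIntegral, lintegral_unique, hd]
      simp only [zero_add, pow_one, Measure.volume_pi_eq_dirac 0, measure_univ, mul_one]
      rw [ENNReal.toReal_ofReal (by positivity), inv_inv]
    rw [key h₀, key h₁, key hf]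
    simpa using h 0 0
  | m + 1, f₀, f₁, f, h₀, h₁, hf, a, b, ha, hb, hab, h => by
    rw [invPowIntegral_marginal h₀, invPowIntegral_marginal h₁, invPowIntegral_marginal hf]
    exact inv_invPowIntegral_combination h₀.marginal h₁.marginal hf.marginal ha hb hab
      (marginal_combination h₀ h₁ hf ha hb hab h)

lemma invPowIntegral_ne_top : ∀ {m : ℕ} {f : (Fin m → ℝ) → ℝ}, ConvexCoercive f →
    invPowIntegral (m + 1) f ≠ ∞
  | 0, f, hf => by
    rw [invPowIntegral, lintegral_unique]
    simp [Measure.volume_pi_eq_dirac 0]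
  | m + 1, f, hf => by
    rw [invPowIntegral_marginal hf]
    exact invPowIntegral_ne_top hf.marginal

/-- Euclidean coordinates on the hyperplane orthogonal to a unit vector `θ`. -/
structure OrthogonalFrame {m : ℕ} (θ : EuclideanSpace ℝ (Fin (m + 1))) where
  /-- The parametrization of the hyperplane. -/
  toLin : (Fin m → ℝ) →L[ℝ] EuclideanSpace ℝ (Fin (m + 1))
  inner_toLin : ∀ w, ⟪θ, toLin w⟫_ℝ = 0
  norm_le : ∀ w, ‖w‖ ≤ ‖toLin w‖
  exists_eq : ∀ u, ⟪θ, u⟫_ℝ = 1 → ∃ w, u = θ + toLin w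
  measurePreserving : MeasurePreserving fun p : ℝ × (Fin m → ℝ) => p.1 • θ + toLin p.2

lemma exists_orthogonalFrame {m : ℕ} {θ : EuclideanSpace ℝ (Fin (m + 1))} (hθ : ‖θ‖ = 1) :
    Nonempty (OrthogonalFrame θ) := by
  obtain ⟨b, hb⟩ := Orthonormal.exists_orthonormalBasis_extension_of_card_eq (𝕜 := ℝ)
    (E := EuclideanSpace ℝ (Fin (m + 1))) (ι := Fin (m + 1)) (by simp) (v := fun _ => θ)
    (s := {0}) (by
      rw [orthonormal_iff_ite]
      rintro ⟨i, rfl⟩ ⟨j, rfl⟩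
      simp [Set.domRestrict, hθ])
  have hb0 : b 0 = θ := hb 0 rfl
  let L : (Fin m → ℝ) →ₗ[ℝ] EuclideanSpace ℝ (Fin (m + 1)) :=
    { toFun := fun w => ∑ i, w i • b i.succ
      map_add' := fun x y => by simp [add_smul, Finset.sum_add_distrib]
      map_smul' := fun c x => by simp [mul_smul, Finset.smul_sum] }
  have hL : ∀ w, L w = ∑ i, w i • b i.succ := fun w => rfl
  have hT : ∀ (s : ℝ) w, s • θ + L w =
      b.repr.symm (WithLp.toLp 2 (Fin.cons s w : Fin (m + 1) → ℝ)) := by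
    intro s w
    rw [← b.sum_repr_symm, ← hb0, hL, Fin.sum_univ_succ]
    simp
  have hT0 : ∀ w, L w = b.repr.symm (WithLp.toLp 2 (Fin.cons 0 w : Fin (m + 1) → ℝ)) := by
    intro w
    rw [← hT]
    simp
  refine ⟨⟨L.toContinuousLinearMap, fun w => ?_, fun w => ?_, fun u hu => ?_, ?_⟩⟩
  · simp only [LinearMap.coe_toContinuousLinearMap', hT0, ← hb0]
    rw [← b.repr_apply_apply]
    simp
  · simp only [LinearMap.coe_toContinuousLinearMap', hT0, LinearIsometryEquiv.norm_map]
    refine (pi_norm_le_iff_of_nonneg (norm_nonneg _)).2 fun i => ?_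
    simpa using PiLp.norm_apply_le (WithLp.toLp 2 (Fin.cons 0 w : Fin (m + 1) → ℝ)) i.succ
  · refine ⟨fun i => b.repr u i.succ, ?_⟩
    rw [← hb0, ← b.repr_apply_apply] at hu
    have := b.sum_repr u
    rw [Fin.sum_univ_succ, hu, one_smul, hb0] at this
    exact this.symm
  · have h := (b.measurePreserving_repr_symm.comp
      (PiLp.volume_preserving_toLp (Fin (m + 1)))).comp
      (volume_preserving_piFinSuccAbove (fun _ : Fin (m + 1) => ℝ) 0).symm
    have e : (fun p : ℝ × (Fin m → ℝ) => p.1 • θ + L.toContinuousLinearMap p.2) =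
        (b.repr.symm ∘ WithLp.toLp 2) ∘
          (MeasurableEquiv.piFinSuccAbove (fun _ : Fin (m + 1) => ℝ) 0).symm := by
      funext p
      simp [hT, MeasurableEquiv.piFinSuccAbove, Fin.insertNthEquiv]
    rw [e]
    exact h

/-- The volume of the part of the polar of `K - z` lying in the half space `⟪θ, y⟫ > 0`. -/
def halfPolarVolume {n : ℕ} (θ : EuclideanSpace ℝ (Fin n)) (K : Set (EuclideanSpace ℝ (Fin n)))
    (z : EuclideanSpace ℝ (Fin n)) : ℝ≥0∞ :=
  volume ({y | 0 < ⟪θ, y⟫_ℝ} ∩ polarSet ((fun x => x - z) '' K))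

lemma isClosed_polarSet {n : ℕ} (K : Set (EuclideanSpace ℝ (Fin n))) :
    IsClosed (polarSet K) := by
  have : polarSet K = ⋂ x ∈ K, {y | ⟪x, y⟫_ℝ ≤ 1} := by ext; simp [polarSet]
  rw [this]
  exact isClosed_biInter fun x _ => isClosed_le (by fun_prop) continuous_const

lemma measurableSet_halfPolar {n : ℕ} (θ : EuclideanSpace ℝ (Fin n))
    (K : Set (EuclideanSpace ℝ (Fin n))) (z : EuclideanSpace ℝ (Fin n)) :
    MeasurableSet ({y | 0 < ⟪θ, y⟫_ℝ} ∩ polarSet ((fun x => x - z) '' K)) :=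
  (isOpen_lt continuous_const (by fun_prop)).measurableSet.inter
    (isClosed_polarSet _).measurableSet

namespace OrthogonalFrame

variable {m : ℕ} {θ : EuclideanSpace ℝ (Fin (m + 1))} (F : OrthogonalFrame θ)
  {K : Set (EuclideanSpace ℝ (Fin (m + 1)))} {z : EuclideanSpace ℝ (Fin (m + 1))}

/-- The support function of `K - z` on the affine hyperplane `θ + θᗮ`. -/
def support (K : Set (EuclideanSpace ℝ (Fin (m + 1)))) (z : EuclideanSpace ℝ (Fin (m + 1)))
    (w : Fin m → ℝ) : ℝ :=
  sSup ((fun x => ⟪x - z, θ + F.toLin w⟫_ℝ) '' K)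

lemma inner_le_support (hK : IsConvexBody K) {x : EuclideanSpace ℝ (Fin (m + 1))} (hx : x ∈ K)
    (w : Fin m → ℝ) : ⟪x - z, θ + F.toLin w⟫_ℝ ≤ F.support K z w :=
  le_csSup (hK.isCompact.image (by fun_prop)).bddAbove (Set.mem_image_of_mem _ hx)

lemma support_le (hK : IsConvexBody K) {w : Fin m → ℝ} {c : ℝ}
    (h : ∀ x ∈ K, ⟪x - z, θ + F.toLin w⟫_ℝ ≤ c) : F.support K z w ≤ c :=
  csSup_le ((hK.nonempty_interior.mono interior_subset).image _)
    (Set.forall_mem_image.2 h)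

lemma inner_add_toLin (hθ : ‖θ‖ = 1) (w : Fin m → ℝ) : ⟪θ, θ + F.toLin w⟫_ℝ = 1 := by
  rw [inner_add_right, F.inner_toLin, real_inner_self_eq_norm_sq, hθ]; norm_num

lemma convexCoercive_support (hθ : ‖θ‖ = 1) (hK : IsConvexBody K) (hz : z ∈ interior K) :
    ConvexCoercive (F.support K z) := by
  refine ⟨⟨convex_univ, fun w₀ _ w₁ _ a b ha hb hab => F.support_le hK fun x hx => ?_⟩, ?_⟩
  · have h₀ := F.inner_le_support (z := z) hK hx w₀
    have h₁ := F.inner_le_support (z := z) hK hx w₁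
    have e : θ + F.toLin (a • w₀ + b • w₁) =
        a • (θ + F.toLin w₀) + b • (θ + F.toLin w₁) := by
      rw [smul_add, smul_add, map_add, map_smul, map_smul, add_add_add_comm, ← add_smul, hab,
        one_smul]
    rw [e, inner_add_right, inner_smul_right, inner_smul_right, smul_eq_mul, smul_eq_mul]
    gcongr
  · obtain ⟨r, hr, hball⟩ := Metric.nhds_basis_closedBall.mem_iff.1 (mem_interior_iff_mem_nhds.1 hz)
    refine ⟨r / 2, by positivity, fun w => ?_⟩
    set u := θ + F.toLin w with hu
    have hsq : ‖u‖ * ‖u‖ = 1 + ‖F.toLin w‖ * ‖F.toLin w‖ := by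
      rw [hu, norm_add_sq_eq_norm_sq_add_norm_sq_of_inner_eq_zero _ _ (F.inner_toLin w), hθ,
        one_mul]
    have h1 : (1 + ‖w‖) / 2 ≤ ‖u‖ := by
      have := F.norm_le w
      have := norm_nonneg w
      nlinarith [norm_nonneg u, sq_nonneg (‖F.toLin w‖ - 1)]
    have hu0 : 0 < ‖u‖ := by
      have := norm_nonneg w
      linarith
    have hx : z + (r / ‖u‖) • u ∈ K := by
      refine hball ?_
      rw [mem_closedBall_iff_norm, add_sub_cancel_left, norm_smul, Real.norm_of_nonneg
        (by positivity), div_mul_cancel₀ _ hu0.ne']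
    have := F.inner_le_support (z := z) hK hx w
    rw [add_sub_cancel_left, ← hu, inner_smul_left, real_inner_self_eq_norm_mul_norm] at this
    refine le_trans ?_ this
    simp only [conj_trivial]
    field_simp
    nlinarith

lemma volume_slice (hK : IsConvexBody K) {s : ℝ} (hs : 0 < s) :
    volume {y : Fin m → ℝ | ∀ x ∈ K, ⟪x - z, s • θ + F.toLin y⟫_ℝ ≤ 1} =
      ENNReal.ofReal (s ^ m) * volume {w | s * F.support K z w ≤ 1} := by
  have : {y : Fin m → ℝ | ∀ x ∈ K, ⟪x - z, s • θ + F.toLin y⟫_ℝ ≤ 1} =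
      s • {w | s * F.support K z w ≤ 1} := by
    ext y
    rw [Set.mem_smul_set_iff_inv_smul_mem₀ hs.ne']
    have e : s • θ + F.toLin y = s • (θ + F.toLin (s⁻¹ • y)) := by
      rw [smul_add, map_smul, smul_inv_smul₀ hs.ne']
    simp only [Set.mem_ofPred_eq, e, inner_smul_right]
    constructor
    · intro h
      rw [← le_div_iff₀' hs]
      exact F.support_le hK fun x hx => (le_div_iff₀' hs).2 (h x hx)
    · intro h x hx
      exact le_trans (by gcongr; exact F.inner_le_support hK hx _) h
  rw [this, Measure.addHaar_smul]
  simp [abs_of_pos hs]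

lemma halfPolarVolume_eq (hθ : ‖θ‖ = 1) (hK : IsConvexBody K) (hz : z ∈ interior K) :
    halfPolarVolume θ K z =
      ENNReal.ofReal ((m + 1 : ℝ)⁻¹) * invPowIntegral (m + 1) (F.support K z) := by
  have hc := F.convexCoercive_support hθ hK hz
  have hmeas := hc.continuous.measurable
  have e1 : invPowIntegral (m + 1) (F.support K z) =
      ∫⁻ w, ENNReal.ofReal ((F.support K z w)⁻¹ ^ ((m : ℝ) + 1)) := by
    refine lintegral_congr fun w => ?_
    rw [← inv_pow]
    norm_cast
  rw [e1, lintegral_rpow_eq_lintegral_meas_le_mul _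
    (Eventually.of_forall fun w => (inv_pos.2 (hc.pos w)).le) (by fun_prop) (by positivity),
    ← mul_assoc, ← ENNReal.ofReal_mul (by positivity), inv_mul_cancel₀ (by positivity),
    ENNReal.ofReal_one, one_mul, halfPolarVolume,
    ← F.measurePreserving.measure_preimage (measurableSet_halfPolar θ K z).nullMeasurableSet,
    Measure.volume_eq_prod, Measure.prod_apply
      (F.measurePreserving.measurable (measurableSet_halfPolar θ K z)),
    ← lintegral_indicator measurableSet_Ioi]
  refine lintegral_congr fun s => ?_
  have hi : ∀ w, ⟪θ, s • θ + F.toLin w⟫_ℝ = s := by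
    intro w
    rw [inner_add_right, F.inner_toLin, inner_smul_right, real_inner_self_eq_norm_sq, hθ]; simp
  by_cases hs : 0 < s
  · rw [Set.indicator_of_mem (by exact hs), add_sub_cancel_right, Real.rpow_natCast, mul_comm]
    have e2 : {w | s ≤ (F.support K z w)⁻¹} = {w | s * F.support K z w ≤ 1} := by
      ext w
      simp only [Set.mem_ofPred_eq, ← one_div]
      rw [le_div_iff₀ (hc.pos w)]
    rw [e2, ← F.volume_slice hK hs]
    congr 1
    ext w
    simp [polarSet, hi, hs]
  · rw [Set.indicator_of_notMem (by exact hs)]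
    refine (congrArg volume (Set.eq_empty_of_forall_notMem fun w => ?_)).trans measure_empty
    simp [hi, hs]

end OrthogonalFrame

section halfPolarVolume

variable {m : ℕ} {θ : EuclideanSpace ℝ (Fin (m + 1))}
  {K K₀ K₁ : Set (EuclideanSpace ℝ (Fin (m + 1)))} {z z₀ z₁ : EuclideanSpace ℝ (Fin (m + 1))}

lemma halfPolarVolume_ne_top (hθ : ‖θ‖ = 1) (hK : IsConvexBody K) (hz : z ∈ interior K) :
    halfPolarVolume θ K z ≠ ∞ := by
  obtain ⟨F⟩ := exists_orthogonalFrame hθ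
  rw [F.halfPolarVolume_eq hθ hK hz]
  exact ENNReal.mul_ne_top ENNReal.ofReal_ne_top
    (invPowIntegral_ne_top (F.convexCoercive_support hθ hK hz))

lemma halfPolarVolume_toReal_pos (hθ : ‖θ‖ = 1) (hK : IsConvexBody K) (hz : z ∈ interior K) :
    0 < (halfPolarVolume θ K z).toReal := by
  refine ENNReal.toReal_pos ?_ (halfPolarVolume_ne_top hθ hK hz)
  obtain ⟨F⟩ := exists_orthogonalFrame hθ
  rw [F.halfPolarVolume_eq hθ hK hz]
  refine mul_ne_zero (ENNReal.ofReal_pos.2 (by positivity)).ne' ?_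
  exact (invPowIntegral_pos (F.convexCoercive_support hθ hK hz) _).ne'

lemma halfPolarVolume_le_add_smul {τ : ℝ} (hτ : 0 ≤ τ) :
    halfPolarVolume θ K z ≤ halfPolarVolume θ K (z + τ • θ) := by
  refine measure_mono fun y hy => ⟨hy.1, ?_⟩
  rintro _ ⟨x, hx, rfl⟩
  refine le_trans ?_ (hy.2 _ ⟨x, hx, rfl⟩)
  have := hy.1
  simp only [Set.mem_ofPred_eq] at this
  beta_reduce
  rw [← sub_sub, inner_sub_left (x - z), inner_smul_left]
  simp only [conj_trivial]
  have := mul_nonneg hτ this.le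
  linarith

/-- The support functions of `K₀ - z₀`, `K₁ - z₁`, `K - z` on the hyperplane `⟪θ, u⟫ = 1` satisfy
the convexity inequality with weights `a`, `b`. -/
def SupportCombination (θ : EuclideanSpace ℝ (Fin (m + 1))) (a b : ℝ)
    (K₀ : Set (EuclideanSpace ℝ (Fin (m + 1)))) (z₀ : EuclideanSpace ℝ (Fin (m + 1)))
    (K₁ : Set (EuclideanSpace ℝ (Fin (m + 1)))) (z₁ : EuclideanSpace ℝ (Fin (m + 1)))
    (K : Set (EuclideanSpace ℝ (Fin (m + 1)))) (z : EuclideanSpace ℝ (Fin (m + 1))) : Prop :=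
  ∀ u₀ u₁, ⟪θ, u₀⟫_ℝ = 1 → ⟪θ, u₁⟫_ℝ = 1 → ∀ c₀ c₁,
    (∀ x ∈ K₀, ⟪x - z₀, u₀⟫_ℝ ≤ c₀) → (∀ x ∈ K₁, ⟪x - z₁, u₁⟫_ℝ ≤ c₁) →
    ∀ x ∈ K, ⟪x - z, a • u₀ + b • u₁⟫_ℝ ≤ a * c₀ + b * c₁

lemma inv_halfPolarVolume_combination (hθ : ‖θ‖ = 1) (hK₀ : IsConvexBody K₀)
    (hz₀ : z₀ ∈ interior K₀) (hK₁ : IsConvexBody K₁) (hz₁ : z₁ ∈ interior K₁)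
    (hK : IsConvexBody K) (hz : z ∈ interior K) {a b : ℝ} (ha : 0 ≤ a) (hb : 0 ≤ b)
    (hab : a + b = 1) (h : SupportCombination θ a b K₀ z₀ K₁ z₁ K z) :
    (halfPolarVolume θ K z).toReal⁻¹ ≤
      a * (halfPolarVolume θ K₀ z₀).toReal⁻¹ + b * (halfPolarVolume θ K₁ z₁).toReal⁻¹ := by
  obtain ⟨F⟩ := exists_orthogonalFrame hθ
  have := inv_invPowIntegral_combination (F.convexCoercive_support hθ hK₀ hz₀)
    (F.convexCoercive_support hθ hK₁ hz₁) (F.convexCoercive_support hθ hK hz) ha hb hab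
    fun w₀ w₁ => F.support_le hK fun x hx => by
      have e : θ + F.toLin (a • w₀ + b • w₁) =
          a • (θ + F.toLin w₀) + b • (θ + F.toLin w₁) := by
        rw [smul_add, smul_add, map_add, map_smul, map_smul, add_add_add_comm, ← add_smul, hab,
          one_smul]
      rw [e]
      exact h _ _ (F.inner_add_toLin hθ _) (F.inner_add_toLin hθ _) _ _
        (fun x hx => F.inner_le_support hK₀ hx _) (fun x hx => F.inner_le_support hK₁ hx _) x hx
  rw [F.halfPolarVolume_eq hθ hK hz, F.halfPolarVolume_eq hθ hK₀ hz₀,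
    F.halfPolarVolume_eq hθ hK₁ hz₁]
  simp only [ENNReal.toReal_mul, mul_inv]
  rw [ENNReal.toReal_ofReal (by positivity), inv_inv]
  refine (mul_le_mul_of_nonneg_left this (by positivity)).trans (le_of_eq ?_)
  ring

lemma supportCombination_self (θ : EuclideanSpace ℝ (Fin (m + 1)))
    (K : Set (EuclideanSpace ℝ (Fin (m + 1)))) (z : EuclideanSpace ℝ (Fin (m + 1))) {a b : ℝ}
    (ha : 0 ≤ a) (hb : 0 ≤ b) (hab : a + b = 1) (τ₀ τ₁ : ℝ) :
    SupportCombination θ a b K (z + τ₀ • θ) K (z + τ₁ • θ) K (z + (a * τ₀ + b * τ₁) • θ) := by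
  intro u₀ u₁ h₀ h₁ c₀ c₁ hc₀ hc₁ x hx
  have e₀ := mul_le_mul_of_nonneg_left (hc₀ x hx) ha
  have e₁ := mul_le_mul_of_nonneg_left (hc₁ x hx) hb
  simp only [← sub_sub, inner_sub_left, inner_add_right, inner_smul_left, inner_smul_right,
    conj_trivial, h₀, h₁] at e₀ e₁ ⊢
  have : b = 1 - a := by linarith
  subst this
  linarith

lemma convex_interior_line (hK : IsConvexBody K) :
    Convex ℝ {τ : ℝ | z + τ • θ ∈ interior K} := by
  intro s hs t ht a b ha hb hab
  have := hK.convex.interior hs ht ha hb hab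
  have e : a • (z + s • θ) + b • (z + t • θ) = z + (a • s + b • t) • θ := by
    rw [smul_add, smul_add, add_add_add_comm, ← add_smul, hab, one_smul, add_smul, smul_smul,
      smul_smul]
    rfl
  rwa [e] at this

lemma isOpen_interior_line :
    IsOpen {τ : ℝ | z + τ • θ ∈ interior K} :=
  isOpen_interior.preimage (by fun_prop : Continuous fun τ : ℝ => z + τ • θ)

lemma continuousOn_halfPolarVolume (hθ : ‖θ‖ = 1) (hK : IsConvexBody K) :
    ContinuousOn (fun τ : ℝ => (halfPolarVolume θ K (z + τ • θ)).toReal)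
      {τ : ℝ | z + τ • θ ∈ interior K} := by
  have hconv : ConvexOn ℝ {τ : ℝ | z + τ • θ ∈ interior K}
      (fun τ : ℝ => (halfPolarVolume θ K (z + τ • θ)).toReal⁻¹) := by
    refine ⟨convex_interior_line hK, fun s hs t ht a b ha hb hab => ?_⟩
    exact inv_halfPolarVolume_combination hθ hK hs hK ht hK
      (convex_interior_line hK hs ht ha hb hab) ha hb hab
      (supportCombination_self θ K z ha hb hab s t)
  have := (hconv.continuousOn isOpen_interior_line).inv₀ fun τ hτ =>
    (inv_pos.2 (halfPolarVolume_toReal_pos hθ hK hτ)).ne'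
  simpa only [Pi.inv_def, inv_inv] using this

/-- The half polar volume blows up as the centre approaches the boundary in direction `θ`. -/
lemma exists_div_le_halfPolarVolume (hθ : ‖θ‖ = 1) (hK : IsConvexBody K)
    {p : EuclideanSpace ℝ (Fin (m + 1))} (hp : p ∉ interior K) {δ₀ : ℝ} (hδ₀ : 0 < δ₀)
    (hp₀ : p - δ₀ • θ ∈ interior K) :
    ∃ c > 0, ∀ δ > 0, p - δ • θ ∈ interior K →
      c / δ ≤ (halfPolarVolume θ K (p - δ • θ)).toReal := by
  obtain ⟨F⟩ := exists_orthogonalFrame hθ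
  obtain ⟨f, hf⟩ := geometric_hahn_banach_open_point hK.convex.interior isOpen_interior hp
  have hfθ : 0 < f θ := by
    have := hf _ hp₀
    rw [map_sub, map_smul, smul_eq_mul] at this
    exact pos_of_mul_pos_right (by linarith : 0 < δ₀ * f θ) hδ₀.le
  obtain ⟨u, hu⟩ : ∃ u, ∀ x, f x = ⟪u, x⟫_ℝ :=
    ⟨(InnerProductSpace.toDual ℝ _).symm f, fun x => by simp⟩
  obtain ⟨w₀, hw₀⟩ := F.exists_eq ((f θ)⁻¹ • u) (by
    rw [inner_smul_right, real_inner_comm, ← hu, inv_mul_cancel₀ hfθ.ne'])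
  have hle : ∀ x ∈ K, ⟪x - p, θ + F.toLin w₀⟫_ℝ ≤ 0 := by
    intro x hx
    have hx' : x ∈ closure (interior K) := by
      rw [hK.convex.closure_interior_eq_closure_of_nonempty_interior hK.nonempty_interior]
      exact subset_closure hx
    have : f x ≤ f p := by
      have hcl : closure (interior K) ⊆ {x | f x ≤ f p} :=
        closure_minimal (fun x hx => (hf x hx).le) (isClosed_le (by fun_prop) continuous_const)
      exact hcl hx'
    rw [← hw₀, inner_smul_right, real_inner_comm, ← hu, map_sub]
    have := inv_pos.2 hfθ
    nlinarith
  obtain ⟨R, hR⟩ := hK.isCompact.isBounded.exists_norm_le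
  have hR0 : 0 ≤ R := by
    obtain ⟨x, hx⟩ := hK.nonempty_interior
    exact (norm_nonneg x).trans (hR x (interior_subset hx))
  set C := (R + ‖p‖) * ‖F.toLin‖ with hC
  have hC0 : 0 ≤ C := by positivity
  have hsupp : ∀ δ > 0, ∀ w ∈ Metric.ball w₀ δ, F.support K (p - δ • θ) w ≤ (1 + C) * δ := by
    intro δ hδ w hw
    refine F.support_le hK fun x hx => ?_
    have e : ⟪x - (p - δ • θ), θ + F.toLin w⟫_ℝ =
        ⟪x - p, θ + F.toLin w₀⟫_ℝ + ⟪x - p, F.toLin (w - w₀)⟫_ℝ + δ := by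
      rw [← sub_add, inner_add_left, inner_smul_left, F.inner_add_toLin hθ, ← inner_add_right,
        add_assoc θ, ← map_add, add_sub_cancel]
      simp
    have h1 : ⟪x - p, F.toLin (w - w₀)⟫_ℝ ≤ C * δ :=
      calc _ ≤ ‖x - p‖ * ‖F.toLin (w - w₀)‖ := real_inner_le_norm _ _
        _ ≤ (R + ‖p‖) * (‖F.toLin‖ * δ) := by
          gcongr
          · exact (norm_sub_le _ _).trans (by gcongr; exact hR x hx)
          · exact (F.toLin.le_opNorm _).trans (by gcongr; exact (mem_ball_iff_norm.1 hw).le)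
        _ = _ := by rw [hC]; ring
    have := hle x hx
    linarith
  refine ⟨(m + 1 : ℝ)⁻¹ * (2 ^ m * ((1 + C) ^ (m + 1))⁻¹), by positivity, fun δ hδ hpδ => ?_⟩
  rw [← ENNReal.ofReal_le_iff_le_toReal (halfPolarVolume_ne_top hθ hK hpδ),
    F.halfPolarVolume_eq hθ hK hpδ]
  have hc := F.convexCoercive_support hθ hK hpδ
  calc ENNReal.ofReal ((m + 1 : ℝ)⁻¹ * (2 ^ m * ((1 + C) ^ (m + 1))⁻¹) / δ)
      = ENNReal.ofReal ((m + 1 : ℝ)⁻¹) * (ENNReal.ofReal ((((1 + C) * δ) ^ (m + 1))⁻¹) *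
        ENNReal.ofReal ((2 * δ) ^ m)) := by
        rw [← ENNReal.ofReal_mul (by positivity), ← ENNReal.ofReal_mul (by positivity)]
        congr 1
        rw [mul_pow, mul_pow, pow_succ δ]
        field_simp
    _ = ENNReal.ofReal ((m + 1 : ℝ)⁻¹) *
        ∫⁻ w in Metric.ball w₀ δ, ENNReal.ofReal ((((1 + C) * δ) ^ (m + 1))⁻¹) := by
        rw [setLIntegral_const, Real.volume_pi_ball _ hδ, Fintype.card_fin]
    _ ≤ ENNReal.ofReal ((m + 1 : ℝ)⁻¹) *
        ∫⁻ w in Metric.ball w₀ δ, ENNReal.ofReal ((F.support K (p - δ • θ) w ^ (m + 1))⁻¹) := by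
        refine mul_le_mul' le_rfl (setLIntegral_mono' measurableSet_ball fun w hw =>
          ENNReal.ofReal_le_ofReal ?_)
        have := hc.pos w
        gcongr
        exact hsupp δ hδ w hw
    _ ≤ _ := by
        gcongr
        exact setLIntegral_le_lintegral _ _

end halfPolarVolume

section balance

variable {m : ℕ} {θ z : EuclideanSpace ℝ (Fin (m + 1))}
  {K K₀ K₁ : Set (EuclideanSpace ℝ (Fin (m + 1)))}

lemma exists_forall_Ioo_le_halfPolarVolume (hθ : ‖θ‖ = 1) (hK : IsConvexBody K) {s t : ℝ}
    (hst : s < t) (hs : z + s • θ ∈ interior K) (ht : z + t • θ ∉ interior K) (C : ℝ) :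
    ∃ r < t, ∀ τ ∈ Set.Ioo r t, z + τ • θ ∈ interior K →
      C ≤ (halfPolarVolume θ K (z + τ • θ)).toReal := by
  have e (τ : ℝ) : z + t • θ - (t - τ) • θ = z + τ • θ := by rw [sub_smul]; abel
  obtain ⟨c, hc, h⟩ := exists_div_le_halfPolarVolume hθ hK ht (sub_pos.2 hst) (by rwa [e])
  refine ⟨t - c / (|C| + 1), sub_lt_self _ (by positivity), fun τ hτ hτK => ?_⟩
  have hδ : 0 < t - τ := sub_pos.2 hτ.2
  have := h (t - τ) hδ (by rwa [e])
  rw [e] at this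
  refine le_trans ?_ this
  have h1 : t - τ < c / (|C| + 1) := by linarith [hτ.1]
  rw [lt_div_iff₀ (by positivity)] at h1
  rw [le_div_iff₀ hδ]
  nlinarith [le_abs_self C]

lemma monotoneOn_halfPolarVolume (hθ : ‖θ‖ = 1) (hK : IsConvexBody K) :
    MonotoneOn (fun τ : ℝ => (halfPolarVolume θ K (z + τ • θ)).toReal)
      {τ : ℝ | z + τ • θ ∈ interior K} := by
  intro s _ t ht hst
  refine ENNReal.toReal_mono (halfPolarVolume_ne_top hθ hK ht) ?_
  have := halfPolarVolume_le_add_smul (θ := θ) (K := K) (z := z + s • θ) (sub_nonneg.2 hst)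
  rwa [add_assoc, ← add_smul, add_sub_cancel] at this

lemma exists_mul_le_mul_halfPolarVolume (hθ : ‖θ‖ = 1) (hK₀ : IsConvexBody K₀)
    (hK₁ : IsConvexBody K₁) {a b σ₀ : ℝ} (ha : 0 < a) (hb : 0 < b)
    (h₀ : z + (b * σ₀) • θ ∈ interior K₀) (h₁ : z + (a * σ₀) • (-θ) ∈ interior K₁) :
    ∃ σ : ℝ, z + (b * σ) • θ ∈ interior K₀ ∧ z + (a * σ) • (-θ) ∈ interior K₁ ∧
      (halfPolarVolume (-θ) K₀ (z + (b * σ) • θ)).toReal *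
        (halfPolarVolume θ K₁ (z + (a * σ) • (-θ))).toReal ≤
      (halfPolarVolume θ K₀ (z + (b * σ) • θ)).toReal *
        (halfPolarVolume (-θ) K₁ (z + (a * σ) • (-θ))).toReal := by
  have hθ' : ‖-θ‖ = 1 := by rwa [norm_neg]
  set S : Set ℝ := {σ | z + (b * σ) • θ ∈ interior K₀ ∧ z + (a * σ) • (-θ) ∈ interior K₁} with hS
  have hSo : IsOpen S :=
    (isOpen_interior.preimage (by fun_prop : Continuous fun σ : ℝ => z + (b * σ) • θ)).inter
      (isOpen_interior.preimage (by fun_prop : Continuous fun σ : ℝ => z + (a * σ) • (-θ)))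
  have hσ₀ : σ₀ ∈ S := ⟨h₀, h₁⟩
  have hbdd : BddAbove S := by
    obtain ⟨R, hR⟩ := hK₀.isCompact.isBounded.exists_norm_le
    refine ⟨(R + ‖z‖) / b, fun σ hσ => ?_⟩
    rw [le_div_iff₀ hb]
    have := hR _ (interior_subset hσ.1)
    have h2 : ‖(b * σ) • θ‖ ≤ R + ‖z‖ := by
      calc ‖(b * σ) • θ‖ = ‖z + (b * σ) • θ - z‖ := by simp
        _ ≤ _ := (norm_sub_le _ _).trans (by gcongr)
    rw [norm_smul, hθ, mul_one, Real.norm_eq_abs] at h2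
    linarith [le_abs_self (b * σ)]
  set t := sSup S with ht
  have hlub : IsLUB S t := isLUB_csSup ⟨σ₀, hσ₀⟩ hbdd
  have htS : t ∉ S := by
    intro h
    obtain ⟨ε, hε, hball⟩ := Metric.isOpen_iff.1 hSo t h
    have := hlub.1 (hball (show t + ε / 2 ∈ Metric.ball t ε by
      rw [Metric.mem_ball, Real.dist_eq, add_sub_cancel_left, abs_of_pos (by positivity)]
      linarith))
    linarith
  have hσ₀t : σ₀ < t := lt_of_le_of_ne (hlub.1 hσ₀) fun h => htS (h ▸ hσ₀)
  set f : ℝ → ℝ := fun σ => (halfPolarVolume θ K₀ (z + (b * σ) • θ)).toReal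
  set g : ℝ → ℝ := fun σ => (halfPolarVolume (-θ) K₁ (z + (a * σ) • (-θ))).toReal
  set p : ℝ → ℝ := fun σ => (halfPolarVolume (-θ) K₀ (z + (b * σ) • θ)).toReal
  set q : ℝ → ℝ := fun σ => (halfPolarVolume θ K₁ (z + (a * σ) • (-θ))).toReal
  have hf₀ : 0 < f σ₀ := halfPolarVolume_toReal_pos hθ hK₀ h₀
  have hg₀ : 0 < g σ₀ := halfPolarVolume_toReal_pos hθ' hK₁ h₁
  have hp₀ : 0 < p σ₀ := halfPolarVolume_toReal_pos hθ' hK₀ h₀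
  have hq₀ : 0 < q σ₀ := halfPolarVolume_toReal_pos hθ hK₁ h₁
  have hf {σ} (hσ : σ ∈ S) (h : σ₀ ≤ σ) : f σ₀ ≤ f σ :=
    monotoneOn_halfPolarVolume hθ hK₀ h₀ hσ.1 (by gcongr)
  have hg {σ} (hσ : σ ∈ S) (h : σ₀ ≤ σ) : g σ₀ ≤ g σ :=
    monotoneOn_halfPolarVolume hθ' hK₁ h₁ hσ.2 (by gcongr)
  have hp {σ} (hσ : σ ∈ S) (h : σ₀ ≤ σ) : p σ ≤ p σ₀ := by
    have e (τ : ℝ) : z + (b * τ) • θ = z + (-(b * τ)) • (-θ) := by simp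
    simp only [p, e]
    refine monotoneOn_halfPolarVolume hθ' hK₀ ?_ ?_ (by gcongr)
    · simpa [← e] using hσ.1
    · simpa [← e] using h₀
  have hq {σ} (hσ : σ ∈ S) (h : σ₀ ≤ σ) : q σ ≤ q σ₀ := by
    have e (τ : ℝ) : z + (a * τ) • (-θ) = z + (-(a * τ)) • θ := by simp
    simp only [q, e]
    refine monotoneOn_halfPolarVolume hθ hK₁ ?_ ?_ (by gcongr)
    · simpa [← e] using hσ.2
    · simpa [← e] using h₁
  obtain ⟨r, hrt, hr⟩ : ∃ r < t, ∀ σ ∈ Set.Ioo r t, σ ∈ S →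
      p σ₀ * q σ₀ / g σ₀ ≤ f σ ∨ p σ₀ * q σ₀ / f σ₀ ≤ g σ := by
    by_cases hK : z + (b * t) • θ ∈ interior K₀
    · have hK' : z + (a * t) • (-θ) ∉ interior K₁ := fun h => htS ⟨hK, h⟩
      obtain ⟨r, hr, h⟩ := exists_forall_Ioo_le_halfPolarVolume hθ' hK₁
        (mul_lt_mul_of_pos_left hσ₀t ha) h₁ hK' (p σ₀ * q σ₀ / f σ₀)
      refine ⟨r / a, by rwa [div_lt_iff₀' ha], fun σ hσ hσS => Or.inr (h _ ⟨?_, ?_⟩ hσS.2)⟩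
      · exact (div_lt_iff₀' ha).1 hσ.1
      · exact mul_lt_mul_of_pos_left hσ.2 ha
    · obtain ⟨r, hr, h⟩ := exists_forall_Ioo_le_halfPolarVolume hθ hK₀
        (mul_lt_mul_of_pos_left hσ₀t hb) h₀ hK (p σ₀ * q σ₀ / g σ₀)
      refine ⟨r / b, by rwa [div_lt_iff₀' hb], fun σ hσ hσS => Or.inl (h _ ⟨?_, ?_⟩ hσS.1)⟩
      · exact (div_lt_iff₀' hb).1 hσ.1
      · exact mul_lt_mul_of_pos_left hσ.2 hb
  obtain ⟨σ, hσS, hσ⟩ := exists_lt_of_lt_csSup ⟨σ₀, hσ₀⟩ (max_lt hσ₀t hrt)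
  have hσσ₀ : σ₀ ≤ σ := (le_max_left _ _).trans hσ.le
  have hσt : σ < t := lt_of_le_of_ne (hlub.1 hσS) fun h => htS (h ▸ hσS)
  refine ⟨σ, hσS.1, hσS.2, ?_⟩
  change p σ * q σ ≤ f σ * g σ
  have hpq : p σ * q σ ≤ p σ₀ * q σ₀ :=
    mul_le_mul (hp hσS hσσ₀) (hq hσS hσσ₀) ENNReal.toReal_nonneg hp₀.le
  refine hpq.trans ?_
  rcases hr σ ⟨(le_max_right _ _).trans_lt hσ, hσt⟩ hσS with h | h
  · rw [div_le_iff₀ hg₀] at h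
    exact h.trans (mul_le_mul_of_nonneg_left (hg hσS hσσ₀) (hf₀.le.trans (hf hσS hσσ₀)))
  · rw [div_le_iff₀ hf₀, mul_comm (g σ)] at h
    exact h.trans (mul_le_mul_of_nonneg_right (hf hσS hσσ₀) (hg₀.le.trans (hg hσS hσσ₀)))

lemma exists_mul_eq_mul_halfPolarVolume (hθ : ‖θ‖ = 1) (hK₀ : IsConvexBody K₀)
    (hK₁ : IsConvexBody K₁) {a b σ₀ : ℝ} (ha : 0 < a) (hb : 0 < b)
    (h₀ : z + (b * σ₀) • θ ∈ interior K₀) (h₁ : z + (a * σ₀) • (-θ) ∈ interior K₁) :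
    ∃ σ : ℝ, z + (b * σ) • θ ∈ interior K₀ ∧ z + (a * σ) • (-θ) ∈ interior K₁ ∧
      (halfPolarVolume (-θ) K₀ (z + (b * σ) • θ)).toReal *
        (halfPolarVolume θ K₁ (z + (a * σ) • (-θ))).toReal =
      (halfPolarVolume θ K₀ (z + (b * σ) • θ)).toReal *
        (halfPolarVolume (-θ) K₁ (z + (a * σ) • (-θ))).toReal := by
  have hθ' : ‖-θ‖ = 1 := by rwa [norm_neg]
  set S : Set ℝ := {σ | z + (b * σ) • θ ∈ interior K₀ ∧ z + (a * σ) • (-θ) ∈ interior K₁} with hS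
  have hSc : Convex ℝ S := by
    have h := (convex_interior_line (z := z) (θ := θ) hK₀).linear_preimage
      (LinearMap.mulLeft ℝ b)
    have h' := (convex_interior_line (z := z) (θ := -θ) hK₁).linear_preimage
      (LinearMap.mulLeft ℝ a)
    exact h.inter h'
  obtain ⟨s, hs₀, hs₁, hs⟩ := exists_mul_le_mul_halfPolarVolume hθ hK₀ hK₁ ha hb h₀ h₁
  obtain ⟨t, ht₁, ht₀, ht⟩ := exists_mul_le_mul_halfPolarVolume (z := z) (σ₀ := -σ₀) hθ hK₁ hK₀
    hb ha (by simpa using h₁) (by simpa using h₀)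
  have hc {θ : EuclideanSpace ℝ (Fin (m + 1))} {K} (hθ : ‖θ‖ = 1) (hK : IsConvexBody K) (c : ℝ) :
      ContinuousOn (fun σ => (halfPolarVolume θ K (z + (c * σ) • θ)).toReal)
        {σ : ℝ | z + (c * σ) • θ ∈ interior K} :=
    (continuousOn_halfPolarVolume hθ hK).comp (by fun_prop) fun σ hσ => hσ
  have hc' {θ : EuclideanSpace ℝ (Fin (m + 1))} {K} (hθ : ‖θ‖ = 1) (hK : IsConvexBody K) (c : ℝ) :
      ContinuousOn (fun σ => (halfPolarVolume (-θ) K (z + (c * σ) • θ)).toReal)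
        {σ : ℝ | z + (c * σ) • θ ∈ interior K} := by
    have := hc (θ := -θ) (by rwa [norm_neg]) hK (-c)
    simpa using this
  have hcq := hc' hθ' hK₁ a
  rw [neg_neg] at hcq
  obtain ⟨σ, hσ, h⟩ := hSc.isPreconnected.intermediate_value₂ ⟨hs₀, hs₁⟩
    (show -t ∈ S from ⟨by simpa using ht₀, by simpa using ht₁⟩)
    (((hc' hθ hK₀ b).mono fun σ (hσ : σ ∈ S) => hσ.1).mul
      (hcq.mono fun σ (hσ : σ ∈ S) => hσ.2))
    (((hc hθ hK₀ b).mono fun σ (hσ : σ ∈ S) => hσ.1).mul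
      ((hc hθ' hK₁ a).mono fun σ (hσ : σ ∈ S) => hσ.2)) hs
    (by simpa [mul_comm] using ht)
  exact ⟨σ, hσ.1, hσ.2, h⟩

end balance

section shadow

variable {n : ℕ} {θ z : EuclideanSpace ℝ (Fin n)} {M : Set (EuclideanSpace ℝ (Fin n))}
  {α : EuclideanSpace ℝ (Fin n) → ℝ}

/-- The member at time `t` of the shadow system along `θ` with base set `M` and speed `α`. -/
def shadowBody (θ : EuclideanSpace ℝ (Fin n)) (M : Set (EuclideanSpace ℝ (Fin n)))
    (α : EuclideanSpace ℝ (Fin n) → ℝ) (t : ℝ) : Set (EuclideanSpace ℝ (Fin n)) :=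
  closure (convexHull ℝ ((fun x => x + (t * α x) • θ) '' M))

lemma mem_shadowBody {x : EuclideanSpace ℝ (Fin n)} (hx : x ∈ M) (t : ℝ) :
    x + (t * α x) • θ ∈ shadowBody θ M α t :=
  subset_closure (subset_convexHull ℝ _ (Set.mem_image_of_mem _ hx))

lemma le_of_mem_shadowBody (f : EuclideanSpace ℝ (Fin n) →L[ℝ] ℝ) {t c : ℝ}
    (h : ∀ x ∈ M, f (x + (t * α x) • θ) ≤ c) {y : EuclideanSpace ℝ (Fin n)}
    (hy : y ∈ shadowBody θ M α t) : f y ≤ c := by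
  refine closure_minimal (convexHull_min ?_ ?_) (isClosed_le f.continuous continuous_const) hy
  · rintro _ ⟨x, hx, rfl⟩
    exact h x hx
  · exact convex_halfSpace_le f.toLinearMap.isLinear c

lemma shadowBody_neg (θ : EuclideanSpace ℝ (Fin n)) (M : Set (EuclideanSpace ℝ (Fin n)))
    (α : EuclideanSpace ℝ (Fin n) → ℝ) (t : ℝ) :
    shadowBody (-θ) M (-α) t = shadowBody θ M α t := by
  simp [shadowBody]

lemma eq_zero_of_forall_mem_le {K : Set (EuclideanSpace ℝ (Fin n))} (hz : z ∈ interior K)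
    {f : EuclideanSpace ℝ (Fin n) →L[ℝ] ℝ} (h : ∀ y ∈ K, f y ≤ f z) : f = 0 := by
  have : IsLocalMax f z := by
    filter_upwards [isOpen_interior.mem_nhds hz] with y hy using h y (interior_subset hy)
  exact this.hasFDerivAt_eq_zero f.hasFDerivAt

lemma exists_mem_interior_shadowBody {t₀ t₁ a b : ℝ} (ha : 0 < a) (hb : 0 < b)
    (hab : a + b = 1) (hK₀ : IsConvexBody (shadowBody θ M α t₀))
    (hK₁ : IsConvexBody (shadowBody θ M α t₁))
    (hz : z ∈ interior (shadowBody θ M α (a * t₀ + b * t₁))) :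
    ∃ σ : ℝ, z + (b * σ) • θ ∈ interior (shadowBody θ M α t₀) ∧
      z + (a * σ) • (-θ) ∈ interior (shadowBody θ M α t₁) := by
  by_contra! hne
  set K₀ := shadowBody θ M α t₀
  set K₁ := shadowBody θ M α t₁
  have hline : Convex ℝ (Set.range fun σ : ℝ => (z + (b * σ) • θ, z + (a * σ) • (-θ))) := by
    rintro _ ⟨s, rfl⟩ _ ⟨t, rfl⟩ c d - - hcd
    refine ⟨c * s + d * t, ?_⟩
    obtain rfl : d = 1 - c := by linarith
    ext1 <;> simp only [Prod.smul_mk, Prod.mk_add_mk] <;> module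
  obtain ⟨f, c, hlt, hle⟩ := geometric_hahn_banach_open
    (hK₀.convex.interior.prod hK₁.convex.interior) (isOpen_interior.prod isOpen_interior) hline
    (by
      rw [Set.disjoint_right]
      rintro _ ⟨σ, rfl⟩ ⟨h₀, h₁⟩
      exact hne σ h₀ h₁)
  set f₀ := f.comp (ContinuousLinearMap.inl ℝ _ _) with hf₀
  set f₁ := f.comp (ContinuousLinearMap.inr ℝ _ _) with hf₁
  have hf (p q) : f (p, q) = f₀ p + f₁ q := by
    rw [hf₀, hf₁, ContinuousLinearMap.comp_apply, ContinuousLinearMap.comp_apply, ← map_add]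
    simp
  have hline' (σ : ℝ) : c ≤ f₀ z + f₁ z + σ * (b * f₀ θ - a * f₁ θ) := by
    have := hle _ ⟨σ, rfl⟩
    simp only [hf, map_add, map_smul, map_neg, smul_eq_mul] at this
    linarith
  have hslope : b * f₀ θ = a * f₁ θ := by
    by_contra h
    have h' : b * f₀ θ - a * f₁ θ ≠ 0 := sub_ne_zero.2 h
    have := hline' ((c - (f₀ z + f₁ z) - 1) / (b * f₀ θ - a * f₁ θ))
    rw [div_mul_cancel₀ _ h'] at this
    linarith
  have hcz : c ≤ f₀ z + f₁ z := by simpa using hline' 0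
  have hpair {p q} (hp : p ∈ K₀) (hq : q ∈ K₁) : f₀ p + f₁ q ≤ c := by
    rw [← hf]
    have hmem : (p, q) ∈ closure (interior K₀ ×ˢ interior K₁) := by
      rw [closure_prod_eq,
        hK₀.convex.closure_interior_eq_closure_of_nonempty_interior hK₀.nonempty_interior,
        hK₁.convex.closure_interior_eq_closure_of_nonempty_interior hK₁.nonempty_interior]
      exact ⟨subset_closure hp, subset_closure hq⟩
    exact closure_minimal (fun r hr => (hlt r hr).le) (isClosed_le f.continuous continuous_const)
      hmem
  have hsum : f₀ + f₁ = 0 := by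
    refine eq_zero_of_forall_mem_le hz fun y hy => ?_
    refine (le_of_mem_shadowBody (f₀ + f₁) (c := c) (fun x hx => ?_) hy).trans (by simpa using hcz)
    have := hpair (mem_shadowBody hx t₀) (mem_shadowBody hx t₁)
    simp only [map_add, map_smul, smul_eq_mul, add_apply] at this ⊢
    obtain rfl : b = 1 - a := by linarith
    refine le_of_eq_of_le ?_ this
    linear_combination α x * (t₁ - t₀) * hslope
  have hf₁' (x) : f₁ x = -f₀ x := by
    have := DFunLike.congr_fun hsum x
    simp only [add_apply, zero_apply] at this
    linarith
  have hc : c ≤ 0 := by rw [hf₁'] at hcz; linarith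
  have hfθ : f₀ θ = 0 := by
    rw [hf₁'] at hslope
    have : (a + b) * f₀ θ = 0 := by linarith
    simpa [hab] using this
  have hM {x x'} (hx : x ∈ M) (hx' : x' ∈ M) : f₀ x ≤ f₀ x' := by
    have := hpair (mem_shadowBody hx t₀) (mem_shadowBody hx' t₁)
    simp only [map_add, map_smul, smul_eq_mul, hf₁', hfθ, mul_zero, add_zero] at this
    linarith
  obtain ⟨p, hp⟩ := hK₀.nonempty_interior
  obtain ⟨q, hq⟩ := hK₁.nonempty_interior
  obtain ⟨x, hx⟩ : M.Nonempty := by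
    by_contra! h
    simpa [K₀, shadowBody, h] using interior_subset hp
  have hf₀0 : f₀ = 0 := by
    refine eq_zero_of_forall_mem_le hp fun y hy => ?_
    have h1 : f₀ y ≤ f₀ x := le_of_mem_shadowBody f₀ (fun x' hx' => by
      simpa [hfθ] using hM hx' hx) hy
    have h2 : (-f₀) p ≤ -f₀ x := le_of_mem_shadowBody (-f₀) (fun x' hx' => by
      simpa [hfθ] using hM hx hx') (interior_subset hp)
    rw [neg_apply] at h2
    linarith
  have := hlt (p, q) ⟨hp, hq⟩
  rw [hf, hf₁', hf₀0] at this
  simp only [zero_apply] at this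
  linarith

end shadow

lemma supportCombination_shadowBody {m : ℕ} {θ z : EuclideanSpace ℝ (Fin (m + 1))}
    {M : Set (EuclideanSpace ℝ (Fin (m + 1)))} {α : EuclideanSpace ℝ (Fin (m + 1)) → ℝ}
    {t₀ t₁ τ₀ τ₁ a b : ℝ} (ha : 0 ≤ a) (hb : 0 ≤ b) (hab : a + b = 1)
    (hτ : a * τ₀ + b * τ₁ = 0) :
    SupportCombination θ a b (shadowBody θ M α t₀) (z + τ₀ • θ) (shadowBody θ M α t₁)
      (z + τ₁ • θ) (shadowBody θ M α (a * t₀ + b * t₁)) z := by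
  intro u₀ u₁ h₀ h₁ c₀ c₁ hc₀ hc₁ y hy
  have key : innerSL ℝ (a • u₀ + b • u₁) y ≤ a * c₀ + b * c₁ + ⟪z, a • u₀ + b • u₁⟫_ℝ := by
    refine le_of_mem_shadowBody _ (fun x hx => ?_) hy
    have e₀ := mul_le_mul_of_nonneg_left (hc₀ _ (mem_shadowBody hx t₀)) ha
    have e₁ := mul_le_mul_of_nonneg_left (hc₁ _ (mem_shadowBody hx t₁)) hb
    rw [innerSL_apply_apply, real_inner_comm]
    simp only [inner_sub_left, inner_add_left, inner_add_right, inner_smul_left,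
      inner_smul_right, h₀, h₁, conj_trivial] at e₀ e₁ ⊢
    linear_combination e₀ + e₁ + hτ + α x * (a * t₀ + b * t₁) * hab
  rw [innerSL_apply_apply, real_inner_comm] at key
  rw [inner_sub_left]
  linarith

lemma volume_polarSet_eq_add {n : ℕ} {θ : EuclideanSpace ℝ (Fin n)} (hθ : ‖θ‖ = 1)
    (K : Set (EuclideanSpace ℝ (Fin n))) (z : EuclideanSpace ℝ (Fin n)) :
    volume (polarSet ((fun x => x - z) '' K)) =
      halfPolarVolume θ K z + halfPolarVolume (-θ) K z := by
  set P := polarSet ((fun x => x - z) '' K) with hP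
  have hnull : volume {y : EuclideanSpace ℝ (Fin n) | ⟪θ, y⟫_ℝ = 0} = 0 := by
    have : {y : EuclideanSpace ℝ (Fin n) | ⟪θ, y⟫_ℝ = 0} =
        (LinearMap.ker (innerSL ℝ θ).toLinearMap : Submodule ℝ (EuclideanSpace ℝ (Fin n))) := by
      ext; simp
    rw [this]
    refine Measure.addHaar_submodule _ _ fun h => ?_
    have : θ ∈ LinearMap.ker (innerSL ℝ θ).toLinearMap := h ▸ Submodule.mem_top
    simp [hθ] at this
  have hdisj : Disjoint ({y | 0 < ⟪θ, y⟫_ℝ} ∩ P) ({y | 0 < ⟪-θ, y⟫_ℝ} ∩ P) := by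
    rw [Set.disjoint_left]
    rintro y ⟨h, -⟩ ⟨h', -⟩
    simp only [Set.mem_ofPred_eq, inner_neg_left] at h h'
    linarith
  rw [halfPolarVolume, halfPolarVolume, ← measure_union hdisj (measurableSet_halfPolar _ _ _)]
  refine measure_congr (EventuallyLE.antisymm ?_ ?_)
  · rw [ae_le_set]
    refine measure_mono_null (fun y hy => ?_) hnull
    by_contra h
    rcases lt_or_gt_of_ne (show ⟪θ, y⟫_ℝ ≠ 0 from h) with h | h
    · exact hy.2 (Or.inr ⟨by simpa using h, hy.1⟩)
    · exact hy.2 (Or.inl ⟨h, hy.1⟩)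
  · exact (Set.union_subset Set.inter_subset_right Set.inter_subset_right).eventuallyLE

lemma inv_add_le_of_balanced {p q p₀ q₀ p₁ q₁ a b : ℝ} (hp : 0 < p) (hq : 0 < q) (hp₀ : 0 < p₀)
    (hq₀ : 0 < q₀) (hp₁ : 0 < p₁) (hq₁ : 0 < q₁) (ha : 0 < a) (hb : 0 < b)
    (hpp : p⁻¹ ≤ a * p₀⁻¹ + b * p₁⁻¹) (hqq : q⁻¹ ≤ a * q₀⁻¹ + b * q₁⁻¹)
    (h : q₀ * p₁ = p₀ * q₁) :
    (p + q)⁻¹ ≤ a * (p₀ + q₀)⁻¹ + b * (p₁ + q₁)⁻¹ := by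
  obtain ⟨r, hr, rfl⟩ : ∃ r > 0, q₀ = r * p₀ := ⟨q₀ / p₀, by positivity, by field_simp⟩
  obtain rfl : q₁ = r * p₁ := by
    have : p₀ * (q₁ - r * p₁) = 0 := by linarith
    rcases mul_eq_zero.1 this with h | h <;> linarith
  set H := a * p₀⁻¹ + b * p₁⁻¹ with hH
  have hH0 : 0 < H := by positivity
  have e : a * (p₀ + r * p₀)⁻¹ + b * (p₁ + r * p₁)⁻¹ = (H⁻¹ + r * H⁻¹)⁻¹ := by
    rw [show H⁻¹ + r * H⁻¹ = (1 + r) * H⁻¹ by ring, mul_inv, inv_inv, hH]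
    field_simp
  have e' : a * (r * p₀)⁻¹ + b * (r * p₁)⁻¹ = (r * H⁻¹)⁻¹ := by
    rw [mul_inv r H⁻¹, inv_inv, hH]
    field_simp
  rw [e]
  rw [e'] at hqq
  have h1 : H⁻¹ ≤ p := inv_le_of_inv_le₀ hp hpp
  have h2 : r * H⁻¹ ≤ q := (inv_le_inv₀ hq (by positivity)).1 hqq
  gcongr

lemma exists_inv_volume_polarSet_le {n : ℕ} {θ z : EuclideanSpace ℝ (Fin n)} (hθ : ‖θ‖ = 1)
    {M : Set (EuclideanSpace ℝ (Fin n))} {α : EuclideanSpace ℝ (Fin n) → ℝ} {t₀ t₁ a b : ℝ}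
    (ha : 0 < a) (hb : 0 < b) (hab : a + b = 1) (hK₀ : IsConvexBody (shadowBody θ M α t₀))
    (hK₁ : IsConvexBody (shadowBody θ M α t₁))
    (hK : IsConvexBody (shadowBody θ M α (a * t₀ + b * t₁)))
    (hz : z ∈ interior (shadowBody θ M α (a * t₀ + b * t₁))) :
    ∃ z₀ ∈ interior (shadowBody θ M α t₀), ∃ z₁ ∈ interior (shadowBody θ M α t₁),
      (volume (polarSet ((fun x => x - z) '' shadowBody θ M α (a * t₀ + b * t₁)))).toReal⁻¹ ≤
        a * (volume (polarSet ((fun x => x - z₀) '' shadowBody θ M α t₀))).toReal⁻¹ +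
        b * (volume (polarSet ((fun x => x - z₁) '' shadowBody θ M α t₁))).toReal⁻¹ := by
  obtain _ | m := n
  · simp [Subsingleton.elim θ 0] at hθ
  have hθ' : ‖-θ‖ = 1 := by rwa [norm_neg]
  obtain ⟨σ₀, h₀, h₁⟩ := exists_mem_interior_shadowBody ha hb hab hK₀ hK₁ hz
  obtain ⟨σ, h₀, h₁, hbal⟩ := exists_mul_eq_mul_halfPolarVolume hθ hK₀ hK₁ ha hb h₀ h₁
  refine ⟨_, h₀, _, h₁, ?_⟩
  simp only [volume_polarSet_eq_add hθ]
  rw [ENNReal.toReal_add (halfPolarVolume_ne_top hθ hK hz) (halfPolarVolume_ne_top hθ' hK hz),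
    ENNReal.toReal_add (halfPolarVolume_ne_top hθ hK₀ h₀) (halfPolarVolume_ne_top hθ' hK₀ h₀),
    ENNReal.toReal_add (halfPolarVolume_ne_top hθ hK₁ h₁) (halfPolarVolume_ne_top hθ' hK₁ h₁)]
  refine inv_add_le_of_balanced (halfPolarVolume_toReal_pos hθ hK hz)
    (halfPolarVolume_toReal_pos hθ' hK hz) (halfPolarVolume_toReal_pos hθ hK₀ h₀)
    (halfPolarVolume_toReal_pos hθ' hK₀ h₀) (halfPolarVolume_toReal_pos hθ hK₁ h₁)
    (halfPolarVolume_toReal_pos hθ' hK₁ h₁) ha hb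
    (inv_halfPolarVolume_combination hθ hK₀ h₀ hK₁ h₁ hK hz ha.le hb.le hab ?_)
    (inv_halfPolarVolume_combination hθ' hK₀ h₀ hK₁ h₁ hK hz ha.le hb.le hab ?_) hbal
  · rw [smul_neg, ← neg_smul]
    exact supportCombination_shadowBody ha.le hb.le hab (by ring)
  · rw [← neg_smul_neg]
    simp only [← shadowBody_neg θ]
    exact supportCombination_shadowBody ha.le hb.le hab (by ring)

section minPolarVolume

variable {n : ℕ} {θ z : EuclideanSpace ℝ (Fin n)} {K : Set (EuclideanSpace ℝ (Fin n))}

lemma minPolarVolume_le (hz : z ∈ interior K) :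
    minPolarVolume K ≤ volume (polarSet ((fun x => x - z) '' K)) :=
  iInf_le (fun z : interior K =>
    volume (polarSet ((fun x => x - (z : EuclideanSpace ℝ (Fin n))) '' K))) ⟨z, hz⟩

lemma minPolarVolume_pos (hK : IsConvexBody K) : 0 < minPolarVolume K := by
  obtain ⟨R, hR⟩ := hK.isCompact.isBounded.exists_norm_le
  have hR0 : 0 ≤ R := by
    obtain ⟨x, hx⟩ := hK.nonempty_interior
    exact (norm_nonneg x).trans (hR x (interior_subset hx))
  refine (Metric.measure_ball_pos volume (0 : EuclideanSpace ℝ (Fin n))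
    (show 0 < (R + R + 1)⁻¹ by positivity)).trans_le (le_iInf fun z => measure_mono fun y hy => ?_)
  rintro _ ⟨x, hx, rfl⟩
  rw [mem_ball_zero_iff] at hy
  have hxz : ‖x - z‖ ≤ R + R :=
    (norm_sub_le _ _).trans (add_le_add (hR x hx) (hR z (interior_subset z.2)))
  calc ⟪x - z, y⟫_ℝ ≤ ‖x - z‖ * ‖y‖ := real_inner_le_norm _ _
    _ ≤ (R + R + 1) * (R + R + 1)⁻¹ := by gcongr; linarith
    _ = 1 := mul_inv_cancel₀ (by positivity)

lemma volume_polarSet_ne_top (hθ : ‖θ‖ = 1) (hK : IsConvexBody K) (hz : z ∈ interior K) :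
    volume (polarSet ((fun x => x - z) '' K)) ≠ ∞ := by
  obtain _ | m := n
  · simp [Subsingleton.elim θ 0] at hθ
  rw [volume_polarSet_eq_add hθ]
  exact ENNReal.add_ne_top.2 ⟨halfPolarVolume_ne_top hθ hK hz,
    halfPolarVolume_ne_top (by rwa [norm_neg]) hK hz⟩

lemma minPolarVolume_ne_top (hθ : ‖θ‖ = 1) (hK : IsConvexBody K) : minPolarVolume K ≠ ∞ := by
  obtain ⟨z, hz⟩ := hK.nonempty_interior
  exact ne_top_of_le_ne_top (volume_polarSet_ne_top hθ hK hz) (minPolarVolume_le hz)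

lemma minPolarVolume_toReal_pos (hθ : ‖θ‖ = 1) (hK : IsConvexBody K) :
    0 < (minPolarVolume K).toReal :=
  ENNReal.toReal_pos (minPolarVolume_pos hK).ne' (minPolarVolume_ne_top hθ hK)

lemma inv_volume_polarSet_le (hθ : ‖θ‖ = 1) (hK : IsConvexBody K) (hz : z ∈ interior K) :
    (volume (polarSet ((fun x => x - z) '' K))).toReal⁻¹ ≤ (minPolarVolume K).toReal⁻¹ :=
  inv_anti₀ (minPolarVolume_toReal_pos hθ hK)
    (ENNReal.toReal_mono (volume_polarSet_ne_top hθ hK hz) (minPolarVolume_le hz))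

lemma inv_minPolarVolume_le (hθ : ‖θ‖ = 1) (hK : IsConvexBody K) {c : ℝ} (hc : 0 < c)
    (h : ∀ z ∈ interior K, (volume (polarSet ((fun x => x - z) '' K))).toReal⁻¹ ≤ c) :
    (minPolarVolume K).toReal⁻¹ ≤ c := by
  refine inv_le_of_inv_le₀ hc ?_
  rw [← ENNReal.ofReal_le_iff_le_toReal (minPolarVolume_ne_top hθ hK)]
  refine le_iInf fun z => ?_
  have hvol := (minPolarVolume_toReal_pos hθ hK).trans_le
    (ENNReal.toReal_mono (volume_polarSet_ne_top hθ hK z.2) (minPolarVolume_le z.2))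
  exact ENNReal.ofReal_le_of_le_toReal (inv_le_of_inv_le₀ hvol (h z z.2))

end minPolarVolume

/-- Shadow system theorem (Campi–Gronchi, Meyer–Reisner): if `(K_t)_{t ∈ (a,b)}` is a shadow
system of convex bodies along a direction `θ`, then `t ↦ vol((K_t)^{s(K_t)})⁻¹` is convex
on `(a,b)`. -/
theorem shadow_system_inverse_polar_volume_convex (n : ℕ) (a b : ℝ)
    (K : ℝ → Set (EuclideanSpace ℝ (Fin n)))
    (θ : EuclideanSpace ℝ (Fin n)) (hθ : ‖θ‖ = 1)
    (M : Set (EuclideanSpace ℝ (Fin n))) (hM : Bornology.IsBounded M)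
    (α : EuclideanSpace ℝ (Fin n) → ℝ) (hα : ∃ C : ℝ, ∀ x ∈ M, |α x| ≤ C)
    (hshadow : ∀ t ∈ Set.Ioo a b,
      K t = closure (convexHull ℝ ((fun x => x + (t * α x) • θ) '' M)))
    (hbody : ∀ t ∈ Set.Ioo a b, IsConvexBody (K t)) :
    ConvexOn ℝ (Set.Ioo a b) (fun t => ((minPolarVolume (K t)).toReal)⁻¹) := by
  refine convexOn_iff_forall_pos.2 ⟨convex_Ioo a b, fun t₀ ht₀ t₁ ht₁ c d hc hd hcd => ?_⟩
  have ht := convex_Ioo a b ht₀ ht₁ hc.le hd.le hcd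
  have hK₀ := hbody _ ht₀
  have hK₁ := hbody _ ht₁
  have hK := hbody _ ht
  simp only [smul_eq_mul] at ht hK ⊢
  have e {t} (ht : t ∈ Set.Ioo a b) : K t = shadowBody θ M α t := hshadow t ht
  rw [e ht₀] at hK₀ ⊢
  rw [e ht₁] at hK₁ ⊢
  rw [e ht] at hK ⊢
  have := minPolarVolume_toReal_pos hθ hK₀
  have := minPolarVolume_toReal_pos hθ hK₁
  refine inv_minPolarVolume_le hθ hK (by positivity) fun z hz => ?_
  obtain ⟨z₀, hz₀, z₁, hz₁, h⟩ := exists_inv_volume_polarSet_le hθ hc hd hcd hK₀ hK₁ hK hz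
  refine h.trans ?_
  exact add_le_add (mul_le_mul_of_nonneg_left (inv_volume_polarSet_le hθ hK₀ hz₀) hc.le)
    (mul_le_mul_of_nonneg_left (inv_volume_polarSet_le hθ hK₁ hz₁) hd.le)
end
end

section
/- If K is a centrally symmetric convex body in ℝⁿ (K = −K with 0 ∈ int K) and H is a linear hyperplane, then vol(K*) ≤ vol((S_H K)*), where S_H K is the Steiner symmetral of K with respect to H. Consequently the volume product does not decrease under Steiner symmetrization: vol(K)·vol(K*) ≤ vol(S_H K)·vol((S_H K)*). -/
open MeasureTheory Filter
open scoped InnerProductSpace Pointwise NNReal ENNReal Topology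

noncomputable section

/-- The Steiner symmetral of `K` with respect to the linear hyperplane with unit normal `u`:
writing points of `K` as `y + s • u` with `y ⊥ u`, it consists of the points
`y + ((s₁ - s₂)/2) • u` with `y + s₁ • u, y + s₂ • u ∈ K`. -/
def steinerSymmetral {n : ℕ} (u : EuclideanSpace ℝ (Fin n))
    (K : Set (EuclideanSpace ℝ (Fin n))) : Set (EuclideanSpace ℝ (Fin n)) :=
  {z | ∃ (y : EuclideanSpace ℝ (Fin n)) (s₁ s₂ : ℝ), ⟪u, y⟫_ℝ = 0 ∧
    y + s₁ • u ∈ K ∧ y + s₂ • u ∈ K ∧ z = y + ((s₁ - s₂) / 2) • u}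

/-- The multiplicative midpoint Brunn–Minkowski inequality for a measure, stated for compact sets
`A`, `B` and a measurable set `C` containing all midpoints between `A` and `B`. -/
def MidpointBrunnMinkowski {E : Type*} [AddCommGroup E] [Module ℝ E] [TopologicalSpace E]
    [MeasurableSpace E] (μ : Measure E) : Prop :=
  ∀ A B C : Set E, IsCompact A → IsCompact B → MeasurableSet C →
    (∀ a ∈ A, ∀ b ∈ B, (2⁻¹ : ℝ) • (a + b) ∈ C) → μ A * μ B ≤ μ C ^ 2

lemma volume_add_le_of_midpoint_mem_of_isCompact {A B C : Set ℝ} (hA : IsCompact A)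
    (hB : IsCompact B) (hA0 : A.Nonempty) (hB0 : B.Nonempty)
    (h : ∀ a ∈ A, ∀ b ∈ B, (2⁻¹ : ℝ) * (a + b) ∈ C) :
    volume A + volume B ≤ 2 * volume C := by
  obtain ⟨a, ha⟩ := hA.exists_isGreatest hA0
  obtain ⟨b, hb⟩ := hB.exists_isLeast hB0
  have hC : volume ((fun x : ℝ => 2⁻¹ * x) ⁻¹' C) = 2 * volume C := by
    rw [Real.volume_preimage_mul_left (by norm_num)]
    norm_num
  have hA' : volume ((fun x : ℝ => x + -b) ⁻¹' A) = volume A := measure_preimage_add_right _ _ _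
  have hB' : volume ((fun x : ℝ => x + -a) ⁻¹' B) = volume B := measure_preimage_add_right _ _ _
  rw [← hC, ← hA', ← hB', ← measure_union₀]
  · apply measure_mono
    rintro x (hx | hx)
    · have := h _ hx _ hb.1
      simpa using this
    · have := h _ ha.1 _ hx
      simpa using this
  · exact ((measurable_id.add_const _) hB.measurableSet).nullMeasurableSet
  · refine measure_mono_null (t := {a + b}) ?_ (by simp)
    rintro x ⟨hx, hx'⟩
    have h1 := ha.2 hx
    have h2 := hb.2 hx'
    simp only at h1 h2
    simp only [Set.mem_singleton_iff]
    linarith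

lemma volume_add_le_of_midpoint_mem {A B C : Set ℝ} (hA : MeasurableSet A)
    (hB : MeasurableSet B) (hA0 : A.Nonempty) (hB0 : B.Nonempty)
    (h : ∀ a ∈ A, ∀ b ∈ B, (2⁻¹ : ℝ) * (a + b) ∈ C) :
    volume A + volume B ≤ 2 * volume C := by
  obtain ⟨a, ha⟩ := hA0
  obtain ⟨b, hb⟩ := hB0
  have hsup : ∀ {S : Set ℝ} {x : ℝ}, MeasurableSet S → x ∈ S →
      volume S = ⨆ k : {k : Set ℝ // k ⊆ S ∧ IsCompact k ∧ k.Nonempty}, volume k.1 := by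
    intro S x hS hx
    refine le_antisymm ?_ (iSup_le fun k => measure_mono k.2.1)
    rw [hS.measure_eq_iSup_isCompact]
    refine iSup_le fun k => iSup_le fun hkS => iSup_le fun hk => ?_
    exact (measure_mono (Set.subset_insert x k)).trans (le_iSup
      (fun k : {k : Set ℝ // k ⊆ S ∧ IsCompact k ∧ k.Nonempty} => volume k.1)
      ⟨insert x k, Set.insert_subset hx hkS, hk.insert x, Set.insert_nonempty x k⟩)
  rw [hsup hA ha, hsup hB hb]
  have : Nonempty {k : Set ℝ // k ⊆ A ∧ IsCompact k ∧ k.Nonempty} :=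
    ⟨{a}, by simpa using ha, isCompact_singleton, Set.singleton_nonempty a⟩
  have : Nonempty {k : Set ℝ // k ⊆ B ∧ IsCompact k ∧ k.Nonempty} :=
    ⟨{b}, by simpa using hb, isCompact_singleton, Set.singleton_nonempty b⟩
  refine ENNReal.iSup_add_iSup_le (fun k l => ?_)
  exact volume_add_le_of_midpoint_mem_of_isCompact k.2.2.1 l.2.2.1 k.2.2.2 l.2.2.2
    fun x hx y hy => h x (k.2.1 hx) y (l.2.1 hy)

lemma ENNReal.mul_le_sq_of_add_le_two_mul {a b c : ℝ≥0∞} (h : a + b ≤ 2 * c) :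
    a * b ≤ c ^ 2 := by
  by_cases hc : c = ∞
  · simp [hc]
  have hab : a + b ≠ ∞ := ne_top_of_le_ne_top (ENNReal.mul_ne_top (by simp) hc) h
  obtain ⟨ha, hb⟩ := ENNReal.add_ne_top.1 hab
  lift a to ℝ≥0 using ha
  lift b to ℝ≥0 using hb
  lift c to ℝ≥0 using hc
  norm_cast at h ⊢
  rw [← NNReal.coe_le_coe] at h ⊢
  push_cast at h ⊢
  nlinarith [sq_nonneg ((a : ℝ) - b), a.2, b.2, c.2]

lemma lintegral_eq_lintegral_meas_lt_of_le_one {α : Type*} [MeasurableSpace α] (μ : Measure α)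
    {f : α → ℝ≥0∞} (hf : Measurable f) (hf1 : ∀ x, f x ≤ 1) :
    ∫⁻ x, f x ∂μ = ∫⁻ t in Set.Ioo (0 : ℝ) 1, μ {x | ENNReal.ofReal t < f x} := by
  have hfin : ∀ x, f x ≠ ∞ := fun x => ne_top_of_le_ne_top ENNReal.one_ne_top (hf1 x)
  have h1 : ∫⁻ x, f x ∂μ = ∫⁻ x, ENNReal.ofReal (f x).toReal ∂μ := by
    simp [ENNReal.ofReal_toReal (hfin _)]
  have h2 : ∀ t ∈ Set.Ioi (0 : ℝ), μ {x | t < (f x).toReal} =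
      (Set.Ioo (0 : ℝ) 1).indicator (fun t => μ {x | ENNReal.ofReal t < f x}) t := by
    intro t ht
    by_cases ht1 : t < 1
    · rw [Set.indicator_of_mem (show t ∈ Set.Ioo (0 : ℝ) 1 from ⟨ht, ht1⟩)]
      congr 1
      ext x
      exact (ENNReal.ofReal_lt_iff_lt_toReal (le_of_lt ht) (hfin x)).symm
    · rw [Set.indicator_of_notMem (fun h => ht1 h.2)]
      convert measure_empty (μ := μ)
      ext x
      have := ENNReal.toReal_mono ENNReal.one_ne_top (hf1 x)
      simp only [ENNReal.toReal_one] at this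
      simp only [Set.mem_ofPred_eq, Set.mem_empty_iff_false, iff_false]
      linarith
  rw [h1, lintegral_eq_lintegral_meas_lt μ (Eventually.of_forall fun x => ENNReal.toReal_nonneg)
    hf.ennreal_toReal.aemeasurable, setLIntegral_congr_fun measurableSet_Ioi h2,
    setLIntegral_indicator measurableSet_Ioo,
    Set.inter_eq_left.2 Set.Ioo_subset_Ioi_self]

/-- The one-dimensional Prékopa–Leindler inequality, in additive form, for functions normalized to
have supremum one. -/
lemma lintegral_add_le_of_midpoint_of_iSup_eq_one {f g h : ℝ → ℝ≥0∞} (hf : Measurable f)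
    (hg : Measurable g) (hh : Measurable h) (hf1 : ⨆ x, f x = 1) (hg1 : ⨆ x, g x = 1)
    (hfg : ∀ x y, f x * g y ≤ h (2⁻¹ * (x + y)) ^ 2) :
    (∫⁻ x, f x) + ∫⁻ x, g x ≤ 2 * ∫⁻ x, h x := by
  have hf1' : ∀ x, f x ≤ 1 := fun x => hf1 ▸ le_iSup f x
  have hg1' : ∀ x, g x ≤ 1 := fun x => hg1 ▸ le_iSup g x
  have hmono : ∫⁻ x, min (h x) 1 ≤ ∫⁻ x, h x := lintegral_mono fun x => min_le_left _ _
  refine le_trans ?_ (mul_le_mul_right hmono 2)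
  have hmeas : ∀ k : ℝ → ℝ≥0∞, Measurable fun t : ℝ => volume {x | ENNReal.ofReal t < k x} := by
    intro k
    refine Antitone.measurable fun s t hst => measure_mono fun x hx => ?_
    exact lt_of_le_of_lt (ENNReal.ofReal_le_ofReal hst) hx
  rw [lintegral_eq_lintegral_meas_lt_of_le_one _ hf hf1',
    lintegral_eq_lintegral_meas_lt_of_le_one _ hg hg1',
    lintegral_eq_lintegral_meas_lt_of_le_one _ (hh.min measurable_const) (fun x => min_le_right _ _),
    ← lintegral_add_left (hmeas f), ← lintegral_const_mul _ (hmeas _)]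
  refine setLIntegral_mono (hmeas _ |>.const_mul _) fun t ht => ?_
  have ht1 : ENNReal.ofReal t < 1 := by simpa using ht.2
  refine volume_add_le_of_midpoint_mem (measurableSet_lt measurable_const hf)
    (measurableSet_lt measurable_const hg) ?_ ?_ ?_
  · exact lt_iSup_iff.1 (hf1.symm ▸ ht1)
  · exact lt_iSup_iff.1 (hg1.symm ▸ ht1)
  intro x hx y hy
  refine lt_min ?_ ht1
  have h1 : ENNReal.ofReal t ^ 2 < h (2⁻¹ * (x + y)) ^ 2 := by
    rw [sq]
    exact (ENNReal.mul_lt_mul hx hy).trans_le (hfg x y)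
  exact lt_of_pow_lt_pow_left' 2 h1

/-- The one-dimensional midpoint **Prékopa–Leindler inequality** for bounded functions. -/
lemma lintegral_mul_lintegral_le_sq_of_midpoint {f g h : ℝ → ℝ≥0∞} (hf : Measurable f)
    (hg : Measurable g) (hh : Measurable h) (hfb : ⨆ x, f x ≠ ∞) (hgb : ⨆ x, g x ≠ ∞)
    (hfg : ∀ x y, f x * g y ≤ h (2⁻¹ * (x + y)) ^ 2) :
    (∫⁻ x, f x) * ∫⁻ x, g x ≤ (∫⁻ x, h x) ^ 2 := by
  by_cases hF0 : ⨆ x, f x = 0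
  · simp [ENNReal.iSup_eq_zero.1 hF0]
  by_cases hG0 : ⨆ x, g x = 0
  · simp [ENNReal.iSup_eq_zero.1 hG0]
  set F := ⨆ x, f x with hF
  set G := ⨆ x, g x with hG
  obtain ⟨s, hs⟩ : ∃ s : ℝ≥0∞, s ^ 2 = F⁻¹ * G⁻¹ :=
    ⟨(F⁻¹ * G⁻¹) ^ (2⁻¹ : ℝ), by rw [← ENNReal.rpow_natCast, ← ENNReal.rpow_mul]; simp⟩
  have key := lintegral_add_le_of_midpoint_of_iSup_eq_one (hf.const_mul F⁻¹) (hg.const_mul G⁻¹)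
    (hh.const_mul s) (by rw [← ENNReal.mul_iSup, ← hF, ENNReal.inv_mul_cancel hF0 hfb])
    (by rw [← ENNReal.mul_iSup, ← hG, ENNReal.inv_mul_cancel hG0 hgb])
    (fun x y => by
      rw [mul_pow, hs, mul_mul_mul_comm]
      exact mul_le_mul_right (hfg x y) _)
  rw [lintegral_const_mul _ hf, lintegral_const_mul _ hg, lintegral_const_mul _ hh] at key
  have key2 := ENNReal.mul_le_sq_of_add_le_two_mul key
  rw [mul_pow, hs, mul_mul_mul_comm] at key2
  refine (ENNReal.mul_le_mul_iff_right ?_ ?_).1 key2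
  · simp [hfb, hgb]
  · exact ENNReal.mul_ne_top (by simpa using hF0) (by simpa using hG0)

lemma IsCompact.preimage_prodMk {X Y : Type*} [TopologicalSpace X] [TopologicalSpace Y]
    [T1Space X] {A : Set (X × Y)} (hA : IsCompact A) (x : X) :
    IsCompact (Prod.mk x ⁻¹' A) := by
  have : Prod.mk x ⁻¹' A = Prod.snd '' (A ∩ Prod.fst ⁻¹' {x}) := by
    ext y
    constructor
    · exact fun hy => ⟨(x, y), ⟨hy, rfl⟩, rfl⟩
    · rintro ⟨⟨x', y'⟩, ⟨h, rfl⟩, rfl⟩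
      exact h
  rw [this]
  exact (hA.inter_right (isClosed_singleton.preimage continuous_fst)).image continuous_snd

lemma MidpointBrunnMinkowski.prod_real {E : Type*} [NormedAddCommGroup E] [NormedSpace ℝ E]
    [MeasurableSpace E] [BorelSpace E] [SecondCountableTopology E] {μ : Measure E} [SFinite μ]
    [IsFiniteMeasureOnCompacts μ] (hμ : MidpointBrunnMinkowski μ) :
    MidpointBrunnMinkowski ((volume : Measure ℝ).prod μ) := by
  intro A B C hA hB hC h
  have hbdd : ∀ A : Set (ℝ × E), IsCompact A → ⨆ t, μ (Prod.mk t ⁻¹' A) ≠ ∞ := by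
    intro A hA
    refine ne_top_of_le_ne_top ((hA.image continuous_snd).measure_lt_top (μ := μ)).ne (iSup_le fun t => ?_)
    exact measure_mono fun x hx => ⟨(t, x), hx, rfl⟩
  rw [Measure.prod_apply hA.measurableSet, Measure.prod_apply hB.measurableSet,
    Measure.prod_apply hC]
  refine lintegral_mul_lintegral_le_sq_of_midpoint (measurable_measure_prodMk_left hA.measurableSet)
    (measurable_measure_prodMk_left hB.measurableSet) (measurable_measure_prodMk_left hC)
    (hbdd A hA) (hbdd B hB) fun s t => ?_
  exact hμ _ _ _ (hA.preimage_prodMk s) (hB.preimage_prodMk t) (measurable_prodMk_left hC)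
    fun a ha b hb => h _ ha _ hb

lemma midpointBrunnMinkowski_volume_pi (m : ℕ) :
    MidpointBrunnMinkowski (volume : Measure (Fin m → ℝ)) := by
  induction m with
  | zero =>
    intro A B C _ _ _ h
    rcases A.eq_empty_or_nonempty with rfl | ⟨a, ha⟩
    · simp
    rcases B.eq_empty_or_nonempty with rfl | ⟨b, hb⟩
    · simp
    have hC : C = Set.univ := Subsingleton.eq_univ_of_nonempty ⟨_, h a ha b hb⟩
    rw [hC, sq]
    exact mul_le_mul' (measure_mono (Set.subset_univ _)) (measure_mono (Set.subset_univ _))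
  | succ m ih =>
    intro A B C hA hB hC h
    have hmp := (volume_preserving_piFinSuccAbove (fun _ : Fin (m + 1) => ℝ) 0).symm
    set e := (MeasurableEquiv.piFinSuccAbove (fun _ : Fin (m + 1) => ℝ) 0).symm with he
    have hcomp : ∀ A : Set (Fin (m + 1) → ℝ), IsCompact A → IsCompact (e ⁻¹' A) := by
      intro A hA
      rw [he, ← MeasurableEquiv.image_symm, MeasurableEquiv.symm_symm]
      refine hA.image ?_
      change Continuous fun f : Fin (m + 1) → ℝ => (f 0, Fin.removeNth 0 f)
      unfold Fin.removeNth
      fun_prop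
    have hadd : ∀ p q, e ((2⁻¹ : ℝ) • (p + q)) = (2⁻¹ : ℝ) • (e p + e q) := by
      intro p q
      ext i
      refine Fin.cases ?_ (fun j => ?_) i <;> simp [he, mul_add]
    rw [← hmp.measure_preimage_equiv A, ← hmp.measure_preimage_equiv B,
      ← hmp.measure_preimage_equiv C]
    refine ih.prod_real _ _ _ (hcomp A hA) (hcomp B hB) (e.measurable hC) fun a ha b hb => ?_
    rw [Set.mem_preimage, hadd]
    exact h _ ha _ hb

section Body

variable {n : ℕ} {K : Set (EuclideanSpace ℝ (Fin n))} {u : EuclideanSpace ℝ (Fin n)}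

/-- A linear parametrization of Euclidean space by `ℝ × ℝᵐ` adapted to the hyperplane orthogonal
to a unit vector. -/
lemma exists_orthogonal_parametrization (hu : ‖u‖ = 1) :
    ∃ (m : ℕ) (J : (ℝ × (Fin m → ℝ)) ≃L[ℝ] EuclideanSpace ℝ (Fin n)) (c : ℝ≥0),
      (∀ t x, J (t, x) = t • u + J (0, x)) ∧ (∀ x, ⟪u, J (0, x)⟫_ℝ = 0) ∧
      ∀ S : Set (EuclideanSpace ℝ (Fin n)),
        volume S = c * ((volume : Measure ℝ).prod (volume : Measure (Fin m → ℝ))) (J ⁻¹' S) := by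
  set H : Submodule ℝ (EuclideanSpace ℝ (Fin n)) := (ℝ ∙ u)ᗮ with hH
  let ι : (Fin (Module.finrank ℝ H) → ℝ) ≃ₗ[ℝ] H := LinearEquiv.ofFinrankEq _ _ (by simp)
  have hι : ∀ x, ⟪u, (ι x : EuclideanSpace ℝ (Fin n))⟫_ℝ = 0 := fun x =>
    Submodule.mem_orthogonal_singleton_iff_inner_right.1 (ι x).2
  let L : (ℝ × (Fin (Module.finrank ℝ H) → ℝ)) →ₗ[ℝ] EuclideanSpace ℝ (Fin n) :=
    (LinearMap.toSpanSingleton ℝ _ u).coprod (H.subtype ∘ₗ ι.toLinearMap)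
  have hL : ∀ t x, L (t, x) = t • u + ι x := fun t x => by simp [L]
  have hbij : Function.Bijective L := by
    constructor
    · have hu0 : u ≠ 0 := by
        rintro rfl
        simp at hu
      rw [← LinearMap.ker_eq_bot, LinearMap.ker_eq_bot']
      rintro ⟨t, x⟩ h
      rw [hL] at h
      have ht : t = 0 := by
        have := congrArg (fun z => ⟪u, z⟫_ℝ) h
        simpa [inner_add_right, inner_smul_right, hu, hι, hu0] using this
      subst ht
      simpa using h
    · intro z
      have hz : z - ⟪u, z⟫_ℝ • u ∈ H := by
        rw [hH, Submodule.mem_orthogonal_singleton_iff_inner_right]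
        simp [inner_sub_right, inner_smul_right, hu]
      refine ⟨(⟪u, z⟫_ℝ, ι.symm ⟨_, hz⟩), ?_⟩
      rw [hL]
      simp
  let J := (LinearEquiv.ofBijective L hbij).toContinuousLinearEquiv
  have hJ : ∀ t x, J (t, x) = t • u + ι x := hL
  have hμ : (Measure.map J.symm volume).IsAddHaarMeasure := J.symm.isAddHaarMeasure_map volume
  refine ⟨_, J, (Measure.map J.symm volume).addHaarScalarFactor
    ((volume : Measure ℝ).prod volume), fun t x => ?_, fun x => ?_, fun S => ?_⟩
  · simp [hJ]
  · simp [hJ, hι]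
  · have h1 : volume S = Measure.map J.symm volume (J ⁻¹' S) := by
      have := J.symm.toHomeomorph.toMeasurableEquiv.map_apply (μ := volume) (J ⁻¹' S)
      refine Eq.trans ?_ this.symm
      congr 1
      ext z
      simp
    rw [h1]
    conv_lhs => rw [Measure.isAddLeftInvariant_eq_smul (Measure.map J.symm volume)
      ((volume : Measure ℝ).prod volume)]
    rfl

lemma isClosed_polarSet_s4 : IsClosed (polarSet K) := by
  have : polarSet K = ⋂ x ∈ K, {y | ⟪x, y⟫_ℝ ≤ 1} := by
    ext; simp [polarSet]
  rw [this]
  exact isClosed_biInter fun x _ => isClosed_le (by fun_prop) continuous_const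

lemma IsConvexBody.isCompact_polarSet (hK : IsConvexBody K) (hsym : K = -K) :
    IsCompact (polarSet K) := by
  obtain ⟨x, hx⟩ := hK.nonempty_interior
  have hx' : -x ∈ interior K := by
    rw [hsym]
    exact ((Homeomorph.neg _).preimage_interior K ▸ by simpa using hx)
  have h0 : (0 : EuclideanSpace ℝ (Fin n)) ∈ interior K := by
    have := hK.convex.interior hx hx' (a := 2⁻¹) (b := 2⁻¹) (by norm_num) (by norm_num)
      (by norm_num)
    simpa using this
  obtain ⟨r, hr, hrK⟩ := Metric.mem_nhds_iff.1 (mem_interior_iff_mem_nhds.1 h0)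
  refine Metric.isCompact_of_isClosed_isBounded isClosed_polarSet_s4
    (isBounded_iff_forall_norm_le.2 ⟨2 / r, fun y hy => ?_⟩)
  by_cases hy0 : ‖y‖ = 0
  · rw [hy0]; positivity
  have hmem : ((r / 2) / ‖y‖) • y ∈ K := by
    apply hrK
    rw [mem_ball_zero_iff, norm_smul, Real.norm_of_nonneg (by positivity),
      div_mul_cancel₀ _ hy0]
    linarith
  have h1 := hy _ hmem
  rw [real_inner_smul_left, real_inner_self_eq_norm_sq] at h1
  have h2 : r / 2 / ‖y‖ * ‖y‖ ^ 2 = r / 2 * ‖y‖ := by field_simp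
  rw [le_div_iff₀ hr]
  linarith

lemma isCompact_steinerSymmetral (hK : IsCompact K) (hu : ‖u‖ = 1) :
    IsCompact (steinerSymmetral u K) := by
  have : steinerSymmetral u K =
      (fun p : EuclideanSpace ℝ (Fin n) × EuclideanSpace ℝ (Fin n) =>
        (p.1 - ⟪u, p.1⟫_ℝ • u) + ((⟪u, p.1⟫_ℝ - ⟪u, p.2⟫_ℝ) / 2) • u) ''
      (K ×ˢ K ∩ {p | p.1 - ⟪u, p.1⟫_ℝ • u = p.2 - ⟪u, p.2⟫_ℝ • u}) := by
    ext z
    constructor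
    · rintro ⟨y, s₁, s₂, hy, h₁, h₂, rfl⟩
      refine ⟨(y + s₁ • u, y + s₂ • u), ⟨⟨h₁, h₂⟩, ?_⟩, ?_⟩ <;>
        simp [inner_add_right, inner_smul_right, hy, hu]
    · rintro ⟨⟨p, q⟩, ⟨⟨hp, hq⟩, hpq⟩, rfl⟩
      simp only [Set.mem_ofPred_eq] at hpq
      refine ⟨p - ⟪u, p⟫_ℝ • u, ⟪u, p⟫_ℝ, ⟪u, q⟫_ℝ, ?_, by simpa using hp, ?_, rfl⟩
      · simp [inner_sub_right, inner_smul_right, hu]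
      · rw [hpq]
        simpa using hq
  rw [this]
  refine ((hK.prod hK).inter_right (isClosed_eq (by fun_prop) (by fun_prop))).image (by fun_prop)

lemma neg_mem_polarSet (hsym : K = -K) {y : EuclideanSpace ℝ (Fin n)} :
    -y ∈ polarSet K ↔ y ∈ polarSet K := by
  have key : ∀ y ∈ polarSet K, -y ∈ polarSet K := by
    intro y hy x hx
    rw [hsym] at hx
    have := hy _ hx
    rwa [inner_neg_left, ← inner_neg_right] at this
  exact ⟨fun h => by simpa using key _ h, key y⟩

lemma volume_polarSet_le_volume_polarSet_steinerSymmetral (hK : IsConvexBody K) (hsym : K = -K)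
    (hu : ‖u‖ = 1) :
    volume (polarSet K) ≤ volume (polarSet (steinerSymmetral u K)) := by
  obtain ⟨m, J, c, hJ, hJu, hvol⟩ := exists_orthogonal_parametrization hu
  have huu : ⟪u, u⟫_ℝ = 1 := by rw [real_inner_self_eq_norm_sq, hu]; norm_num
  have hP : IsCompact (J ⁻¹' polarSet K) :=
    J.toHomeomorph.isCompact_preimage.2 (hK.isCompact_polarSet hsym)
  have hQ : MeasurableSet (J ⁻¹' polarSet (steinerSymmetral u K)) :=
    (isClosed_polarSet_s4.preimage J.continuous).measurableSet
  rw [hvol, hvol (polarSet (steinerSymmetral u K)), Measure.prod_apply hP.measurableSet,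
    Measure.prod_apply hQ]
  refine mul_le_mul_right (lintegral_mono fun t => ?_) _
  have hneg : volume (Prod.mk (-t) ⁻¹' (J ⁻¹' polarSet K)) =
      volume (Prod.mk t ⁻¹' (J ⁻¹' polarSet K)) := by
    rw [← Measure.measure_neg]
    congr 1
    ext x
    simp only [Set.mem_neg, Set.mem_preimage]
    rw [← neg_mem_polarSet hsym, ← map_neg]
    simp
  have hBM := midpointBrunnMinkowski_volume_pi m _ _ _ (hP.preimage_prodMk t)
    (hP.preimage_prodMk (-t)) (measurable_prodMk_left (x := t) hQ) (by
      rintro x₁ h₁ x₂ h₂ z ⟨y, s₁, s₂, hy, hy₁, hy₂, rfl⟩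
      have e₁ := h₁ _ hy₁
      have e₂ := h₂ _ hy₂
      have hy' : ⟪y, u⟫_ℝ = 0 := by rw [real_inner_comm, hy]
      have hlin : J (0, (2⁻¹ : ℝ) • (x₁ + x₂)) = (2⁻¹ : ℝ) • (J (0, x₁) + J (0, x₂)) := by
        rw [← map_add, ← map_smul]
        simp
      rw [hJ] at e₁ e₂ ⊢
      rw [hlin]
      simp only [inner_add_left, inner_add_right, real_inner_smul_left, real_inner_smul_right,
        huu, hJu, hy'] at e₁ e₂ ⊢
      linarith)
  rw [hneg, ← sq] at hBM
  exact (ENNReal.pow_le_pow_left_iff two_ne_zero).1 hBM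

lemma volume_le_volume_steinerSymmetral (hK : IsCompact K) (hu : ‖u‖ = 1) :
    volume K ≤ volume (steinerSymmetral u K) := by
  obtain ⟨m, J, c, hJ, hJu, hvol⟩ := exists_orthogonal_parametrization hu
  have hK' : MeasurableSet (J ⁻¹' K) := (hK.isClosed.preimage J.continuous).measurableSet
  have hS : MeasurableSet (J ⁻¹' steinerSymmetral u K) :=
    ((isCompact_steinerSymmetral hK hu).isClosed.preimage J.continuous).measurableSet
  rw [hvol, hvol (steinerSymmetral u K), Measure.prod_apply_symm hK', Measure.prod_apply_symm hS]
  refine mul_le_mul_right (lintegral_mono fun x => ?_) _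
  set A := (fun t => (t, x)) ⁻¹' (J ⁻¹' K) with hA
  have hAm : MeasurableSet A := measurable_prodMk_right hK'
  rcases A.eq_empty_or_nonempty with hA0 | hA0
  · simp [hA0]
  have key := volume_add_le_of_midpoint_mem hAm hAm.neg hA0 hA0.neg
    (C := (fun t => (t, x)) ⁻¹' (J ⁻¹' steinerSymmetral u K)) (by
      intro a ha b hb
      have ha' : J (a, x) ∈ K := ha
      have hb' : J (-b, x) ∈ K := hb
      rw [hJ, add_comm] at ha' hb'
      refine ⟨J (0, x), a, -b, hJu x, ha', hb', ?_⟩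
      rw [hJ, add_comm]
      congr 2
      ring)
  rw [Measure.measure_neg, ← two_mul] at key
  exact (ENNReal.mul_le_mul_iff_right (by simp) (by simp)).1 key

end Body

/-- For a centrally symmetric convex body `K` and a linear hyperplane `H` (with unit normal
`u`), `vol(K*) ≤ vol((S_H K)*)`; consequently the volume product does not decrease under
Steiner symmetrization. -/
theorem steiner_symmetrization_increases_volume_product (n : ℕ)
    (K : Set (EuclideanSpace ℝ (Fin n))) (hK : IsConvexBody K) (hsym : K = -K)
    (u : EuclideanSpace ℝ (Fin n)) (hu : ‖u‖ = 1) :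
    volume (polarSet K) ≤ volume (polarSet (steinerSymmetral u K)) ∧
    volume K * volume (polarSet K) ≤
      volume (steinerSymmetral u K) * volume (polarSet (steinerSymmetral u K)) := by
  have h := volume_polarSet_le_volume_polarSet_steinerSymmetral hK hsym hu
  exact ⟨h, mul_le_mul' (volume_le_volume_steinerSymmetral hK.isCompact hu) h⟩
end
end

section
/- Mahler's theorem in the plane (general case, with equality case by Meyer): for every convex body K in ℝ², the volume product satisfies P(K) ≥ P(Δ₂) = 27/4, where Δ₂ is a triangle, with equality if and only if K is a triangle (the image of a fixed nondegenerate simplex in ℝ² under an invertible affine map). -/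
open MeasureTheory Filter
open scoped InnerProductSpace Pointwise NNReal ENNReal Topology

noncomputable section

/-- The volume product `P(K) = vol K * min_{z ∈ int K} vol ((K - z)*)`. -/
def volumeProduct {n : ℕ} (K : Set (EuclideanSpace ℝ (Fin n))) : ℝ≥0∞ :=
  volume K * ⨅ z : interior K, volume (polarSet ((fun x => x - (z : EuclideanSpace ℝ (Fin n))) '' K))

/-- A fixed nondegenerate triangle (2-simplex) in the plane. -/
def stdTriangle : Set (EuclideanSpace ℝ (Fin 2)) :=
  convexHull ℝ {0, EuclideanSpace.single 0 (1 : ℝ), EuclideanSpace.single 1 (1 : ℝ)}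

/-- The Euclidean plane. -/
abbrev Plane := EuclideanSpace ℝ (Fin 2)

theorem plane_inner (x y : Plane) : ⟪x, y⟫_ℝ = x 0 * y 0 + x 1 * y 1 := by
  simp [PiLp.inner_apply, Fin.sum_univ_two, mul_comm]

theorem Convex.add_three_mem {L : Set Plane} (hL : Convex ℝ L) {p q r : Plane} (hp : p ∈ L)
    (hq : q ∈ L) (hr : r ∈ L) {a b c : ℝ} (ha : 0 ≤ a) (hb : 0 ≤ b) (hc : 0 ≤ c)
    (h : a + b + c = 1) : a • p + b • q + c • r ∈ L := by
  have := hL.sum_mem (t := Finset.univ) (w := ![a, b, c]) (z := ![p, q, r])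
    (by intro i _; fin_cases i <;> simp [ha, hb, hc])
    (by simpa [Fin.sum_univ_three] using h)
    (by intro i _; fin_cases i <;> simp [hp, hq, hr])
  simpa [Fin.sum_univ_three] using this

theorem mem_stdTriangle {x : Plane} :
    x ∈ stdTriangle ↔ 0 ≤ x 0 ∧ 0 ≤ x 1 ∧ x 0 + x 1 ≤ 1 := by
  unfold stdTriangle
  constructor
  · intro hx
    have hconv : Convex ℝ {y : Plane | 0 ≤ y 0 ∧ 0 ≤ y 1 ∧ y 0 + y 1 ≤ 1} := by
      intro a ha b hb s t hs ht hst
      obtain ⟨h1, h2, h3⟩ := ha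
      obtain ⟨h4, h5, h6⟩ := hb
      simp only [Set.mem_ofPred_eq, PiLp.add_apply, PiLp.smul_apply, smul_eq_mul]
      refine ⟨by positivity, by positivity, ?_⟩
      nlinarith
    refine convexHull_min ?_ hconv hx
    rintro y (rfl | rfl | rfl) <;> simp
  · rintro ⟨h0, h1, h2⟩
    have key : x = (1 - x 0 - x 1) • (0 : Plane) + x 0 • EuclideanSpace.single 0 (1 : ℝ)
        + x 1 • EuclideanSpace.single 1 (1 : ℝ) := by
      ext i; fin_cases i <;> simp
    rw [key]
    exact (convex_convexHull ℝ _).add_three_mem (subset_convexHull ℝ _ (by simp))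
      (subset_convexHull ℝ _ (by simp)) (subset_convexHull ℝ _ (by simp)) (by linarith) h0 h1
      (by ring)

theorem volume_plane (s : Set (ℝ × ℝ)) :
    volume {x : Plane | (x 0, x 1) ∈ s} = volume s := by
  have h1 := ((volume_preserving_finTwoArrow ℝ).comp
    (EuclideanSpace.volume_preserving_symm_measurableEquiv_toLp (Fin 2)))
  have h2 := MeasurePreserving.measure_preimage_equiv
    (f := (MeasurableEquiv.toLp 2 (Fin 2 → ℝ)).symm.trans MeasurableEquiv.finTwoArrow) h1 s
  exact h2

theorem volume_openTriangle :
    volume {x : Plane | 0 < x 0 ∧ 0 < x 1 ∧ x 0 + x 1 < 1} = ENNReal.ofReal (1 / 2) := by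
  have h : {x : Plane | 0 < x 0 ∧ 0 < x 1 ∧ x 0 + x 1 < 1} =
      {x : Plane | (x 0, x 1) ∈ regionBetween (fun _ => (0 : ℝ)) (fun a => 1 - a) (Set.Ioc 0 1)} := by
    ext x
    simp only [regionBetween, Set.mem_ofPred_eq, Set.mem_Ioc, Set.mem_Ioo]
    constructor
    · rintro ⟨a, b, c⟩; exact ⟨⟨a, by linarith⟩, b, by linarith⟩
    · rintro ⟨⟨a, _⟩, b, c⟩; exact ⟨a, b, by linarith⟩
  rw [h, volume_plane, Measure.volume_eq_prod, volume_regionBetween_eq_integral]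
  · rw [← intervalIntegral.integral_of_le zero_le_one]
    congr 1
    simp only [Pi.sub_apply, sub_zero]
    rw [intervalIntegral.integral_sub (by simp) (by simp), integral_id]
    norm_num
  · exact integrableOn_const (by simp)
  · exact (Continuous.integrableOn_Icc (by fun_prop)).mono_set Set.Ioc_subset_Icc_self
  · exact measurableSet_Ioc
  · intro x hx; linarith [hx.2]

theorem exists_add_smul_mem {K : Set Plane} {x : Plane} (hx : x ∈ interior K) (v : Plane) :
    ∃ ε > (0 : ℝ), x + ε • v ∈ K := by
  rw [mem_interior_iff_mem_nhds] at hx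
  have hcont : Tendsto (fun ε : ℝ => x + ε • v) (𝓝[>] 0) (𝓝 x) := by
    have : Tendsto (fun ε : ℝ => x + ε • v) (𝓝 0) (𝓝 (x + (0 : ℝ) • v)) :=
      Continuous.tendsto (by fun_prop) 0
    simpa using this.mono_left nhdsWithin_le_nhds
  obtain ⟨ε, h1, h2⟩ := ((hcont.eventually hx).and self_mem_nhdsWithin).exists
  exact ⟨ε, h2, h1⟩

theorem volume_stdTriangle : volume stdTriangle = ENNReal.ofReal (1 / 2) := by
  refine le_antisymm ?_ ?_
  · have hc : Convex ℝ stdTriangle := convex_convexHull ℝ _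
    have hint : interior stdTriangle ⊆ {x : Plane | 0 < x 0 ∧ 0 < x 1 ∧ x 0 + x 1 < 1} := by
      intro x hx
      refine ⟨?_, ?_, ?_⟩
      · obtain ⟨ε, hε, h⟩ := exists_add_smul_mem hx (!₂[-1, 0])
        rw [mem_stdTriangle] at h; simp at h; linarith
      · obtain ⟨ε, hε, h⟩ := exists_add_smul_mem hx (!₂[0, -1])
        rw [mem_stdTriangle] at h; simp at h; linarith
      · obtain ⟨ε, hε, h⟩ := exists_add_smul_mem hx (!₂[1, 0])
        rw [mem_stdTriangle] at h; simp at h; linarith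
    calc volume stdTriangle ≤ volume (interior stdTriangle ∪ frontier stdTriangle) := by
          rw [← closure_eq_interior_union_frontier]; exact measure_mono subset_closure
      _ ≤ volume (interior stdTriangle) + volume (frontier stdTriangle) := measure_union_le _ _
      _ = volume (interior stdTriangle) := by rw [hc.addHaar_frontier volume, add_zero]
      _ ≤ _ := (measure_mono hint).trans volume_openTriangle.le
  · rw [← volume_openTriangle]
    refine measure_mono fun x hx => mem_stdTriangle.2 ⟨hx.1.le, hx.2.1.le, hx.2.2.le⟩

/-- The linear endomorphism of the plane sending the standard basis to `u, v`. -/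
def linOfColumns (u v : Plane) : Plane →ₗ[ℝ] Plane :=
  Matrix.toLpLin 2 2 !![u 0, v 0; u 1, v 1]

theorem linOfColumns_apply (u v x : Plane) : linOfColumns u v x = x 0 • u + x 1 • v := by
  ext i
  fin_cases i <;> simp [linOfColumns, Matrix.toLpLin_apply,
    dotProduct, Fin.sum_univ_two, mul_comm]

theorem det_linOfColumns (u v : Plane) :
    LinearMap.det (linOfColumns u v) = u 0 * v 1 - v 0 * u 1 := by
  rw [linOfColumns, LinearMap.det_toLpLin, Matrix.det_fin_two_of]

/-- A convex set containing three points contains the volume of their triangle, inside any set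
containing the open triangle. -/
theorem Convex.volume_ge_triangle {L S : Set Plane} (hL : Convex ℝ L) {p q r : Plane}
    (hp : p ∈ L) (hq : q ∈ L) (hr : r ∈ L)
    (hS : ∀ s t : ℝ, 0 < s → 0 < t → s + t < 1 → p + s • (q - p) + t • (r - p) ∈ S)
    {d : ℝ} (hd : d ≤ (q 0 - p 0) * (r 1 - p 1) - (r 0 - p 0) * (q 1 - p 1)) :
    ENNReal.ofReal (d / 2) ≤ volume (L ∩ S) := by
  set A := linOfColumns (q - p) (r - p) with hA
  have hdet : d ≤ |LinearMap.det A| := by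
    rw [hA, det_linOfColumns]; exact hd.trans (le_abs_self _)
  calc ENNReal.ofReal (d / 2) ≤ ENNReal.ofReal (|LinearMap.det A| * (1 / 2)) := by
        apply ENNReal.ofReal_le_ofReal; linarith
    _ = ENNReal.ofReal |LinearMap.det A| * ENNReal.ofReal (1 / 2) :=
        ENNReal.ofReal_mul (abs_nonneg _)
    _ = volume ((fun y => p + y) '' (A '' {x : Plane | 0 < x 0 ∧ 0 < x 1 ∧ x 0 + x 1 < 1})) := by
        rw [← volume_openTriangle, ← Measure.addHaar_image_linearMap, Set.image_add_left,
          measure_preimage_add]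
    _ ≤ volume (L ∩ S) := by
        apply measure_mono
        rintro _ ⟨_, ⟨x, ⟨h0, h1, h2⟩, rfl⟩, rfl⟩
        simp only [hA, linOfColumns_apply, ← add_assoc]
        refine ⟨?_, hS _ _ h0 h1 h2⟩
        have := hL.add_three_mem hp hq hr (a := 1 - x 0 - x 1) (by linarith) h0.le h1.le (by ring)
        convert this using 1
        module

theorem polarSet_image_linearMap (L : Plane →ₗ[ℝ] Plane) (S : Set Plane) :
    polarSet (L '' S) = LinearMap.adjoint L ⁻¹' polarSet S := by
  ext y
  simp [polarSet, LinearMap.adjoint_inner_right]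

theorem det_adjoint_plane (L : Plane →ₗ[ℝ] Plane) :
    LinearMap.det (LinearMap.adjoint L) = LinearMap.det L := by
  obtain ⟨M, rfl⟩ := (Matrix.toEuclideanLin (𝕜 := ℝ) (m := Fin 2) (n := Fin 2)).surjective L
  rw [← Matrix.toEuclideanLin_conjTranspose_eq_adjoint, Matrix.toEuclideanLin,
    LinearMap.det_toLpLin, LinearMap.det_toLpLin, Matrix.det_conjTranspose, star_trivial]

theorem affineEquiv_apply_eq (T : Plane ≃ᵃ[ℝ] Plane) (x : Plane) : T x = T 0 + T.linear x := by
  have := T.map_vadd 0 x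
  simpa [add_comm] using this

theorem volume_image_affineEquiv (T : Plane ≃ᵃ[ℝ] Plane) (S : Set Plane) :
    volume (T '' S) = ENNReal.ofReal |LinearMap.det (T.linear : Plane →ₗ[ℝ] Plane)| * volume S := by
  have : T '' S = (fun y => T 0 + y) '' ((T.linear : Plane →ₗ[ℝ] Plane) '' S) := by
    rw [Set.image_image]
    exact Set.image_congr fun x _ => affineEquiv_apply_eq T x
  rw [this, ← Measure.addHaar_image_linearMap, Set.image_add_left, measure_preimage_add]

theorem volumeProduct_image_le (T : Plane ≃ᵃ[ℝ] Plane) (K : Set Plane) :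
    volumeProduct (T '' K) ≤ volumeProduct K := by
  unfold volumeProduct
  set L : Plane →ₗ[ℝ] Plane := (T.linear : Plane →ₗ[ℝ] Plane) with hL
  have hdet : LinearMap.det L ≠ 0 := (LinearEquiv.isUnit_det' T.linear).ne_zero
  have hint (z : interior K) : T z ∈ interior (T '' K) := by
    have := (AffineEquiv.toContinuousAffineEquiv T).toHomeomorph.image_interior K
    have h2 : T z ∈ T '' interior K := ⟨z, z.2, rfl⟩
    exact this ▸ h2
  have hpol (z : interior K) :
      volume (polarSet ((fun x => x - T z) '' (T '' K))) =
        ENNReal.ofReal |(LinearMap.det L)⁻¹| * volume (polarSet ((fun x => x - (z : Plane)) '' K)) := by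
    have : (fun x => x - T z) '' (T '' K) = L '' ((fun x => x - (z : Plane)) '' K) := by
      rw [Set.image_image, Set.image_image]
      refine Set.image_congr fun x _ => ?_
      rw [affineEquiv_apply_eq T x, affineEquiv_apply_eq T z, hL, map_sub]
      simp
    rw [this, polarSet_image_linearMap, Measure.addHaar_preimage_linearMap, det_adjoint_plane]
    rwa [det_adjoint_plane]
  have hc : ENNReal.ofReal |LinearMap.det L| * ENNReal.ofReal |(LinearMap.det L)⁻¹| = 1 := by
    rw [← ENNReal.ofReal_mul (abs_nonneg _), ← abs_mul, mul_inv_cancel₀ hdet]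
    simp
  rw [volume_image_affineEquiv]
  calc _ ≤ ENNReal.ofReal |LinearMap.det L| * volume K *
        ⨅ z : interior K, ENNReal.ofReal |(LinearMap.det L)⁻¹| *
          volume (polarSet ((fun x => x - (z : Plane)) '' K)) := by
        gcongr
        refine le_iInf fun z => ?_
        exact (iInf_le _ ⟨T z, hint z⟩).trans (hpol z).le
    _ = ENNReal.ofReal |LinearMap.det L| * volume K * (ENNReal.ofReal |(LinearMap.det L)⁻¹| *
        ⨅ z : interior K, volume (polarSet ((fun x => x - (z : Plane)) '' K))) := by
        rw [ENNReal.mul_iInf_of_ne (by simpa using hdet) ENNReal.ofReal_ne_top]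
    _ = _ := by
        rw [mul_mul_mul_comm, hc, one_mul]

theorem volumeProduct_image (T : Plane ≃ᵃ[ℝ] Plane) (K : Set Plane) :
    volumeProduct (T '' K) = volumeProduct K := by
  refine le_antisymm (volumeProduct_image_le T K) ?_
  have := volumeProduct_image_le T.symm (T '' K)
  rwa [← Set.image_comp, show (T.symm ∘ T : Plane → Plane) = id from funext fun x => by simp,
    Set.image_id] at this

theorem sum_volume_inter_le {ι : Type*} [Fintype ι] (L : Set Plane) {S : ι → Set Plane}
    (hS : ∀ i, MeasurableSet (S i)) (hd : Pairwise (Function.onFun Disjoint S)) :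
    ∑ i, volume (L ∩ S i) ≤ volume L := by
  have := sum_measure_le_measure_univ (μ := volume.restrict L) (s := Finset.univ) (t := S)
    (fun i _ => (hS i).nullMeasurableSet) (fun i _ j _ h => (hd h).aedisjoint)
  simpa [Measure.restrict_apply (hS _), Set.inter_comm] using this

theorem Convex.volume_ge_hexagon {L : Set Plane} (hL : Convex ℝ L) (h0 : (0 : Plane) ∈ L)
    {α β γ δ ε ζ : ℝ} (hα : 0 < α) (hβ : 0 < β) (hγ : 0 < γ) (hδ : 0 < δ) (hε : 0 < ε) (hζ : 0 < ζ)
    (h1 : !₂[α, 0] ∈ L) (h2 : !₂[β, β] ∈ L) (h3 : !₂[0, γ] ∈ L)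
    (h4 : !₂[-δ, 0] ∈ L) (h5 : !₂[-ε, -ε] ∈ L) (h6 : !₂[0, -ζ] ∈ L) :
    ENNReal.ofReal ((α * β + β * γ + γ * δ + δ * ε + ε * ζ + ζ * α) / 2) ≤ volume L := by
  let S : Fin 6 → Set Plane :=
    ![{x | 0 < x 1 ∧ x 1 < x 0}, {x | 0 < x 0 ∧ x 0 < x 1}, {x | x 0 < 0 ∧ 0 < x 1},
      {x | x 1 < 0 ∧ x 0 < x 1}, {x | x 0 < 0 ∧ x 1 < x 0}, {x | 0 < x 0 ∧ x 1 < 0}]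
  have hm : ∀ i, MeasurableSet (S i) := by
    have c0 : Continuous fun x : Plane => x 0 := by fun_prop
    have c1 : Continuous fun x : Plane => x 1 := by fun_prop
    intro i
    apply IsOpen.measurableSet
    fin_cases i
    · exact (isOpen_lt continuous_const c1).inter (isOpen_lt c1 c0)
    · exact (isOpen_lt continuous_const c0).inter (isOpen_lt c0 c1)
    · exact (isOpen_lt c0 continuous_const).inter (isOpen_lt continuous_const c1)
    · exact (isOpen_lt c1 continuous_const).inter (isOpen_lt c0 c1)
    · exact (isOpen_lt c0 continuous_const).inter (isOpen_lt c1 c0)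
    · exact (isOpen_lt continuous_const c0).inter (isOpen_lt c1 continuous_const)
  have hd : Pairwise (Function.onFun Disjoint S) := by
    intro i j hij
    rw [Function.onFun, Set.disjoint_left]
    intro x hx hy
    fin_cases i <;> fin_cases j <;> first | exact hij rfl | skip
    all_goals
      obtain ⟨a, b⟩ := hx
      obtain ⟨c, d⟩ := hy
      linarith
  refine le_trans ?_ (sum_volume_inter_le L hm hd)
  rw [Fin.sum_univ_six]
  have e1 : ENNReal.ofReal (α * β / 2) ≤ volume (L ∩ S 0) :=
    hL.volume_ge_triangle h0 h1 h2 (fun s t hs ht _ => by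
      have := mul_pos hs hα; have := mul_pos ht hβ
      constructor <;> simp <;> linarith) (by simp)
  have e2 : ENNReal.ofReal (β * γ / 2) ≤ volume (L ∩ S 1) :=
    hL.volume_ge_triangle h0 h2 h3 (fun s t hs ht _ => by
      have := mul_pos hs hβ; have := mul_pos ht hγ
      constructor <;> simp <;> linarith) (by simp)
  have e3 : ENNReal.ofReal (γ * δ / 2) ≤ volume (L ∩ S 2) :=
    hL.volume_ge_triangle h0 h3 h4 (fun s t hs ht _ => by
      have := mul_pos hs hγ; have := mul_pos ht hδ
      constructor <;> simp <;> linarith) (by simp; linarith)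
  have e4 : ENNReal.ofReal (δ * ε / 2) ≤ volume (L ∩ S 3) :=
    hL.volume_ge_triangle h0 h4 h5 (fun s t hs ht _ => by
      have := mul_pos hs hδ; have := mul_pos ht hε
      constructor <;> simp <;> linarith) (by simp)
  have e5 : ENNReal.ofReal (ε * ζ / 2) ≤ volume (L ∩ S 4) :=
    hL.volume_ge_triangle h0 h5 h6 (fun s t hs ht _ => by
      have := mul_pos hs hε; have := mul_pos ht hζ
      constructor <;> simp <;> linarith) (by simp)
  have e6 : ENNReal.ofReal (ζ * α / 2) ≤ volume (L ∩ S 5) :=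
    hL.volume_ge_triangle h0 h6 h1 (fun s t hs ht _ => by
      have := mul_pos hs hζ; have := mul_pos ht hα
      constructor <;> simp <;> linarith) (by simp; linarith)
  refine le_trans (le_of_eq ?_)
    (add_le_add (add_le_add (add_le_add (add_le_add (add_le_add e1 e2) e3) e4) e5) e6)
  rw [← ENNReal.ofReal_add, ← ENNReal.ofReal_add, ← ENNReal.ofReal_add, ← ENNReal.ofReal_add,
    ← ENNReal.ofReal_add]
  · congr 1; ring
  all_goals positivity

/-- Cubic form of the arithmetic-geometric mean inequality. -/
theorem amgm_three {x y z : ℝ} (hx : 0 < x) (hy : 0 < y) (hz : 0 < z) :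
    27 * (x * y * z) ≤ (x + y + z) ^ 3 := by
  have h1 : 0 ≤ (x + y + z) * ((x - y) ^ 2 + (y - z) ^ 2 + (x - z) ^ 2) := by positivity
  have h2 : 0 ≤ x * (y - z) ^ 2 := by positivity
  have h3 : 0 ≤ y * (x - z) ^ 2 := by positivity
  have h4 : 0 ≤ z * (x - y) ^ 2 := by positivity
  linarith [h1, h2, h3, h4]

theorem product_stability {U V W : ℝ} (hU : U < 2) (hV : V < 2) (hW : W < 2)
    (h : U + V + W = 4) :
    U * V * W ≤ 64 / 27 - 1 / 3 * ((U - 4 / 3) ^ 2 + (V - 4 / 3) ^ 2 + (W - 4 / 3) ^ 2) := by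
  obtain ⟨x, rfl⟩ : ∃ x, U = 4 / 3 + x := ⟨U - 4 / 3, by ring⟩
  obtain ⟨y, rfl⟩ : ∃ y, V = 4 / 3 + y := ⟨V - 4 / 3, by ring⟩
  obtain rfl : W = 4 / 3 + (-x - y) := by linarith
  have key : x * y * (-x - y) ≤ 1 / 3 * (x ^ 2 + y ^ 2 + (-x - y) ^ 2) := by
    have aux {p q r : ℝ} (hp : 0 ≤ p) (hp' : p < 2 / 3) :
        p * q * r ≤ 1 / 3 * (p ^ 2 + q ^ 2 + r ^ 2) := by
      have h1 : q * r ≤ (q ^ 2 + r ^ 2) / 2 := by linarith [sq_nonneg (q - r)]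
      have h2 : p * (q * r) ≤ p * ((q ^ 2 + r ^ 2) / 2) := by gcongr
      have h3 : p * ((q ^ 2 + r ^ 2) / 2) ≤ 2 / 3 * ((q ^ 2 + r ^ 2) / 2) := by gcongr
      linarith [sq_nonneg p]
    rcases le_or_gt 0 x with hx | hx
    · exact aux hx (by linarith)
    rcases le_or_gt 0 y with hy | hy
    · have := aux (q := x) (r := -x - y) hy (by linarith)
      linarith
    · have := aux (p := -x - y) (q := x) (r := y) (by linarith) (by linarith)
      linarith
  linarith [key]

theorem pow_three_mul_sum_ge {a b c U V W : ℝ} (ha : 0 < a) (hb : 0 < b) (hc : 0 < c)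
    (hU : 0 < U) (hV : 0 < V) (hW : 0 < W) :
    (36 : ℝ) ^ 3 ≤ ((a + b + c) * (4 / U / a + 4 / V / b + 4 / W / c)) ^ 3 * (U * V * W) := by
  have h1 := amgm_three ha hb hc
  have h2 : 27 * (4 / U / a * (4 / V / b) * (4 / W / c)) ≤
      (4 / U / a + 4 / V / b + 4 / W / c) ^ 3 :=
    amgm_three (by positivity) (by positivity) (by positivity)
  have e : (27 * (a * b * c)) * (27 * (4 / U / a * (4 / V / b) * (4 / W / c))) * (U * V * W)
      = 36 ^ 3 := by
    field_simp; norm_num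
  have h3 := mul_le_mul h1 h2 (by positivity) (by positivity)
  have h4 := mul_le_mul_of_nonneg_right h3 (by positivity : 0 ≤ U * V * W)
  rw [e] at h4
  rwa [mul_pow]

theorem stability_of_pow_three {S P Q : ℝ} (hS : 0 < S) (hQ : 0 ≤ Q)
    (hPQ : P ≤ 64 / 27 - 1 / 3 * Q) (hP : 0 < P) (h : (36 : ℝ) ^ 3 ≤ S ^ 3 * P) :
    27 * (1 + 3 / 64 * Q) ≤ S := by
  by_contra! hlt
  obtain ⟨τ, rfl⟩ : ∃ τ, Q = 64 / 3 * τ := ⟨3 / 64 * Q, by ring⟩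
  have hτ : 0 ≤ τ := by linarith
  have hlt' : S < 27 * (1 + τ) := by linarith
  have h5 : S ^ 3 < (27 * (1 + τ)) ^ 3 := pow_lt_pow_left₀ hlt' hS.le (by norm_num)
  have h6 : S ^ 3 * P < (27 * (1 + τ)) ^ 3 * P := mul_lt_mul_of_pos_right h5 hP
  have h7 : (27 * (1 + τ)) ^ 3 * P ≤ (27 * (1 + τ)) ^ 3 * (64 / 27 - 1 / 3 * (64 / 3 * τ)) :=
    mul_le_mul_of_nonneg_left hPQ (by positivity)
  have h8 : (27 * (1 + τ)) ^ 3 * (64 / 27 - 1 / 3 * (64 / 3 * τ)) =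
      36 ^ 3 * (1 - 6 * τ ^ 2 - 8 * τ ^ 3 - 3 * τ ^ 4) := by ring
  have i2 : 0 ≤ τ ^ 2 := by positivity
  have i3 : 0 ≤ τ ^ 3 := by positivity
  have i4 : 0 ≤ τ ^ 4 := by positivity
  linarith

theorem four_div_add_le {x y : ℝ} (hx : 0 < x) (hy : 0 < y) : 4 / (x + y) ≤ 1 / x + 1 / y := by
  rw [div_add_div _ _ hx.ne' hy.ne', div_le_div_iff₀ (by positivity) (by positivity)]
  nlinarith [sq_nonneg (x - y)]

/-- The numerical core of the volume product bound, with a stability term. -/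
theorem hexagon_numeric {a b c u v w : ℝ} (ha : 0 < a) (hb : 0 < b) (hc : 0 < c)
    (hu : 0 < u) (hv : 0 < v) (hw : 0 < w) (h : u + v + w = 2) :
    27 * (1 + 3 / 64 * ((u - 2 / 3) ^ 2 + (v - 2 / 3) ^ 2 + (w - 2 / 3) ^ 2)) ≤
      (a + b + c) * ((1 / v + 1 / w) / a + (1 / w + 1 / u) / b + (1 / u + 1 / v) / c) := by
  have hTle : 4 / (v + w) / a + 4 / (w + u) / b + 4 / (u + v) / c ≤
      (1 / v + 1 / w) / a + (1 / w + 1 / u) / b + (1 / u + 1 / v) / c :=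
    add_le_add (add_le_add (div_le_div_of_nonneg_right (four_div_add_le hv hw) ha.le)
      (div_le_div_of_nonneg_right (four_div_add_le hw hu) hb.le))
      (div_le_div_of_nonneg_right (four_div_add_le hu hv) hc.le)
  refine le_trans ?_ (mul_le_mul_of_nonneg_left hTle (by positivity))
  have h4 := product_stability (U := v + w) (V := w + u) (W := u + v) (by linarith) (by linarith)
    (by linarith) (by linarith)
  refine stability_of_pow_three (by positivity) (by positivity) (h4.trans_eq ?_) (by positivity)
    (pow_three_mul_sum_ge ha hb hc (by positivity) (by positivity) (by positivity))
  rw [show v + w = 2 - u by linarith, show w + u = 2 - v by linarith,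
      show u + v = 2 - w by linarith]
  ring

theorem hexagon_numeric_eq {a b c : ℝ} (ha : 0 < a) (hb : 0 < b) (hc : 0 < c)
    (h : (a + b + c) * (1 / a + 1 / b + 1 / c) ≤ 9) : a = b ∧ b = c := by
  have e : (a + b + c) * (1 / a + 1 / b + 1 / c) - 9 =
      (c * (a - b) ^ 2 + a * (b - c) ^ 2 + b * (a - c) ^ 2) / (a * b * c) := by
    field_simp; ring
  have h1 : (c * (a - b) ^ 2 + a * (b - c) ^ 2 + b * (a - c) ^ 2) / (a * b * c) ≤ 0 := by linarith
  have hp : 0 < a * b * c := by positivity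
  have h2 : c * (a - b) ^ 2 + a * (b - c) ^ 2 + b * (a - c) ^ 2 ≤ 0 := by
    by_contra! h3
    exact absurd h1 (not_le.2 (div_pos h3 hp))
  have i1 : 0 ≤ c * (a - b) ^ 2 := by positivity
  have i2 : 0 ≤ a * (b - c) ^ 2 := by positivity
  have i3 : 0 ≤ b * (a - c) ^ 2 := by positivity
  have j1 : c * (a - b) ^ 2 = 0 := by linarith
  have j2 : a * (b - c) ^ 2 = 0 := by linarith
  have k1 : a - b = 0 := by simpa [hc.ne'] using j1
  have k2 : b - c = 0 := by simpa [ha.ne'] using j2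
  exact ⟨by linarith, by linarith⟩

theorem mem_polarSet_sub {K : Set Plane} {z y : Plane} :
    y ∈ polarSet ((fun x => x - z) '' K) ↔
      ∀ x ∈ K, (x 0 - z 0) * y 0 + (x 1 - z 1) * y 1 ≤ 1 := by
  simp [polarSet, plane_inner]

theorem convex_polarSet (S : Set Plane) : Convex ℝ (polarSet S) := by
  intro a ha b hb s t hs ht hst x hx
  have h1 := mul_le_mul_of_nonneg_left (ha x hx) hs
  have h2 := mul_le_mul_of_nonneg_left (hb x hx) ht
  rw [inner_add_right, inner_smul_right, inner_smul_right]
  linarith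

theorem zero_mem_polarSet (S : Set Plane) : (0 : Plane) ∈ polarSet S := by
  intro x _; simp

/-- `K` contains the standard triangle and no triangle in `K` has larger area. -/
structure StdTriangleIsMaximal (K : Set Plane) : Prop where
  subset : stdTriangle ⊆ K
  det_le : ∀ p ∈ K, ∀ q ∈ K, ∀ r ∈ K,
    (q 0 - p 0) * (r 1 - p 1) - (r 0 - p 0) * (q 1 - p 1) ≤ 1

namespace StdTriangleIsMaximal

variable {K : Set Plane}

theorem zero_mem (h : StdTriangleIsMaximal K) : (0 : Plane) ∈ K :=
  h.subset (mem_stdTriangle.2 (by simp))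

theorem e_zero_mem (h : StdTriangleIsMaximal K) : !₂[(1 : ℝ), 0] ∈ K :=
  h.subset (mem_stdTriangle.2 (by simp))

theorem e_one_mem (h : StdTriangleIsMaximal K) : !₂[(0 : ℝ), 1] ∈ K :=
  h.subset (mem_stdTriangle.2 (by simp))

theorem bounds (h : StdTriangleIsMaximal K) {x : Plane} (hx : x ∈ K) :
    x 0 ≤ 1 ∧ x 1 ≤ 1 ∧ 0 ≤ x 0 + x 1 := by
  have h1 := h.det_le _ h.zero_mem _ hx _ h.e_one_mem
  have h2 := h.det_le _ h.zero_mem _ h.e_zero_mem _ hx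
  have h3 := h.det_le _ h.e_zero_mem _ h.e_one_mem _ hx
  simp at h1 h2 h3
  refine ⟨by linarith, by linarith, by linarith⟩

/-- The heights of the three caps of `K` over the edges of a maximal triangle are controlled by
the area of `K`. -/
theorem exists_heights (h : StdTriangleIsMaximal K) (hK : IsConvexBody K) :
    ∃ h₁ h₂ h₃ : ℝ, (∀ x ∈ K, x 0 + x 1 - 1 ≤ h₁ ∧ -x 0 ≤ h₂ ∧ -x 1 ≤ h₃) ∧
      (1 + h₁ + h₂ + h₃) / 2 ≤ volume.real K := by
  have hfin : volume K ≠ ⊤ := hK.isCompact.measure_ne_top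
  have hfin' (S : Set Plane) : volume (K ∩ S) ≠ ⊤ :=
    measure_ne_top_of_subset Set.inter_subset_left hfin
  have c0 : Continuous fun x : Plane => x 0 := by fun_prop
  have c1 : Continuous fun x : Plane => x 1 := by fun_prop
  let S : Fin 4 → Set Plane := ![{x | 0 < x 0 ∧ 0 < x 1 ∧ x 0 + x 1 < 1}, {x | 1 < x 0 + x 1},
    {x | x 0 < 0 ∧ 0 ≤ x 0 + x 1 ∧ x 1 ≤ 1}, {x | x 1 < 0 ∧ 0 ≤ x 0 + x 1 ∧ x 0 ≤ 1}]
  have hm : ∀ i, MeasurableSet (S i) := by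
    intro i
    fin_cases i
    · exact ((isOpen_lt continuous_const c0).inter ((isOpen_lt continuous_const c1).inter
        (isOpen_lt (c0.add c1) continuous_const))).measurableSet
    · exact (isOpen_lt continuous_const (c0.add c1)).measurableSet
    · exact (isOpen_lt c0 continuous_const).measurableSet.inter
        ((isClosed_le continuous_const (c0.add c1)).inter
          (isClosed_le c1 continuous_const)).measurableSet
    · exact (isOpen_lt c1 continuous_const).measurableSet.inter
        ((isClosed_le continuous_const (c0.add c1)).inter
          (isClosed_le c0 continuous_const)).measurableSet
  have hd : Pairwise (Function.onFun Disjoint S) := by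
    intro i j hij
    rw [Function.onFun, Set.disjoint_left]
    intro x hx hy
    fin_cases i <;> fin_cases j <;> first | exact hij rfl | skip
    all_goals
      simp [S] at hx hy
      linarith
  have hsum : ∑ i, volume.real (K ∩ S i) ≤ volume.real K := by
    have := ENNReal.toReal_mono hfin (sum_volume_inter_le K hm hd)
    rwa [ENNReal.toReal_sum fun i _ => hfin' (S i)] at this
  have hconv := hK.convex
  rw [Fin.sum_univ_four] at hsum
  have t0 : (1 : ℝ) / 2 ≤ volume.real (K ∩ S 0) := by
    refine (ENNReal.ofReal_le_iff_le_toReal (hfin' _)).1 ?_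
    refine hconv.volume_ge_triangle h.zero_mem h.e_zero_mem h.e_one_mem (fun s t hs ht hst => ?_)
      (by simp)
    simp [S, hs, ht, hst]
  refine ⟨2 * volume.real (K ∩ S 1), 2 * volume.real (K ∩ S 2), 2 * volume.real (K ∩ S 3),
    fun x hx => ⟨?_, ?_, ?_⟩, by linarith⟩
  · rcases le_or_gt (x 0 + x 1) 1 with h1 | h1
    · have := measureReal_nonneg (μ := volume) (s := K ∩ S 1)
      linarith
    have : (x 0 + x 1 - 1) / 2 ≤ volume.real (K ∩ S 1) := by
      refine (ENNReal.ofReal_le_iff_le_toReal (hfin' _)).1 ?_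
      refine hconv.volume_ge_triangle h.e_zero_mem hx h.e_one_mem (fun s t hs ht hst => ?_)
        (by simp; linarith)
      simp [S]
      nlinarith
    linarith
  · rcases le_or_gt 0 (x 0) with h1 | h1
    · have := measureReal_nonneg (μ := volume) (s := K ∩ S 2)
      linarith
    have : (-x 0) / 2 ≤ volume.real (K ∩ S 2) := by
      refine (ENNReal.ofReal_le_iff_le_toReal (hfin' _)).1 ?_
      refine hconv.volume_ge_triangle h.zero_mem h.e_one_mem hx (fun s t hs ht hst => ?_)
        (by simp)
      obtain ⟨b0, b1, b2⟩ := h.bounds hx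
      simp [S]
      refine ⟨by nlinarith, by nlinarith, by nlinarith⟩
    linarith
  · rcases le_or_gt 0 (x 1) with h1 | h1
    · have := measureReal_nonneg (μ := volume) (s := K ∩ S 3)
      linarith
    have : (-x 1) / 2 ≤ volume.real (K ∩ S 3) := by
      refine (ENNReal.ofReal_le_iff_le_toReal (hfin' _)).1 ?_
      refine hconv.volume_ge_triangle h.zero_mem hx h.e_zero_mem (fun s t hs ht hst => ?_)
        (by simp)
      obtain ⟨b0, b1, b2⟩ := h.bounds hx
      simp [S]
      refine ⟨by nlinarith, by nlinarith, by nlinarith⟩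
    linarith

/-- The six vertices of a hexagon inscribed in the polar of `K` at an interior point. -/
theorem hexagon_mem_polarSet (h : StdTriangleIsMaximal K) {z : Plane} {a b c : ℝ}
    (ha : 0 < a) (hb : 0 < b) (hc : 0 < c)
    (hcap : ∀ x ∈ K, x 0 + x 1 - z 0 - z 1 ≤ a ∧ z 0 - x 0 ≤ b ∧ z 1 - x 1 ≤ c)
    (hu : 0 < z 0 + z 1) (hv : 0 < 1 - z 0) (hw : 0 < 1 - z 1) :
    let L := polarSet ((fun x => x - z) '' K)
    !₂[1 / (1 - z 0), 0] ∈ L ∧ !₂[1 / a, 1 / a] ∈ L ∧ !₂[0, 1 / (1 - z 1)] ∈ L ∧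
      !₂[-(1 / b), 0] ∈ L ∧ !₂[-(1 / (z 0 + z 1)), -(1 / (z 0 + z 1))] ∈ L ∧
      !₂[0, -(1 / c)] ∈ L := by
  intro L
  refine ⟨?_, ?_, ?_, ?_, ?_, ?_⟩ <;> rw [mem_polarSet_sub] <;> intro x hx <;>
    obtain ⟨b0, b1, b2⟩ := h.bounds hx <;> obtain ⟨c0, c1, c2⟩ := hcap x hx <;> simp
  · rw [← div_eq_mul_inv, div_le_one hv]; linarith
  · rw [← add_mul, ← div_eq_mul_inv, div_le_one ha]; linarith
  · rw [← div_eq_mul_inv, div_le_one hw]; linarith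
  · rw [← neg_mul, ← div_eq_mul_inv, div_le_one hb]; linarith
  · have : (z 0 - x 0 + (z 1 - x 1)) * (z 0 + z 1)⁻¹ ≤ 1 := by
      rw [← div_eq_mul_inv, div_le_one hu]; linarith
    linarith
  · rw [← neg_mul, ← div_eq_mul_inv, div_le_one hc]; linarith

theorem volume_mul_polar_ge (h : StdTriangleIsMaximal K) (hK : IsConvexBody K) {z : Plane}
    (hz : z ∈ interior K) :
    ENNReal.ofReal (27 / 4 * (1 + 3 / 64 * ((z 0 + z 1 - 2 / 3) ^ 2 + (1 - z 0 - 2 / 3) ^ 2 +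
      (1 - z 1 - 2 / 3) ^ 2))) ≤ volume K * volume (polarSet ((fun x => x - z) '' K)) := by
  obtain ⟨h₁, h₂, h₃, hcap, hvol⟩ := h.exists_heights hK
  obtain ⟨hv, hb⟩ : 0 < 1 - z 0 ∧ 0 < h₂ + z 0 := by
    obtain ⟨ε, hε, h1⟩ := exists_add_smul_mem hz !₂[1, 0]
    obtain ⟨δ, hδ, h2⟩ := exists_add_smul_mem hz !₂[-1, 0]
    have h3 := h.bounds h1
    have h4 := hcap _ h2
    simp at h3 h4
    exact ⟨by linarith, by linarith⟩
  obtain ⟨hw, hc⟩ : 0 < 1 - z 1 ∧ 0 < h₃ + z 1 := by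
    obtain ⟨ε, hε, h1⟩ := exists_add_smul_mem hz !₂[0, 1]
    obtain ⟨δ, hδ, h2⟩ := exists_add_smul_mem hz !₂[0, -1]
    have h3 := h.bounds h1
    have h4 := hcap _ h2
    simp at h3 h4
    exact ⟨by linarith, by linarith⟩
  obtain ⟨hu, ha⟩ : 0 < z 0 + z 1 ∧ 0 < h₁ + 1 - z 0 - z 1 := by
    obtain ⟨ε, hε, h1⟩ := exists_add_smul_mem hz !₂[-1, 0]
    obtain ⟨δ, hδ, h2⟩ := exists_add_smul_mem hz !₂[1, 0]
    have h3 := h.bounds h1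
    have h4 := hcap _ h2
    simp at h3 h4
    exact ⟨by linarith, by linarith⟩
  obtain ⟨m1, m2, m3, m4, m5, m6⟩ := h.hexagon_mem_polarSet ha hb hc
    (fun x hx => by
      obtain ⟨i1, i2, i3⟩ := hcap x hx
      exact ⟨by linarith, by linarith, by linarith⟩) hu hv hw
  have hD := (convex_polarSet _).volume_ge_hexagon (zero_mem_polarSet _) (by positivity)
    (by positivity) (by positivity) (by positivity) (by positivity) (by positivity) m1 m2 m3 m4 m5 m6
  have hV : ENNReal.ofReal ((1 + h₁ + h₂ + h₃) / 2) ≤ volume K :=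
    (ENNReal.ofReal_le_iff_le_toReal hK.isCompact.measure_ne_top).2 hvol
  refine le_trans ?_ (mul_le_mul' hV hD)
  rw [← ENNReal.ofReal_mul (by linarith)]
  apply ENNReal.ofReal_le_ofReal
  have := hexagon_numeric ha hb hc hu hv hw (by ring)
  set u := z 0 + z 1
  set v := 1 - z 0
  set w := 1 - z 1
  set a := h₁ + 1 - z 0 - z 1 with hadef
  have e : (1 + h₁ + h₂ + h₃) / 2 *
      ((1 / v * (1 / a) + 1 / a * (1 / w) + 1 / w * (1 / (h₂ + z 0)) + 1 / (h₂ + z 0) * (1 / u) +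
        1 / u * (1 / (h₃ + z 1)) + 1 / (h₃ + z 1) * (1 / v)) / 2) =
      (a + (h₂ + z 0) + (h₃ + z 1)) * ((1 / v + 1 / w) / a + (1 / w + 1 / u) / (h₂ + z 0) +
        (1 / u + 1 / v) / (h₃ + z 1)) / 4 := by
    have : a + (h₂ + z 0) + (h₃ + z 1) = 1 + h₁ + h₂ + h₃ := by rw [hadef]; ring
    rw [this]; ring
  rw [e]
  linarith

end StdTriangleIsMaximal

/-- The centroid of the standard triangle. -/
def stdCentroid : Plane := !₂[1 / 3, 1 / 3]

theorem stdCentroid_mem_interior {K : Set Plane} (h : stdTriangle ⊆ K) :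
    stdCentroid ∈ interior K := by
  have c0 : Continuous fun x : Plane => x 0 := by fun_prop
  have c1 : Continuous fun x : Plane => x 1 := by fun_prop
  rw [mem_interior]
  refine ⟨{x | 0 < x 0} ∩ ({x | 0 < x 1} ∩ {x | x 0 + x 1 < 1}), ?_,
    (isOpen_lt continuous_const c0).inter ((isOpen_lt continuous_const c1).inter
        (isOpen_lt (c0.add c1) continuous_const)), ?_⟩
  · rintro x ⟨h0, h1, h2⟩
    simp only [Set.mem_ofPred_eq] at h0 h1 h2
    exact h (mem_stdTriangle.2 ⟨h0.le, h1.le, h2.le⟩)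
  · simp [stdCentroid]; norm_num

theorem volume_polar_stdTriangle_le :
    volume (polarSet ((fun x => x - stdCentroid) '' stdTriangle)) ≤ ENNReal.ofReal (27 / 2) := by
  have hsub : polarSet ((fun x => x - stdCentroid) '' stdTriangle) ⊆
      (fun y => !₂[-3, 0] + y) '' (linOfColumns !₂[6, 3] !₂[3, -3] '' stdTriangle) := by
    intro y hy
    rw [mem_polarSet_sub] at hy
    have h0 := hy 0 (mem_stdTriangle.2 (by simp))
    have h1 := hy !₂[1, 0] (mem_stdTriangle.2 (by simp))
    have h2 := hy !₂[0, 1] (mem_stdTriangle.2 (by simp))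
    simp [stdCentroid] at h0 h1 h2
    refine ⟨_, ⟨!₂[(y 0 + y 1 + 3) / 9, (y 0 - 2 * y 1 + 3) / 9], ?_, rfl⟩, ?_⟩
    · rw [mem_stdTriangle]; simp
      exact ⟨by linarith, by linarith, by linarith⟩
    · rw [linOfColumns_apply]
      ext i; fin_cases i <;> simp <;> ring
  refine (measure_mono hsub).trans (le_of_eq ?_)
  rw [Set.image_add_left, measure_preimage_add, Measure.addHaar_image_linearMap,
    volume_stdTriangle, det_linOfColumns, ← ENNReal.ofReal_mul (abs_nonneg _)]
  congr 1
  simp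
  norm_num

/-- Polars at points near the centroid have almost as much area as the polar at the centroid. -/
theorem volume_polar_centroid_le {K : Set Plane} (h : stdTriangle ⊆ K) {z : Plane} {ε : ℝ}
    (hε : 0 < ε) (hε1 : ε < 1) (h0 : |z 0 - 1 / 3| ≤ ε / 3) (h1 : |z 1 - 1 / 3| ≤ ε / 3)
    (h2 : |z 0 + z 1 - 2 / 3| ≤ ε / 3) :
    ENNReal.ofReal ((1 - ε) ^ 2) * volume (polarSet ((fun x => x - stdCentroid) '' K)) ≤
      volume (polarSet ((fun x => x - z) '' K)) := by
  have hsub : (1 - ε) • polarSet ((fun x => x - stdCentroid) '' K) ⊆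
      polarSet ((fun x => x - z) '' K) := by
    rintro _ ⟨y, hy, rfl⟩
    rw [mem_polarSet_sub] at hy ⊢
    intro x hx
    rw [abs_le] at h0 h1 h2
    have hmem : !₂[1 / 3 + (1 / 3 - z 0) / ε, 1 / 3 + (1 / 3 - z 1) / ε] ∈ K := by
      apply h
      rw [mem_stdTriangle]
      have e0 : -(1 / 3) ≤ (1 / 3 - z 0) / ε := by rw [le_div_iff₀ hε]; linarith
      have e1 : -(1 / 3) ≤ (1 / 3 - z 1) / ε := by rw [le_div_iff₀ hε]; linarith
      have e2 : (1 / 3 - z 0) / ε + (1 / 3 - z 1) / ε ≤ 1 / 3 := by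
        rw [← add_div, div_le_iff₀ hε]; linarith
      refine ⟨?_, ?_, ?_⟩ <;> simp only [Matrix.cons_val_zero, Matrix.cons_val_one,
        Matrix.cons_val_fin_one] <;> linarith
    have a1 := hy x hx
    have a2 := hy _ hmem
    simp [stdCentroid] at a1 a2 ⊢
    have a3 : (1 / 3 - z 0) * y 0 + (1 / 3 - z 1) * y 1 ≤ ε := by
      have := mul_le_mul_of_nonneg_left a2 hε.le
      have e : ε * ((3⁻¹ - z 0) / ε * y 0 + (3⁻¹ - z 1) / ε * y 1) =
        (1 / 3 - z 0) * y 0 + (1 / 3 - z 1) * y 1 := by field_simp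
      linarith
    have a4 := mul_le_mul_of_nonneg_left (add_le_add a1 a3) (sub_pos.2 hε1).le
    nlinarith [sq_nonneg ε]
  refine le_trans (le_of_eq ?_) (measure_mono hsub)
  rw [Measure.addHaar_smul]
  simp [abs_of_nonneg (sq_nonneg (1 - ε))]

namespace StdTriangleIsMaximal

variable {K : Set Plane}

theorem volume_ne_zero (h : StdTriangleIsMaximal K) : volume K ≠ 0 := fun h0 => by
  have := measure_mono (μ := volume) h.subset
  rw [h0, volume_stdTriangle] at this
  simp at this

theorem le_volumeProduct (h : StdTriangleIsMaximal K) (hK : IsConvexBody K) :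
    ENNReal.ofReal (27 / 4) ≤ volumeProduct K := by
  have hV0 := h.volume_ne_zero
  unfold volumeProduct
  rw [ENNReal.mul_iInf_of_ne hV0 hK.isCompact.measure_ne_top]
  refine le_iInf fun z => le_trans ?_ (h.volume_mul_polar_ge hK z.2)
  apply ENNReal.ofReal_le_ofReal
  nlinarith [sq_nonneg ((z : Plane) 0 + (z : Plane) 1 - 2 / 3), sq_nonneg (1 - (z : Plane) 0 - 2 / 3),
    sq_nonneg (1 - (z : Plane) 1 - 2 / 3)]

/-- If the volume product is minimal then the minimum is attained at the centroid of the maximal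
triangle. -/
theorem volume_mul_polar_centroid_le (h : StdTriangleIsMaximal K) (hK : IsConvexBody K)
    (hP : volumeProduct K = ENNReal.ofReal (27 / 4)) :
    volume K * volume (polarSet ((fun x => x - stdCentroid) '' K)) ≤ ENNReal.ofReal (27 / 4) := by
  set X := volume K * volume (polarSet ((fun x => x - stdCentroid) '' K)) with hX
  have hV0 := h.volume_ne_zero
  unfold volumeProduct at hP
  rw [ENNReal.mul_iInf_of_ne hV0 hK.isCompact.measure_ne_top] at hP
  have key (ε : ℝ) (hε : 0 < ε) (hε1 : ε < 1) :
      ENNReal.ofReal ((1 - ε) ^ 2) * X ≤ ENNReal.ofReal (27 / 4 * (1 + ε ^ 2 / 192)) := by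
    have hlt : ⨅ z : interior K, volume K * volume (polarSet ((fun x => x - (z : Plane)) '' K)) <
        ENNReal.ofReal (27 / 4 * (1 + ε ^ 2 / 192)) := by
      rw [hP]
      apply (ENNReal.ofReal_lt_ofReal_iff (by positivity)).2
      have : 0 < ε ^ 2 := by positivity
      linarith
    obtain ⟨z, hz⟩ := iInf_lt_iff.1 hlt
    have h1 := (h.volume_mul_polar_ge hK z.2).trans_lt hz
    rw [ENNReal.ofReal_lt_ofReal_iff (by positivity)] at h1
    set p := (z : Plane) 0
    set q := (z : Plane) 1
    have s1 := sq_nonneg (p + q - 2 / 3)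
    have s2 := sq_nonneg (1 - p - 2 / 3)
    have s3 := sq_nonneg (1 - q - 2 / 3)
    have hz' := volume_polar_centroid_le h.subset (z := z) hε hε1
      (abs_le_of_sq_le_sq (by linarith) (by positivity))
      (abs_le_of_sq_le_sq (by linarith) (by positivity))
      (abs_le_of_sq_le_sq (by linarith) (by positivity))
    calc ENNReal.ofReal ((1 - ε) ^ 2) * X = volume K * (ENNReal.ofReal ((1 - ε) ^ 2) *
          volume (polarSet ((fun x => x - stdCentroid) '' K))) := by rw [hX]; ring
      _ ≤ _ := (mul_le_mul' le_rfl hz').trans hz.le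
  have hXtop : X ≠ ⊤ := fun hX' => by
    have := key (1 / 2) (by norm_num) (by norm_num)
    rw [hX', ENNReal.mul_top (by norm_num)] at this
    simp at this
  have lim1 : Tendsto (fun ε : ℝ => (1 - ε) ^ 2 * X.toReal) (𝓝[>] 0) (𝓝 X.toReal) := by
    have : Tendsto (fun ε : ℝ => (1 - ε) ^ 2 * X.toReal) (𝓝 0) (𝓝 ((1 - 0) ^ 2 * X.toReal)) :=
      Continuous.tendsto (by fun_prop) 0
    simpa using this.mono_left nhdsWithin_le_nhds
  have lim2 : Tendsto (fun ε : ℝ => 27 / 4 * (1 + ε ^ 2 / 192)) (𝓝[>] 0) (𝓝 (27 / 4)) := by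
    have : Tendsto (fun ε : ℝ => 27 / 4 * (1 + ε ^ 2 / 192)) (𝓝 0) (𝓝 (27 / 4 * (1 + 0 ^ 2 / 192))) :=
      Continuous.tendsto (by fun_prop) 0
    simpa using this.mono_left nhdsWithin_le_nhds
  rw [← ENNReal.ofReal_toReal hXtop]
  apply ENNReal.ofReal_le_ofReal
  refine le_of_tendsto_of_tendsto lim1 lim2 ?_
  filter_upwards [Ioo_mem_nhdsGT (zero_lt_one' ℝ)] with ε hε
  have := key ε hε.1 hε.2
  rw [← ENNReal.ofReal_toReal hXtop, ← ENNReal.ofReal_mul (by positivity)] at this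
  exact (ENNReal.ofReal_le_ofReal_iff (by positivity)).1 this

end StdTriangleIsMaximal

theorem Convex.volume_inter_pos {L S : Set Plane} (hL : Convex ℝ L) (hS : Convex ℝ S)
    (hSo : IsOpen S) {y p q : Plane} (hy : y ∈ L) (hyS : y ∈ S) (hp : p ∈ L) (hq : q ∈ L)
    (hdet : 0 < (p 0 - y 0) * (q 1 - y 1) - (q 0 - y 0) * (p 1 - y 1)) :
    0 < volume (L ∩ S) := by
  have hev (v : Plane) : ∀ᶠ ε : ℝ in 𝓝[>] 0, y + ε • (v - y) ∈ S := by
    have : Tendsto (fun ε : ℝ => y + ε • (v - y)) (𝓝 0) (𝓝 (y + (0 : ℝ) • (v - y))) :=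
      Continuous.tendsto (by fun_prop) 0
    have h2 := this.mono_left (nhdsWithin_le_nhds (s := Set.Ioi 0))
    exact h2.eventually (by simpa using hSo.mem_nhds hyS)
  obtain ⟨ε, hpS, hqS, hε⟩ :=
    ((hev p).and ((hev q).and (Ioo_mem_nhdsGT (zero_lt_one' ℝ)))).exists
  have hLm (v : Plane) (hv : v ∈ L) : y + ε • (v - y) ∈ L :=
    hL.add_smul_sub_mem hy hv ⟨hε.1.le, hε.2.le⟩
  have := (hL.inter hS).volume_ge_triangle (S := Set.univ) ⟨hy, hyS⟩ ⟨hLm p hp, hpS⟩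
    ⟨hLm q hq, hqS⟩ (fun _ _ _ _ _ => Set.mem_univ _)
    (d := ε ^ 2 * ((p 0 - y 0) * (q 1 - y 1) - (q 0 - y 0) * (p 1 - y 1)))
    (le_of_eq (by simp; ring))
  rw [Set.inter_univ] at this
  refine lt_of_lt_of_le (ENNReal.ofReal_pos.2 ?_) this
  have := hε.1
  positivity

/-- Separation of a point from a convex body by a polar functional. -/
theorem exists_mem_polarSet_of_notMem {K : Set Plane} (hK : IsConvexBody K) {g x : Plane}
    (hg : g ∈ K) (hx : x ∉ K) :
    ∃ y ∈ polarSet ((fun x => x - g) '' K), 1 < (x 0 - g 0) * y 0 + (x 1 - g 1) * y 1 := by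
  obtain ⟨f, u, hu, hux⟩ := geometric_hahn_banach_closed_point hK.convex hK.isCompact.isClosed hx
  set w := (InnerProductSpace.toDual ℝ Plane).symm f with hw
  have hf (v : Plane) : f v = v 0 * w 0 + v 1 * w 1 := by
    rw [← plane_inner, real_inner_comm, hw, InnerProductSpace.toDual_symm_apply]
  have hpos : 0 < u - f g := sub_pos.2 (hu g hg)
  refine ⟨(u - f g)⁻¹ • w, ?_, ?_⟩
  · rw [mem_polarSet_sub]
    intro a ha
    have := hu a ha
    have e : (a 0 - g 0) * ((u - f g)⁻¹ • w) 0 + (a 1 - g 1) * ((u - f g)⁻¹ • w) 1 =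
        (f a - f g) / (u - f g) := by
      rw [hf a, hf g]; simp; ring
    rw [e, div_le_one hpos]; linarith
  · have e : (x 0 - g 0) * ((u - f g)⁻¹ • w) 0 + (x 1 - g 1) * ((u - f g)⁻¹ • w) 1 =
        (f x - f g) / (u - f g) := by
      rw [hf x, hf g]; simp; ring
    rw [e, lt_div_iff₀ hpos]; linarith

/-- If a hexagon already exhausts the area of the polar of `K`, then every point which is dual to
the whole hexagon belongs to `K`. -/
theorem mem_of_hexagon_exhausts {K : Set Plane} (hK : IsConvexBody K) (hg : stdCentroid ∈ K)
    {t : ℝ} (ht : 0 < t)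
    (m1 : !₂[3 / 2, 0] ∈ polarSet ((fun x => x - stdCentroid) '' K))
    (m2 : !₂[t, t] ∈ polarSet ((fun x => x - stdCentroid) '' K))
    (m3 : !₂[0, 3 / 2] ∈ polarSet ((fun x => x - stdCentroid) '' K))
    (m4 : !₂[-t, 0] ∈ polarSet ((fun x => x - stdCentroid) '' K))
    (m5 : !₂[-(3 / 2), -(3 / 2)] ∈ polarSet ((fun x => x - stdCentroid) '' K))
    (m6 : !₂[0, -t] ∈ polarSet ((fun x => x - stdCentroid) '' K))
    (hD : volume (polarSet ((fun x => x - stdCentroid) '' K)) ≤ ENNReal.ofReal (9 / 2 * t))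
    {x : Plane} (x1 : (x 0 - 1 / 3) * (3 / 2) ≤ 1)
    (x2 : (x 0 - 1 / 3 + (x 1 - 1 / 3)) * t ≤ 1) (x3 : (x 1 - 1 / 3) * (3 / 2) ≤ 1)
    (x4 : (1 / 3 - x 0) * t ≤ 1) (x5 : (1 / 3 - x 0 + (1 / 3 - x 1)) * (3 / 2) ≤ 1)
    (x6 : (1 / 3 - x 1) * t ≤ 1) : x ∈ K := by
  by_contra hx
  obtain ⟨y, hy, hxy⟩ := exists_mem_polarSet_of_notMem hK hg hx
  set L := polarSet ((fun x => x - stdCentroid) '' K) with hL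
  have hLc : Convex ℝ L := convex_polarSet _
  set φ : Plane → ℝ := fun v => (x 0 - 1 / 3) * v 0 + (x 1 - 1 / 3) * v 1 with hφ
  have hφc : Continuous φ := by fun_prop
  have hφl : IsLinearMap ℝ φ :=
    ⟨fun a b => by simp [hφ]; ring, fun r a => by simp [hφ]; ring⟩
  have hyS : 1 < φ y := by simpa [stdCentroid, hφ] using hxy
  have hSo : IsOpen {v | 1 < φ v} := isOpen_lt continuous_const hφc
  have hSc : Convex ℝ {v | 1 < φ v} := convex_halfSpace_gt hφl 1
  have hpos : 0 < volume (L ∩ {v | 1 < φ v}) := by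
    have hcase : 0 < (3 / 2 - y 0) * (3 / 2 - y 1) - (0 - y 0) * (0 - y 1) ∨
        0 < (0 - y 0) * (-(3 / 2) - y 1) - (-(3 / 2) - y 0) * (3 / 2 - y 1) ∨
        0 < (-(3 / 2) - y 0) * (0 - y 1) - (3 / 2 - y 0) * (-(3 / 2) - y 1) := by
      by_contra! hcon
      obtain ⟨i1, i2, i3⟩ := hcon
      linarith
    rcases hcase with hc | hc | hc
    · exact hLc.volume_inter_pos hSc hSo hy hyS m1 m3 (by simpa using hc)
    · exact hLc.volume_inter_pos hSc hSo hy hyS m3 m5 (by simpa using hc)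
    · exact hLc.volume_inter_pos hSc hSo hy hyS m5 m1 (by simpa using hc)
  have hhex : ENNReal.ofReal (9 / 2 * t) ≤ volume (L \ {v | 1 < φ v}) := by
    have hc : Convex ℝ (L \ {v | 1 < φ v}) := by
      have : L \ {v | 1 < φ v} = L ∩ {v | φ v ≤ 1} := by ext v; simp
      rw [this]
      exact hLc.inter (convex_halfSpace_le hφl 1)
    have := hc.volume_ge_hexagon ⟨zero_mem_polarSet _, by simp [hφ]⟩ (α := 3 / 2) (β := t)
      (γ := 3 / 2) (δ := t) (ε := 3 / 2) (ζ := t) (by norm_num) ht (by norm_num) ht (by norm_num) ht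
      ⟨m1, by simp [hφ]; linarith⟩ ⟨m2, by simp [hφ]; linarith⟩ ⟨m3, by simp [hφ]; linarith⟩
      ⟨m4, by simp [hφ]; linarith⟩ ⟨m5, by simp [hφ]; linarith⟩ ⟨m6, by simp [hφ]; linarith⟩
    refine le_trans (le_of_eq ?_) this
    congr 1; ring
  have htot := measure_inter_add_sdiff (μ := volume) L hSo.measurableSet
  have hlt : ENNReal.ofReal (9 / 2 * t) < volume L := by
    rw [← htot, add_comm]
    calc ENNReal.ofReal (9 / 2 * t) < ENNReal.ofReal (9 / 2 * t) + volume (L ∩ {v | 1 < φ v}) :=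
          ENNReal.lt_add_right ENNReal.ofReal_ne_top hpos.ne'
      _ ≤ _ := by gcongr
  exact absurd hD (not_le.2 hlt)

/-- If the area of the polar is not larger than allowed by `hexagon_numeric_eq`, then the three
heights agree. -/
theorem hexagon_heights_eq {L : Set Plane} (hL : Convex ℝ L) (h0 : (0 : Plane) ∈ L)
    (hLtop : volume L ≠ ⊤) {a b c : ℝ} (ha : 0 < a) (hb : 0 < b) (hc : 0 < c)
    (m1 : !₂[3 / 2, 0] ∈ L) (m2 : !₂[1 / a, 1 / a] ∈ L) (m3 : !₂[0, 3 / 2] ∈ L)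
    (m4 : !₂[-(1 / b), 0] ∈ L) (m5 : !₂[-(3 / 2), -(3 / 2)] ∈ L) (m6 : !₂[0, -(1 / c)] ∈ L)
    (upper : (a + b + c) / 2 * volume.real L ≤ 27 / 4) : a = b ∧ b = c := by
  have hD := (ENNReal.ofReal_le_iff_le_toReal hLtop).1
    (hL.volume_ge_hexagon h0 (α := 3 / 2) (β := 1 / a) (γ := 3 / 2) (δ := 1 / b) (ε := 3 / 2)
      (ζ := 1 / c) (by norm_num) (by positivity) (by norm_num) (by positivity) (by norm_num)
      (by positivity) m1 m2 m3 m4 m5 m6)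
  have hD2 : 3 / 2 * (1 / a + 1 / b + 1 / c) ≤ volume.real L :=
    le_trans (le_of_eq (by ring)) hD
  have := mul_le_mul_of_nonneg_left hD2 (by positivity : 0 ≤ (a + b + c) / 2)
  exact hexagon_numeric_eq ha hb hc (by linarith)

theorem three_quarters_le_of_volume_le {L : Set Plane} (hL : Convex ℝ L) (h0 : (0 : Plane) ∈ L)
    (hLtop : volume L ≠ ⊤) {t : ℝ} (ht : 0 < t)
    (m1 : !₂[3 / 2, 0] ∈ L) (m3 : !₂[0, 3 / 2] ∈ L)
    (m4 : !₂[-t, 0] ∈ L) (m5 : !₂[-(3 / 2), -(3 / 2)] ∈ L) (m6 : !₂[0, -t] ∈ L)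
    (hDt : volume.real L ≤ 9 / 2 * t) : 3 / 4 ≤ t := by
  have mid : !₂[3 / 4, 3 / 4] ∈ L := by
    have := hL m1 m3 (a := 1 / 2) (b := 1 / 2) (by norm_num) (by norm_num) (by norm_num)
    convert this using 1
    ext i; fin_cases i <;> simp <;> norm_num
  have hD := (ENNReal.ofReal_le_iff_le_toReal hLtop).1
    (hL.volume_ge_hexagon h0 (α := 3 / 2) (β := 3 / 4) (γ := 3 / 2) (δ := t) (ε := 3 / 2)
      (ζ := t) (by norm_num) (by norm_num) (by norm_num) ht (by norm_num) ht m1 mid m3 m4 m5 m6)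
  have hD2 : 9 / 8 + 3 * t ≤ volume.real L := le_trans (le_of_eq (by ring)) hD
  linarith

theorem StdTriangleIsMaximal.subset_of_exhausts {K : Set Plane}
    (h : StdTriangleIsMaximal K) {s t : ℝ} (hs : 0 ≤ s) (ht : 3 / 4 ≤ t)
    (hst : (s + 1 / 3) * t = 1) (hcap : ∀ x ∈ K, x 0 + x 1 - 1 ≤ s ∧ -x 0 ≤ s ∧ -x 1 ≤ s)
    (hmem : ∀ x : Plane, (x 0 - 1 / 3) * (3 / 2) ≤ 1 → (x 0 - 1 / 3 + (x 1 - 1 / 3)) * t ≤ 1 →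
      (x 1 - 1 / 3) * (3 / 2) ≤ 1 → (1 / 3 - x 0) * t ≤ 1 →
      (1 / 3 - x 0 + (1 / 3 - x 1)) * (3 / 2) ≤ 1 → (1 / 3 - x 1) * t ≤ 1 → x ∈ K) :
    K ⊆ stdTriangle := by
  have hs1 : s ≤ 1 := by
    have := mul_le_mul_of_nonneg_left ht (by linarith : 0 ≤ s + 1 / 3)
    linarith
  have hst0 : 0 ≤ s * t := by positivity
  have hx1 : !₂[1, s] ∈ K := by
    apply hmem <;> simp <;> linarith
  have hx3 : !₂[-s, 1] ∈ K := by
    apply hmem <;> simp <;> linarith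
  have hdet := h.det_le _ h.zero_mem _ hx1 _ hx3
  simp at hdet
  have hs0 : s = 0 := by nlinarith
  intro x hx
  obtain ⟨i1, i2, i3⟩ := hcap x hx
  exact mem_stdTriangle.2 ⟨by linarith, by linarith, by linarith⟩

/-- Only the triangle itself attains equality at the centroid. -/
theorem StdTriangleIsMaximal.subset_of_volume_mul_polar_le {K : Set Plane}
    (h : StdTriangleIsMaximal K) (hK : IsConvexBody K)
    (hX : volume K * volume (polarSet ((fun x => x - stdCentroid) '' K)) ≤
      ENNReal.ofReal (27 / 4)) : K ⊆ stdTriangle := by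
  have hgi := stdCentroid_mem_interior h.subset
  obtain ⟨h₁, h₂, h₃, hcap, hvol⟩ := h.exists_heights hK
  have g0 : stdCentroid 0 = 1 / 3 := by simp [stdCentroid]
  have g1 : stdCentroid 1 = 1 / 3 := by simp [stdCentroid]
  obtain ⟨n1, -, -⟩ := hcap _ h.e_zero_mem
  obtain ⟨-, n2, n3⟩ := hcap _ h.zero_mem
  simp at n1 n2 n3
  have hm := h.hexagon_mem_polarSet (z := stdCentroid) (a := h₁ + 1 / 3) (b := h₂ + 1 / 3)
    (c := h₃ + 1 / 3) (by linarith) (by linarith) (by linarith) (fun x hx => by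
      obtain ⟨i1, i2, i3⟩ := hcap x hx
      rw [g0, g1]
      exact ⟨by linarith, by linarith, by linarith⟩) (by rw [g0, g1]; norm_num)
      (by rw [g0]; norm_num) (by rw [g1]; norm_num)
  rw [g0, g1, show (1 : ℝ) / (1 - 1 / 3) = 3 / 2 by norm_num,
    show (1 : ℝ) / (1 / 3 + 1 / 3) = 3 / 2 by norm_num] at hm
  obtain ⟨m1, m2, m3, m4, m5, m6⟩ := hm
  have hmem := fun t ht m2 m4 m6 hD x =>
    mem_of_hexagon_exhausts hK (interior_subset hgi) (t := t) ht m1 m2 m3 m4 m5 m6 hD (x := x)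
  have hLc := convex_polarSet ((fun x => x - stdCentroid) '' K)
  have hL0 := zero_mem_polarSet ((fun x => x - stdCentroid) '' K)
  generalize polarSet ((fun x => x - stdCentroid) '' K) = L at *
  have hLtop : volume L ≠ ⊤ := fun hT => by
    rw [hT, ENNReal.mul_top h.volume_ne_zero] at hX
    exact ENNReal.ofReal_ne_top (top_le_iff.1 hX)
  have upper : (h₁ + 1 / 3 + (h₂ + 1 / 3) + (h₃ + 1 / 3)) / 2 * volume.real L ≤ 27 / 4 := by
    have hV : volume.real K * volume.real L ≤ 27 / 4 := by
      have := ENNReal.toReal_mono ENNReal.ofReal_ne_top hX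
      rwa [ENNReal.toReal_mul, ENNReal.toReal_ofReal (by norm_num)] at this
    refine (mul_le_mul_of_nonneg_right ?_ measureReal_nonneg).trans hV
    linarith
  obtain ⟨hab, hbc⟩ := hexagon_heights_eq hLc hL0 hLtop (by linarith) (by linarith) (by linarith)
    m1 m2 m3 m4 m5 m6 upper
  obtain rfl : h₁ = h₂ := by linarith
  obtain rfl : h₁ = h₃ := by linarith
  have ht0 : 0 < 1 / (h₁ + 1 / 3) := by positivity
  have hat : (h₁ + 1 / 3) * (1 / (h₁ + 1 / 3)) = 1 := mul_one_div_cancel (by positivity)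
  generalize 1 / (h₁ + 1 / 3) = t at *
  have hDt : volume.real L ≤ 9 / 2 * t := by
    have := mul_le_mul_of_nonneg_right upper (by positivity : 0 ≤ 2 / 3 * t)
    linear_combination this + (-volume.real L) * hat
  refine h.subset_of_exhausts n2
    (three_quarters_le_of_volume_le hLc hL0 hLtop ht0 m1 m3 m4 m5 m6 hDt) hat hcap
    (hmem t ht0 m2 m4 m6 ?_)
  rw [← ofReal_measureReal hLtop]
  exact ENNReal.ofReal_le_ofReal hDt

theorem IsConvexBody.image {K : Set Plane} (hK : IsConvexBody K) (T : Plane ≃ᵃ[ℝ] Plane) :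
    IsConvexBody (T '' K) where
  convex := hK.convex.affine_image (T : Plane →ᵃ[ℝ] Plane)
  isCompact := hK.isCompact.image (AffineEquiv.toContinuousAffineEquiv T).continuous
  nonempty_interior := by
    have := (AffineEquiv.toContinuousAffineEquiv T).toHomeomorph.image_interior K
    have h2 : (T '' interior K) = interior (T '' K) := this
    rw [← h2]
    exact hK.nonempty_interior.image _

theorem isConvexBody_stdTriangle : IsConvexBody stdTriangle where
  convex := convex_convexHull ℝ _
  isCompact := Set.Finite.isCompact_convexHull (𝕜 := ℝ) (Set.toFinite _)
  nonempty_interior := ⟨_, stdCentroid_mem_interior subset_rfl⟩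

/-- A triangle of maximal area in a convex body can be moved to the standard position. -/
theorem IsConvexBody.exists_stdTriangleIsMaximal {K : Set Plane} (hK : IsConvexBody K) :
    ∃ (T : Plane ≃ᵃ[ℝ] Plane) (K₀ : Set Plane), K = T '' K₀ ∧ IsConvexBody K₀ ∧
      StdTriangleIsMaximal K₀ := by
  let D : Plane × Plane × Plane → ℝ := fun x =>
    (x.2.1 0 - x.1 0) * (x.2.2 1 - x.1 1) - (x.2.2 0 - x.1 0) * (x.2.1 1 - x.1 1)
  obtain ⟨z, hz⟩ := hK.nonempty_interior
  have hzK := interior_subset hz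
  obtain ⟨⟨A, B, C⟩, ⟨hA, hB, hC⟩, hmax⟩ :=
    (hK.isCompact.prod (hK.isCompact.prod hK.isCompact)).exists_isMaxOn ⟨(z, z, z), hzK, hzK, hzK⟩
      (f := D) (Continuous.continuousOn (by fun_prop))
  have hmax' (p q r : Plane) (hp : p ∈ K) (hq : q ∈ K) (hr : r ∈ K) : D (p, q, r) ≤ D (A, B, C) :=
    hmax (show (p, q, r) ∈ _ from ⟨hp, hq, hr⟩)
  have hpos : 0 < D (A, B, C) := by
    obtain ⟨ε, hε, h1⟩ := exists_add_smul_mem hz !₂[1, 0]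
    obtain ⟨δ, hδ, h2⟩ := exists_add_smul_mem hz !₂[0, 1]
    refine lt_of_lt_of_le ?_ (hmax' _ _ _ hzK h1 h2)
    simp [D]
    positivity
  have hdet : LinearMap.det (linOfColumns (B - A) (C - A)) = D (A, B, C) := by
    rw [det_linOfColumns]; simp [D]
  let b := (EuclideanSpace.basisFun (Fin 2) ℝ).toBasis
  let L : Plane ≃ₗ[ℝ] Plane :=
    LinearEquiv.ofIsUnitDet (v := b) (v' := b) (f := linOfColumns (B - A) (C - A)) (by
      rw [LinearMap.det_toMatrix, hdet]; exact hpos.ne'.isUnit)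
  let T : Plane ≃ᵃ[ℝ] Plane := L.toAffineEquiv.trans (AffineEquiv.constVAdd ℝ Plane A)
  have hT (x : Plane) : T x = A + (x 0 • (B - A) + x 1 • (C - A)) := by
    rw [← linOfColumns_apply]; rfl
  have hTK (x : Plane) (hx : x ∈ T.symm '' K) : T x ∈ K := by
    obtain ⟨y, hy, rfl⟩ := hx
    simpa using hy
  refine ⟨T, T.symm '' K, ?_, hK.image _, ⟨fun x hx => ?_, fun p hp q hq r hr => ?_⟩⟩
  · rw [← Set.image_comp, show (T ∘ T.symm : Plane → Plane) = id from funext fun x => by simp,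
      Set.image_id]
  · obtain ⟨x0, x1, x2⟩ := mem_stdTriangle.1 hx
    refine ⟨T x, ?_, by simp⟩
    have := hK.convex.add_three_mem hA hB hC (a := 1 - x 0 - x 1) (by linarith) x0 x1 (by ring)
    convert this using 1
    rw [hT]
    module
  · have := hmax' _ _ _ (hTK p hp) (hTK q hq) (hTK r hr)
    have e : D (T p, T q, T r) =
        ((q 0 - p 0) * (r 1 - p 1) - (r 0 - p 0) * (q 1 - p 1)) * D (A, B, C) := by
      simp [D, hT]
      ring
    rw [e] at this
    exact le_of_mul_le_mul_right (by linarith) hpos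

theorem IsConvexBody.le_volumeProduct {K : Set Plane} (hK : IsConvexBody K) :
    ENNReal.ofReal (27 / 4) ≤ volumeProduct K := by
  obtain ⟨T, K₀, rfl, hK₀, h⟩ := hK.exists_stdTriangleIsMaximal
  rw [volumeProduct_image]
  exact h.le_volumeProduct hK₀

theorem volumeProduct_stdTriangle : volumeProduct stdTriangle = ENNReal.ofReal (27 / 4) := by
  refine le_antisymm ?_ isConvexBody_stdTriangle.le_volumeProduct
  calc volumeProduct stdTriangle
      ≤ volume stdTriangle * volume (polarSet ((fun x => x - stdCentroid) '' stdTriangle)) :=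
        mul_le_mul_right
          (iInf_le _ (⟨_, stdCentroid_mem_interior subset_rfl⟩ : interior stdTriangle)) _
    _ ≤ ENNReal.ofReal (1 / 2) * ENNReal.ofReal (27 / 2) :=
        mul_le_mul' volume_stdTriangle.le volume_polar_stdTriangle_le
    _ = ENNReal.ofReal (27 / 4) := by rw [← ENNReal.ofReal_mul (by norm_num)]; norm_num

theorem IsConvexBody.eq_image_stdTriangle {K : Set Plane} (hK : IsConvexBody K)
    (hP : volumeProduct K = ENNReal.ofReal (27 / 4)) :
    ∃ T : Plane ≃ᵃ[ℝ] Plane, K = T '' stdTriangle := by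
  obtain ⟨T, K₀, rfl, hK₀, h⟩ := hK.exists_stdTriangleIsMaximal
  rw [volumeProduct_image] at hP
  refine ⟨T, congrArg _ (Set.Subset.antisymm ?_ h.subset)⟩
  exact h.subset_of_volume_mul_polar_le hK₀ (h.volume_mul_polar_centroid_le hK₀ hP)

/-- Mahler's theorem in the plane (equality case by Meyer): every convex body `K ⊆ ℝ²`
satisfies `P(K) ≥ P(Δ₂) = 27/4`, with equality iff `K` is a triangle, i.e. an invertible
affine image of a fixed nondegenerate simplex. -/
theorem mahler_plane (K : Set (EuclideanSpace ℝ (Fin 2))) (hK : IsConvexBody K) :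
    (27 / 4 : ℝ≥0∞) ≤ volumeProduct K ∧
    volumeProduct stdTriangle = (27 / 4 : ℝ≥0∞) ∧
    (volumeProduct K = (27 / 4 : ℝ≥0∞) ↔
      ∃ T : EuclideanSpace ℝ (Fin 2) ≃ᵃ[ℝ] EuclideanSpace ℝ (Fin 2),
        K = T '' stdTriangle) := by
  have e : (27 / 4 : ℝ≥0∞) = ENNReal.ofReal (27 / 4) := by
    rw [ENNReal.ofReal_div_of_pos (by norm_num), ENNReal.ofReal_ofNat, ENNReal.ofReal_ofNat]
  rw [e]
  refine ⟨hK.le_volumeProduct, volumeProduct_stdTriangle, hK.eq_image_stdTriangle, ?_⟩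
  rintro ⟨T, rfl⟩
  rw [volumeProduct_image, volumeProduct_stdTriangle]
end
end
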